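/- arXiv:0704.0277 — 2 statements merged into one kernel-verified Lean document; each statement's English description precedes it below -/
import Mathlib

section
/- Let V_1,…,V_m be finite disjoint sets, let X be a simplicial complex contained in the join V_1 * ⋯ * V_m, let π: V_1*⋯*V_m → Δ_{m-1} be the simplicial projection sending every vertex of V_i to the vertex i of the (m−1)-simplex, and let r = max over points x of the geometric realization |X| of the cardinality |π^{-1}(π(x))|. Then the rational Leray number of the image complex satisfies L(π(X)) ≤ r·L(X) + r − 1. -/
open Classical in
/-- A (possibly abstract) simplicial complex: a set of finsets closed under taking subsets. -/
def IsComplex {V : Type*} (X : Set (Finset V)) : Prop := ∀ s ∈ X, ∀ t ⊆ s, t ∈ X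

/-- Ordered `n`-tuples of vertices spanning a simplex of `X` (repetitions allowed). -/
def Tup {V : Type*} [DecidableEq V] (X : Set (Finset V)) (n : ℕ) : Type _ :=
  {σ : Fin n → V // Finset.image σ Finset.univ ∈ X}

/-- Rational ordered simplicial chains on tuples of `n` vertices. -/
abbrev Chains {V : Type*} [DecidableEq V] (X : Set (Finset V)) (n : ℕ) := Tup X n →₀ ℚ

open Classical in
noncomputable def gen {V : Type*} [DecidableEq V] (X : Set (Finset V)) {n : ℕ}
    (τ : Fin n → V) : Chains X n :=
  if h : Finset.image τ Finset.univ ∈ X then Finsupp.single ⟨τ, h⟩ 1 else 0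

/-- The simplicial boundary map. -/
noncomputable def bdry {V : Type*} [DecidableEq V] (X : Set (Finset V)) (n : ℕ) :
    Chains X (n + 1) →ₗ[ℚ] Chains X n :=
  Finsupp.lsum ℚ fun σ => LinearMap.toSpanSingleton ℚ (Chains X n)
    (∑ i : Fin (n + 1), ((-1 : ℚ) ^ (i : ℕ)) • gen X (σ.1 ∘ i.succAbove))

/-- Reduced rational homology `H̃_i(X;ℚ)` (chains on `i+1` vertices correspond to
`i`-dimensional simplices; tuples with `0` vertices give the augmentation). -/
noncomputable abbrev reducedHomology {V : Type*} [DecidableEq V] (X : Set (Finset V)) (i : ℕ) :=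
  LinearMap.ker (bdry X i) ⧸
    Submodule.comap (LinearMap.ker (bdry X i)).subtype (LinearMap.range (bdry X (i + 1)))

/-- `H̃_i(X;ℚ) = 0`. -/
def HomologyVanishes {V : Type*} [DecidableEq V] (X : Set (Finset V)) (i : ℕ) : Prop :=
  ∀ x : reducedHomology X i, x = 0

/-- The induced subcomplex on a vertex subset. -/
def induced {V : Type*} (X : Set (Finset V)) (S : Finset V) : Set (Finset V) :=
  {s ∈ X | s ⊆ S}

/-- The rational Leray number `L(X)`. -/
noncomputable def lerayNumber {V : Type*} [DecidableEq V] (X : Set (Finset V)) : ℕ :=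
  sInf {d | ∀ S : Finset V, ∀ i, d ≤ i → HomologyVanishes (induced X S) i}

/-- The geometric realization of a complex `X`: convex-combination weight functions whose
support is a simplex of `X`. -/
def geomPt {V : Type*} [Fintype V] (X : Set (Finset V)) : Type _ :=
  {f : V → ℝ // (∀ v, 0 ≤ f v) ∧ (∑ v, f v) = 1 ∧ ∃ s ∈ X, ∀ v, f v ≠ 0 ↔ v ∈ s}

/-- The affine extension of the vertex projection `p` to the geometric realization. -/
noncomputable def projPt {V : Type*} [Fintype V] {m : ℕ} (p : V → Fin m) (f : V → ℝ) :
    Fin m → ℝ :=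
  fun i => ∑ v ∈ Finset.univ.filter (fun v => p v = i), f v

/-- The image complex `π(X)` under the simplicial projection induced by `p`. -/
def imageComplex {V : Type*} [DecidableEq V] {m : ℕ} (p : V → Fin m)
    (X : Set (Finset V)) : Set (Finset (Fin m)) :=
  {t : Finset (Fin m) | ∃ s ∈ X, t = s.image p}


universe u v w

/-- Functors from the Boolean lattice of finite subsets of `α` to rational vector spaces. -/
structure SqMod (α : Type) [DecidableEq α] where
  obj : Finset α → Type u
  [acg : ∀ F, AddCommGroup (obj F)]
  [mod : ∀ F, Module ℚ (obj F)]
  map : ∀ {F G : Finset α}, F ⊆ G → obj F →ₗ[ℚ] obj G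
  map_id : ∀ (F : Finset α) (h : F ⊆ F) (x : obj F), map h x = x
  map_comp : ∀ {F G H : Finset α} (h₁ : F ⊆ G) (h₂ : G ⊆ H) (x : obj F),
    map h₂ (map h₁ x) = map (h₁.trans h₂) x

attribute [instance] SqMod.acg SqMod.mod

namespace SqMod

variable {α : Type} [DecidableEq α]

/-- The vertex set of a tuple. -/
abbrev im {n : ℕ} (σ : Fin n → α) : Finset α := Finset.image σ Finset.univ

theorem im_comp {n k : ℕ} (σ : Fin n → α) (φ : Fin k → Fin n) : im (σ ∘ φ) ⊆ im σ := by
  intro x hx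
  simp only [Finset.mem_image, Finset.mem_univ, true_and, Function.comp] at hx ⊢
  obtain ⟨i, hi⟩ := hx
  exact ⟨_, hi⟩

/-- Cochains on `n`-tuples. -/
abbrev Coch (M : SqMod.{u} α) (n : ℕ) := (σ : Fin n → α) → M.obj (im σ)

/-- The coboundary. -/
def cob (M : SqMod.{u} α) {n : ℕ} (f : Coch M n) : Coch M (n + 1) :=
  fun τ => ∑ i : Fin (n + 1), (-1 : ℚ) ^ (i : ℕ) • M.map (im_comp τ i.succAbove) (f (τ ∘ i.succAbove))

/-- Vanishing of the cohomology at `(n+1)`-tuples inside `F`. -/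
def Van (M : SqMod.{u} α) (F : Finset α) (n : ℕ) : Prop :=
  ∀ f : Coch M (n + 1), (∀ τ, im τ ⊆ F → M.cob f τ = 0) →
    ∃ g : Coch M n, ∀ σ, im σ ⊆ F → M.cob g σ = f σ

/-- Regularity at most `d`. -/
def RegLE (M : SqMod.{u} α) (d : ℕ) : Prop := ∀ F n, d ≤ n → Van M F n

theorem RegLE.mono {M : SqMod.{u} α} {d e : ℕ} (h : RegLE M d) (hde : d ≤ e) : RegLE M e :=
  fun F n hn => h F n (hde.trans hn)

theorem altsum2 {A β : Type*} [AddCommGroup A] [Module ℚ A] {n : ℕ} (τ : Fin (n + 2) → β)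
    (H : (Fin n → β) → A) :
    ∑ i : Fin (n + 2), ∑ j : Fin (n + 1), ((-1 : ℚ) ^ (i : ℕ) * (-1 : ℚ) ^ (j : ℕ)) •
      H ((τ ∘ i.succAbove) ∘ j.succAbove) = 0 := by
  rw [← Finset.sum_product']
  refine Finset.sum_involution
    (fun (x : Fin (n + 2) × Fin (n + 1)) _ => (x.1.succAbove x.2, x.2.predAbove x.1)) ?_ ?_ ?_ ?_
  · rintro ⟨i, j⟩ -
    have h1 : (τ ∘ (i.succAbove j).succAbove) ∘ (j.predAbove i).succAbove
        = (τ ∘ i.succAbove) ∘ j.succAbove := by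
      funext k
      simp only [Function.comp]
      rw [Fin.succAbove_succAbove_succAbove_predAbove]
    simp only [h1]
    rw [← add_smul, ← pow_add, ← pow_add, Fin.neg_one_pow_succAbove_add_predAbove]
    simp
  · rintro ⟨i, j⟩ - - h
    simp only [Prod.mk.injEq] at h
    exact Fin.succAbove_ne _ _ h.1
  · rintro ⟨i, j⟩ -
    simp
  · rintro ⟨i, j⟩ -
    simp [Fin.succAbove_succAbove_predAbove, Fin.predAbove_predAbove_succAbove]

open Classical in
theorem cob_cob (M : SqMod.{u} α) {n : ℕ} (f : Coch M n) (τ : Fin (n + 2) → α) :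
    M.cob (M.cob f) τ = 0 := by
  have := altsum2 τ (fun σ => if h : im σ ⊆ im τ then M.map h (f σ) else 0)
  rw [← this]
  unfold cob
  refine Finset.sum_congr rfl fun i _ => ?_
  rw [map_sum, Finset.smul_sum]
  refine Finset.sum_congr rfl fun j _ => ?_
  rw [dif_pos ((im_comp _ _).trans (im_comp τ _)), map_smul, smul_smul, map_comp]

theorem cob_add (M : SqMod.{u} α) {n : ℕ} (f g : Coch M n) (τ) :
    M.cob (f + g) τ = M.cob f τ + M.cob g τ := by
  simp [cob, Finset.sum_add_distrib]

theorem cob_sub (M : SqMod.{u} α) {n : ℕ} (f g : Coch M n) (τ) :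
    M.cob (f - g) τ = M.cob f τ - M.cob g τ := by
  simp [cob, Finset.sum_sub_distrib, smul_sub]

/-- `cob` at `τ` only depends on values on faces. -/
theorem cob_congr (M : SqMod.{u} α) {n : ℕ} (f g : Coch M n) (τ : Fin (n + 1) → α)
    (h : ∀ σ, im σ ⊆ im τ → f σ = g σ) : M.cob f τ = M.cob g τ := by
  unfold cob
  refine Finset.sum_congr rfl fun i _ => ?_
  rw [h _ (im_comp _ _)]

/-- Natural transformations. -/
structure Hom (M : SqMod.{u} α) (N : SqMod.{v} α) where
  app : ∀ F, M.obj F →ₗ[ℚ] N.obj F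
  nat : ∀ {F G : Finset α} (h : F ⊆ G) (x : M.obj F), app G (M.map h x) = N.map h (app F x)

theorem Hom.cob {M : SqMod.{u} α} {N : SqMod.{v} α} (φ : Hom M N) {n : ℕ} (f : Coch M n) (τ) :
    N.cob (fun σ => φ.app _ (f σ)) τ = φ.app _ (M.cob f τ) := by
  simp [SqMod.cob, φ.nat]

theorem van_retract {M : SqMod.{u} α} {N : SqMod.{v} α} (i : Hom M N) (q : Hom N M)
    (hiq : ∀ F x, q.app F (i.app F x) = x) {F n} (h : Van N F n) : Van M F n := by
  intro f hf
  obtain ⟨g, hg⟩ := h (fun σ => i.app _ (f σ)) (fun τ hτ => by rw [i.cob, hf τ hτ, map_zero])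
  refine ⟨fun σ => q.app _ (g σ), fun σ hσ => ?_⟩
  rw [q.cob, hg σ hσ, hiq]

theorem van_of_bij {M : SqMod.{u} α} {N : SqMod.{v} α} (i : Hom M N)
    (hi : ∀ F, Function.Bijective (i.app F)) {F n} (h : Van N F n) : Van M F n := by
  refine van_retract i ⟨fun F => (LinearEquiv.ofBijective _ (hi F)).symm.toLinearMap, ?_⟩ ?_ h
  · intro F G h x
    obtain ⟨y, rfl⟩ := (hi F).2 x
    have e1 : (LinearEquiv.ofBijective _ (hi F)).symm ((i.app F) y) = y :=
      (LinearEquiv.ofBijective _ (hi F)).symm_apply_apply y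
    have e2 : (LinearEquiv.ofBijective _ (hi G)).symm ((i.app G) (M.map h y)) = M.map h y :=
      (LinearEquiv.ofBijective _ (hi G)).symm_apply_apply _
    simp only [LinearEquiv.coe_coe]
    rw [e1, ← i.nat, e2]
  · intro F x
    exact (LinearEquiv.ofBijective _ (hi F)).symm_apply_apply x

/-- Short exact sequences. -/
structure SES {K : SqMod.{u} α} {P : SqMod.{v} α} {M : SqMod.{w} α}
    (i : Hom K P) (q : Hom P M) : Prop where
  inj : ∀ F, Function.Injective (i.app F)
  zero : ∀ F x, q.app F (i.app F x) = 0
  exact : ∀ F x, q.app F x = 0 → ∃ y, i.app F y = x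
  surj : ∀ F, Function.Surjective (q.app F)

theorem SES.van_right {K : SqMod.{u} α} {P : SqMod.{v} α} {M : SqMod.{w} α}
    {i : Hom K P} {q : Hom P M} (S : SES i q) {F n} (hP : Van P F n) (hK : Van K F (n + 1)) :
    Van M F n := by
  intro f hf
  choose f' hf' using fun σ => S.surj (im σ) (f σ)
  have h1 : ∀ τ, im τ ⊆ F → ∃ y, i.app _ y = P.cob f' τ := by
    intro τ hτ
    refine S.exact _ _ ?_
    rw [← q.cob, show (fun σ => q.app _ (f' σ)) = f from funext hf', hf τ hτ]
  have h2 : ∀ τ, ∃ y, im τ ⊆ F → i.app _ y = P.cob f' τ := by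
    intro τ
    by_cases hτ : im τ ⊆ F
    · obtain ⟨y, hy⟩ := h1 τ hτ
      exact ⟨y, fun _ => hy⟩
    · exact ⟨0, fun h => absurd h hτ⟩
  choose k hk using h2
  obtain ⟨l, hl⟩ := hK k (by
    intro τ hτ
    apply S.inj
    rw [← i.cob, map_zero, P.cob_congr _ (P.cob f') τ (fun σ hσ => hk σ (hσ.trans hτ)), cob_cob])
  obtain ⟨g, hg⟩ := hP (f' - fun σ => i.app _ (l σ)) (by
    intro τ hτ
    rw [cob_sub, i.cob, hl τ hτ, hk τ hτ, sub_self])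
  refine ⟨fun σ => q.app _ (g σ), fun σ hσ => ?_⟩
  rw [q.cob, hg σ hσ]
  simp [S.zero, hf']

theorem SES.van_left {K : SqMod.{u} α} {P : SqMod.{v} α} {M : SqMod.{w} α}
    {i : Hom K P} {q : Hom P M} (S : SES i q) {F n} (hP : Van P F (n + 1)) (hM : Van M F n) :
    Van K F (n + 1) := by
  intro f hf
  obtain ⟨g, hg⟩ := hP (fun σ => i.app _ (f σ)) (fun τ hτ => by rw [i.cob, hf τ hτ, map_zero])
  obtain ⟨h, hh⟩ := hM (fun σ => q.app _ (g σ)) (fun τ hτ => by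
    rw [q.cob, hg τ hτ, S.zero])
  choose h' hh' using fun σ => S.surj (im σ) (h σ)
  have h2 : ∀ τ, ∃ y, im τ ⊆ F → i.app _ y = g τ - P.cob h' τ := by
    intro τ
    by_cases hτ : im τ ⊆ F
    · obtain ⟨y, hy⟩ := S.exact (im τ) (g τ - P.cob h' τ) (by
        rw [map_sub, ← q.cob, show (fun σ => q.app _ (h' σ)) = h from funext hh', hh τ hτ, sub_self])
      exact ⟨y, fun _ => hy⟩
    · exact ⟨0, fun h => absurd h hτ⟩
  choose k hk using h2
  refine ⟨k, fun σ hσ => S.inj _ ?_⟩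
  rw [← i.cob, P.cob_congr _ (g - P.cob h') σ (fun τ hτ => hk τ (hτ.trans hσ)), cob_sub, cob_cob,
    sub_zero, hg σ hσ]

theorem SES.reg_right {K : SqMod.{u} α} {P : SqMod.{v} α} {M : SqMod.{w} α}
    {i : Hom K P} {q : Hom P M} (S : SES i q) {d} (hP : RegLE P d) (hK : RegLE K (d + 1)) :
    RegLE M d := fun F n hn => S.van_right (hP F n hn) (hK F (n + 1) (by omega))

theorem SES.reg_left {K : SqMod.{u} α} {P : SqMod.{v} α} {M : SqMod.{w} α}
    {i : Hom K P} {q : Hom P M} (S : SES i q) {d} (hP : RegLE P (d + 1)) (hM : RegLE M d) :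
    RegLE K (d + 1) := by
  intro F n hn
  obtain ⟨n, rfl⟩ : ∃ k, n = k + 1 := ⟨n - 1, by omega⟩
  exact S.van_left (hP F _ hn) (hM F n (by omega))

end SqMod

namespace SqMod

variable {α : Type} [DecidableEq α]

/-- Constant functor. -/
def const (α : Type) [DecidableEq α] (W : Type u) [AddCommGroup W] [Module ℚ W] : SqMod.{u} α where
  obj _ := W
  map _ := LinearMap.id
  map_id _ _ _ := rfl
  map_comp _ _ _ := rfl

theorem im_cons {n : ℕ} (e : α) (σ : Fin n → α) (F : Finset α) (he : e ∈ F) (hσ : im σ ⊆ F) :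
    im (Fin.cons e σ : Fin (n + 1) → α) ⊆ F := by
  intro x hx
  simp only [Finset.mem_image, Finset.mem_univ, true_and] at hx
  obtain ⟨i, rfl⟩ := hx
  refine Fin.cases ?_ (fun j => ?_) i
  · simpa using he
  · simp only [Fin.cons_succ]
    exact hσ (Finset.mem_image_of_mem _ (Finset.mem_univ _))

theorem const_reg (W : Type u) [AddCommGroup W] [Module ℚ W] : RegLE (const α W) 0 := by
  intro F n _ f hf
  by_cases hF : ∃ e, e ∈ F
  · obtain ⟨e, he⟩ := hF
    refine ⟨fun σ => f (Fin.cons e σ), fun σ hσ => ?_⟩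
    have h := hf (Fin.cons e σ) (im_cons e σ F he hσ)
    unfold cob at h ⊢
    rw [Fin.sum_univ_succ] at h
    have h0 : (Fin.cons e σ : Fin (n + 2) → α) ∘ (Fin.succAbove 0) = σ := by
      funext k; simp
    have hs : ∀ i : Fin (n + 1), (Fin.cons e σ : Fin (n + 2) → α) ∘ (Fin.succAbove i.succ)
        = Fin.cons e (σ ∘ i.succAbove) := by
      intro i
      funext k
      refine Fin.cases ?_ (fun k => ?_) k <;> simp
    let f' : (Fin (n + 1) → α) → W := fun σ => f σ
    have h' : ((-1 : ℚ) ^ (0 : ℕ)) • f' ((Fin.cons e σ : Fin (n + 2) → α) ∘ (Fin.succAbove 0)) +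
      ∑ i : Fin (n + 1), (-1 : ℚ) ^ ((i.succ : Fin (n + 2)) : ℕ) •
        f' ((Fin.cons e σ : Fin (n + 2) → α) ∘ (Fin.succAbove i.succ)) = 0 := h
    change ∑ i : Fin (n + 1), (-1 : ℚ) ^ (i : ℕ) •
        f' (Fin.cons e (σ ∘ i.succAbove) : Fin (n + 1) → α) = f' σ
    rw [h0, pow_zero, one_smul] at h'
    rw [eq_neg_of_add_eq_zero_left h', ← Finset.sum_neg_distrib]
    refine Finset.sum_congr rfl fun i _ => ?_
    rw [hs i, Fin.val_succ, pow_succ]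
    simp
  · refine ⟨fun _ => 0, fun σ hσ => ?_⟩
    exact absurd ⟨σ 0, hσ (Finset.mem_image_of_mem _ (Finset.mem_univ _))⟩ hF


/-- Subfunctors. -/
def sub (Q : SqMod.{u} α) (S : ∀ F, Submodule ℚ (Q.obj F))
    (hS : ∀ {F G : Finset α} (h : F ⊆ G), ∀ x ∈ S F, Q.map h x ∈ S G) : SqMod.{u} α where
  obj F := S F
  map h := (Q.map h).restrict (hS h)
  map_id F h x := Subtype.ext (Q.map_id F h x.1)
  map_comp h₁ h₂ x := Subtype.ext (Q.map_comp h₁ h₂ x.1)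

/-- Inclusion of a subfunctor. -/
def subIncl (Q : SqMod.{u} α) (S : ∀ F, Submodule ℚ (Q.obj F))
    (hS : ∀ {F G : Finset α} (h : F ⊆ G), ∀ x ∈ S F, Q.map h x ∈ S G) : Hom (sub Q S hS) Q where
  app F := (S F).subtype
  nat _ _ := rfl

theorem subIncl_inj (Q : SqMod.{u} α) (S : ∀ F, Submodule ℚ (Q.obj F))
    (hS : ∀ {F G : Finset α} (h : F ⊆ G), ∀ x ∈ S F, Q.map h x ∈ S G) (F) :
    Function.Injective ((subIncl Q S hS).app F) := Subtype.val_injective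

/-- Elements supported above `G`. -/
def trSub (G : Finset α) (Q : SqMod.{u} α) (F : Finset α) : Submodule ℚ (Q.obj F) where
  carrier := {x | ¬ G ⊆ F → x = 0}
  zero_mem' := fun _ => rfl
  add_mem' := by
    intro a b ha hb h
    rw [ha h, hb h, add_zero]
  smul_mem' := by
    intro c a ha h
    rw [ha h, smul_zero]

theorem trSub_map (G : Finset α) (Q : SqMod.{u} α) {F F' : Finset α} (h : F ⊆ F') :
    ∀ x ∈ trSub G Q F, Q.map h x ∈ trSub G Q F' := by
  intro x hx hG
  rw [hx (fun h' => hG (h'.trans h)), map_zero]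

/-- Truncation: keep only the part over sets containing `G`. -/
def Tr (G : Finset α) (Q : SqMod.{u} α) : SqMod.{u} α :=
  sub Q (trSub G Q) (trSub_map G Q)

theorem Tr_empty {Q : SqMod.{u} α} {d} (h : RegLE Q d) : RegLE (Tr ∅ Q) d := by
  intro F n hn
  refine van_of_bij (subIncl Q _ (trSub_map ∅ Q)) ?_ (h F n hn)
  intro F
  refine ⟨subIncl_inj _ _ _ _, fun x => ⟨⟨x, fun h => absurd (Finset.empty_subset _) h⟩, rfl⟩⟩

/-- Inclusion of truncations. -/
def TrIncl {G G' : Finset α} (h : G ⊆ G') (Q : SqMod.{u} α) : Hom (Tr G' Q) (Tr G Q) where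
  app _ := Submodule.inclusion (fun _ hx hG => hx (fun h' => hG (h.trans h')))
  nat _ _ := rfl

theorem Tr_insert {Q : SqMod.{u} α} {d} (e : α) (G : Finset α) (hQ : RegLE (Tr G Q) d) :
    RegLE (Tr (insert e G) Q) (d + 1) := by
  intro F n hn
  obtain ⟨n, rfl⟩ : ∃ k, n = k + 1 := ⟨n - 1, by omega⟩
  intro f hf
  let i := TrIncl (Finset.subset_insert e G) Q
  have hinj : ∀ F, Function.Injective (i.app F) :=
    fun F x y hxy => by
      have := congrArg Subtype.val hxy
      exact Subtype.ext this
  obtain ⟨g, hg⟩ := hQ F (n + 1) (by omega) (fun σ => i.app _ (f σ))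
    (fun τ hτ => by rw [i.cob, hf τ hτ, map_zero])
  obtain ⟨h, hh⟩ := hQ (F.erase e) n (by omega) g (by
    intro τ hτ
    rw [hg τ (hτ.trans (Finset.erase_subset _ _))]
    have : f τ = 0 := Subtype.ext ((f τ).2 (fun h' =>
      Finset.notMem_erase e F (hτ (h' (Finset.mem_insert_self _ _)))))
    rw [this, map_zero])
  have h2 : ∀ σ, ∃ y, im σ ⊆ F → i.app _ y = g σ - (Tr G Q).cob h σ := by
    intro σ
    by_cases hσ : im σ ⊆ F
    · refine ⟨⟨(g σ - (Tr G Q).cob h σ).1, ?_⟩, fun _ => rfl⟩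
      intro hne
      by_cases he : e ∈ im σ
      · exact (g σ - (Tr G Q).cob h σ).2 (fun hG => hne (Finset.insert_subset he hG))
      · rw [hh σ (fun x hx => Finset.mem_erase.2 ⟨fun hxe => he (hxe ▸ hx), hσ hx⟩), sub_self]
        rfl
    · exact ⟨0, fun h => absurd h hσ⟩
  choose k hk using h2
  refine ⟨k, fun σ hσ => hinj _ ?_⟩
  rw [← i.cob, (Tr G Q).cob_congr _ (g - (Tr G Q).cob h) σ (fun τ hτ => hk τ (hτ.trans hσ)),
    cob_sub, cob_cob, sub_zero, hg σ hσ]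

theorem Tr_reg {Q : SqMod.{u} α} {d} (hQ : RegLE Q d) (G : Finset α) :
    RegLE (Tr G Q) (d + G.card) := by
  induction G using Finset.induction_on with
  | empty => exact Tr_empty hQ
  | insert e G he ih =>
    rw [Finset.card_insert_of_notMem he, ← add_assoc]
    exact Tr_insert e G ih

/-- Products. -/
def pi {ι : Type} (M : ι → SqMod.{u} α) : SqMod.{u} α where
  obj F := ∀ i, (M i).obj F
  map h := LinearMap.pi fun i => (M i).map h ∘ₗ LinearMap.proj i
  map_id F h x := funext fun i => (M i).map_id F h (x i)
  map_comp h₁ h₂ x := funext fun i => (M i).map_comp h₁ h₂ (x i)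

/-- Projections. -/
def piProj {ι : Type} (M : ι → SqMod.{u} α) (i : ι) : Hom (pi M) (M i) where
  app _ := LinearMap.proj i
  nat _ _ := rfl

theorem pi_reg {ι : Type} {M : ι → SqMod.{u} α} {d} (h : ∀ i, RegLE (M i) d) :
    RegLE (pi M) d := by
  intro F n hn f hf
  have h1 : ∀ i, ∃ g : Coch (M i) n, ∀ σ, im σ ⊆ F → (M i).cob g σ = f σ i := by
    intro i
    refine h i F n hn (fun σ => f σ i) (fun τ hτ => ?_)
    have := (piProj M i).cob f τ
    rw [hf τ hτ, map_zero] at this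
    exact this
  choose g hg using h1
  refine ⟨fun σ i => g i σ, fun σ hσ => funext fun i => ?_⟩
  rw [← hg i σ hσ]
  exact ((piProj M i).cob (fun σ i => g i σ) σ).symm

/-- Contravariant set valued functors. -/
structure SetF (α : Type) [DecidableEq α] where
  obj : Finset α → Type u
  res : ∀ {F G : Finset α}, F ⊆ G → obj G → obj F
  res_id : ∀ (F : Finset α) (h : F ⊆ F) (x : obj F), res h x = x
  res_comp : ∀ {F G H : Finset α} (h₁ : F ⊆ G) (h₂ : G ⊆ H) (x : obj H),
    res h₁ (res h₂ x) = res (h₁.trans h₂) x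

/-- Functions on `E` with values in `M`. -/
def fn (E : SetF.{u} α) (M : SqMod.{u} α) : SqMod.{u} α where
  obj F := E.obj F → M.obj F
  map h :=
    { toFun := fun φ e => M.map h (φ (E.res h e))
      map_add' := fun a b => by funext e; simp
      map_smul' := fun c a => by funext e; simp }
  map_id F h x := by
    funext e
    simp [E.res_id, M.map_id]
  map_comp h₁ h₂ x := by
    funext e
    simp [E.res_comp, M.map_comp]

/-- Postcomposition. -/
def fnMap (E : SetF.{u} α) {M N : SqMod.{u} α} (φ : Hom M N) : Hom (fn E M) (fn E N) where
  app F :=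
    { toFun := fun x e => φ.app F (x e)
      map_add' := fun a b => by funext e; exact map_add _ _ _
      map_smul' := fun c a => by funext e; exact map_smul _ _ _ }
  nat h x := by
    funext e
    exact φ.nat h _

theorem fn_ses (E : SetF.{u} α) {K P M : SqMod.{u} α} {i : Hom K P} {q : Hom P M} (S : SES i q) :
    SES (fnMap E i) (fnMap E q) where
  inj F x y h := funext fun e => S.inj F (congrFun h e)
  zero F x := funext fun e => S.zero F (x e)
  exact F x h := by
    choose y hy using fun e => S.exact F (x e) (congrFun h e)
    exact ⟨y, funext hy⟩
  surj F x := by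
    choose y hy using fun e => S.surj F (x e)
    exact ⟨y, funext hy⟩

theorem fn_pi_reg (E : SetF.{u} α) {ι : Type} {M : ι → SqMod.{u} α} {d}
    (h : ∀ i, RegLE (fn E (M i)) d) : RegLE (fn E (pi M)) d := by
  intro F n hn
  let j : Hom (fn E (pi M)) (pi fun i => fn E (M i)) :=
    { app := fun F =>
        { toFun := fun x i e => x e i
          map_add' := fun _ _ => rfl
          map_smul' := fun _ _ => rfl }
      nat := fun _ _ => rfl }
  refine van_of_bij j ?_ (pi_reg h F n hn)
  intro F
  exact ⟨fun x y hxy => funext fun e => funext fun i => congrFun (congrFun hxy i) e,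
    fun x => ⟨fun e i => x i e, rfl⟩⟩

theorem fn_Tr_reg (E : SetF.{u} α) {M : SqMod.{u} α} {d} (h : RegLE (fn E M) d) (G : Finset α) :
    RegLE (fn E (Tr G M)) (d + G.card) := by
  intro F n hn
  let j : Hom (fn E (Tr G M)) (Tr G (fn E M)) :=
    { app := fun F =>
        { toFun := fun x => ⟨fun e => (x e).1, fun hG => funext fun e => (x e).2 hG⟩
          map_add' := fun _ _ => rfl
          map_smul' := fun _ _ => rfl }
      nat := fun _ _ => rfl }
  refine van_of_bij j ?_ (Tr_reg h G F n hn)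
  intro F
  refine ⟨fun x y hxy => funext fun e => Subtype.ext ?_, fun x =>
    ⟨fun e => ⟨x.1 e, fun hG => congrFun (x.2 hG) e⟩, rfl⟩⟩
  exact congrFun (congrArg Subtype.val hxy) e

end SqMod

namespace SqMod

set_option linter.unusedSectionVars false

variable {α : Type} [DecidableEq α] [Fintype α]

/-- The free module covering `M` by its elements in degrees at most `a`. -/
def Fr (M : SqMod.{u} α) (a : ℕ) : SqMod.{u} α :=
  pi fun G : {G : Finset α // G.card ≤ a} => Tr G.1 (const α (M.obj G.1))

/-- Coordinates in the free module. -/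
def crd (M : SqMod.{u} α) (a : ℕ) (F : Finset α) (G : {G : Finset α // G.card ≤ a}) :
    (Fr M a).obj F →ₗ[ℚ] M.obj G.1 where
  toFun x := (x G).1
  map_add' _ _ := rfl
  map_smul' _ _ := rfl

theorem crd_zero (M : SqMod.{u} α) (a : ℕ) (F : Finset α) (G : {G : Finset α // G.card ≤ a})
    (x : (Fr M a).obj F) (h : ¬ G.1 ⊆ F) : crd M a F G x = 0 := (x G).2 h

theorem crd_map (M : SqMod.{u} α) (a : ℕ) {F F' : Finset α} (h : F ⊆ F')
    (G : {G : Finset α // G.card ≤ a}) (x : (Fr M a).obj F) :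
    crd M a F' G ((Fr M a).map h x) = crd M a F G x := rfl

theorem crd_ext (M : SqMod.{u} α) (a : ℕ) {F : Finset α} (x : (Fr M a).obj F)
    (h : ∀ G, crd M a F G x = 0) : x = 0 := funext fun G => Subtype.ext (h G)

theorem crd_single (M : SqMod.{u} α) (a : ℕ) {F : Finset α} (G : {G : Finset α // G.card ≤ a})
    (h : G.1 ⊆ F) (w : M.obj G.1) : ∃ x : (Fr M a).obj F, crd M a F G x = w ∧
      ∀ G', G' ≠ G → crd M a F G' x = 0 := by
  classical
  let y : (Tr G.1 (const α (M.obj G.1))).obj F := ⟨w, fun h' => absurd h h'⟩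
  let x : ∀ G : {G : Finset α // G.card ≤ a}, (Tr G.1 (const α (M.obj G.1))).obj F :=
    Pi.single G y
  have h1 : x G = y := Pi.single_eq_same _ _
  have h2 : ∀ G', G' ≠ G → x G' = 0 := fun G' h => Pi.single_eq_of_ne h _
  exact ⟨x, congrArg Subtype.val h1, fun G' h' => congrArg Subtype.val (h2 G' h')⟩

open Classical in
/-- The canonical map from the free module. -/
noncomputable def eps (M : SqMod.{u} α) (a : ℕ) : Hom (Fr M a) M where
  app F := ∑ G : {G : Finset α // G.card ≤ a}, if h : G.1 ⊆ F then
      M.map h ∘ₗ crd M a F G else 0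
  nat := by
    intro F F' hF x
    rw [LinearMap.sum_apply, LinearMap.sum_apply, map_sum]
    refine Finset.sum_congr rfl fun G _ => ?_
    by_cases h : G.1 ⊆ F
    · rw [dif_pos h, dif_pos (h.trans hF), LinearMap.comp_apply, LinearMap.comp_apply, M.map_comp,
        crd_map]
    · rw [dif_neg h]
      by_cases h' : G.1 ⊆ F'
      · rw [dif_pos h', LinearMap.comp_apply, crd_map, crd_zero M a F G x h]
        simp
      · rw [dif_neg h']
        simp

open Classical in
theorem eps_apply (M : SqMod.{u} α) (a : ℕ) (F : Finset α) (x : (Fr M a).obj F) :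
    (eps M a).app F x = ∑ G : {G : Finset α // G.card ≤ a},
      if h : G.1 ⊆ F then M.map h (crd M a F G x) else 0 := by
  unfold eps
  rw [LinearMap.sum_apply]
  refine Finset.sum_congr rfl fun G _ => ?_
  by_cases h : G.1 ⊆ F
  · rw [dif_pos h, dif_pos h]; rfl
  · rw [dif_neg h, dif_neg h]; rfl

theorem eps_gen (M : SqMod.{u} α) (a : ℕ) {F G : Finset α} (hG : G.card ≤ a) (h : G ⊆ F)
    (w : M.obj G) : M.map h w ∈ LinearMap.range ((eps M a).app F) := by
  classical
  obtain ⟨x, h1, h2⟩ := crd_single M a (⟨G, hG⟩ : {G : Finset α // G.card ≤ a}) h w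
  refine ⟨x, ?_⟩
  rw [eps_apply, Finset.sum_eq_single (⟨G, hG⟩ : {G : Finset α // G.card ≤ a})]
  · rw [dif_pos h, h1]
  · intro G' _ hne
    simp [h2 G' hne]
  · intro h; exact absurd (Finset.mem_univ _) h

theorem det_cocycle {n : ℕ} (F : Finset α) (c : Fin n → α) (hF : im c = F)
    (hc : Function.Injective c) (τ : Fin (n + 1) → α) (hτ : im τ ⊆ F) :
    ∑ i : Fin (n + 1), (-1 : ℚ) ^ (i : ℕ) *
      (Matrix.of fun k l => if τ (i.succAbove k) = c l then (1 : ℚ) else 0).det = 0 := by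
  let A : Matrix (Fin (n + 1)) (Fin (n + 1)) ℚ :=
    Matrix.of fun k => Fin.cons 1 (fun l => if τ k = c l then (1 : ℚ) else 0)
  have hA : A.det = 0 := by
    rw [← Matrix.exists_mulVec_eq_zero_iff]
    refine ⟨Fin.cons 1 (fun _ => -1), ?_, ?_⟩
    · intro h
      have := congrFun h 0
      simp at this
    · funext k
      have hk : τ k ∈ im c := hF ▸ hτ (Finset.mem_image_of_mem _ (Finset.mem_univ _))
      simp only [Finset.mem_image, Finset.mem_univ, true_and] at hk
      obtain ⟨l, hl⟩ := hk
      simp only [Matrix.mulVec, dotProduct, Fin.sum_univ_succ, A, Matrix.of_apply, Fin.cons_zero,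
        Fin.cons_succ, Pi.zero_apply]
      rw [← hl]
      simp [hc.eq_iff]
  rw [Matrix.det_succ_column_zero] at hA
  refine Eq.trans (Finset.sum_congr rfl fun i _ => ?_) hA
  have : A i 0 = 1 := by simp [A]
  rw [this, mul_one]
  congr 2

theorem gen_step (M : SqMod.{u} α) {n : ℕ} {F : Finset α} (hn : F.card = n + 1)
    (hM : Van M F n) (w : M.obj F) (R : Submodule ℚ (M.obj F))
    (hR : ∀ (G : Finset α) (h : G ⊆ F), G.card < F.card → ∀ x, M.map h x ∈ R) : w ∈ R := by
  classical
  let c : Fin (n + 1) → α := fun i => (F.equivFinOfCardEq hn).symm i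
  have hc : Function.Injective c := fun i j h => by
    exact (F.equivFinOfCardEq hn).symm.injective (Subtype.ext h)
  have hF : im c = F := by
    ext x
    simp only [Finset.mem_image, Finset.mem_univ, true_and]
    constructor
    · rintro ⟨i, rfl⟩
      exact ((F.equivFinOfCardEq hn).symm i).2
    · intro hx
      exact ⟨F.equivFinOfCardEq hn ⟨x, hx⟩, by simp [c]⟩
  let D : (Fin (n + 1) → α) → ℚ := fun σ =>
    (Matrix.of fun k l => if σ k = c l then (1 : ℚ) else 0).det
  let f : Coch M (n + 1) := fun σ => if h : F ⊆ im σ then D σ • M.map h w else 0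
  have hD0 : ∀ σ, ¬ F ⊆ im σ → D σ = 0 := by
    intro σ h
    rw [← hF, Finset.not_subset] at h
    obtain ⟨x, hx, hxσ⟩ := h
    simp only [Finset.mem_image, Finset.mem_univ, true_and] at hx
    obtain ⟨l, rfl⟩ := hx
    refine Matrix.det_eq_zero_of_column_eq_zero l fun k => ?_
    rw [Matrix.of_apply, if_neg]
    intro h
    exact hxσ (h ▸ Finset.mem_image_of_mem _ (Finset.mem_univ _))
  have hf : ∀ τ, im τ ⊆ F → M.cob f τ = 0 := by
    intro τ hτ
    by_cases hFτ : F ⊆ im τ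
    · have key := det_cocycle F c hF hc τ hτ
      have : M.cob f τ = (∑ i : Fin (n + 1 + 1), (-1 : ℚ) ^ (i : ℕ) *
          D (τ ∘ i.succAbove)) • M.map hFτ w := by
        rw [Finset.sum_smul]
        unfold cob
        refine Finset.sum_congr rfl fun i _ => ?_
        rw [mul_smul]
        congr 1
        by_cases h : F ⊆ im (τ ∘ i.succAbove)
        · simp only [f]
          rw [dif_pos h, map_smul, M.map_comp]
        · simp only [f]
          rw [dif_neg h, map_zero, hD0 _ h, zero_smul]
      rw [this]
      have key' : ∑ i : Fin (n + 1 + 1), (-1 : ℚ) ^ (i : ℕ) * D (τ ∘ i.succAbove) = 0 := key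
      rw [key', zero_smul]
    · unfold cob
      refine Finset.sum_eq_zero fun i _ => ?_
      have h : ¬ F ⊆ im (τ ∘ i.succAbove) := fun h => hFτ (h.trans (im_comp _ _))
      simp only [f]
      rw [dif_neg h, map_zero, smul_zero]
  obtain ⟨g, hg⟩ := hM f hf
  have h1 := hg c hF.subset
  have hDc : D c = 1 := by
    have : (Matrix.of fun k l => if c k = c l then (1 : ℚ) else 0) = (1 : Matrix _ _ ℚ) := by
      ext k l
      simp [Matrix.one_apply, hc.eq_iff]
    simp only [D, this, Matrix.det_one]
  have h2 : f c = M.map hF.symm.subset w := by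
    simp only [f]
    rw [dif_pos hF.symm.subset, hDc, one_smul]
  have h3 := congrArg (M.map hF.subset) (h1.trans h2)
  rw [M.map_comp, M.map_id] at h3
  rw [← h3]
  unfold cob
  rw [map_sum]
  refine Submodule.sum_mem _ fun i _ => ?_
  rw [map_smul, M.map_comp]
  refine Submodule.smul_mem _ _ (hR _ _ ?_ _)
  rw [hn]
  refine lt_of_le_of_lt Finset.card_image_le ?_
  simp

theorem eps_surj (M : SqMod.{u} α) (a : ℕ) (hM : ∀ F : Finset α, ∀ n, F.card = n + 1 → a ≤ n →
    Van M F n) (F : Finset α) : Function.Surjective ((eps M a).app F) := by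
  rw [← LinearMap.range_eq_top, Submodule.eq_top_iff']
  induction hk : F.card using Nat.strong_induction_on generalizing F with
  | _ k ih =>
    intro w
    by_cases hFa : F.card ≤ a
    · have := eps_gen M a hFa (subset_refl F) w
      rwa [M.map_id] at this
    · obtain ⟨n, hn⟩ : ∃ n, F.card = n + 1 := ⟨F.card - 1, by omega⟩
      refine gen_step M hn (hM F n hn (by omega)) w _ ?_
      intro G hG hlt x
      obtain ⟨y, rfl⟩ := ih G.card (hk ▸ hlt) G rfl x
      rw [← (eps M a).nat]
      exact ⟨_, rfl⟩

theorem ker_map (M : SqMod.{u} α) (a : ℕ) {F G : Finset α} (h : F ⊆ G) :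
    ∀ x ∈ LinearMap.ker ((eps M a).app F), (Fr M a).map h x ∈ LinearMap.ker ((eps M a).app G) := by
  intro x hx
  rw [LinearMap.mem_ker] at hx ⊢
  rw [(eps M a).nat, hx, map_zero]

/-- The kernel of the canonical map. -/
noncomputable def Ke (M : SqMod.{u} α) (a : ℕ) : SqMod.{u} α :=
  sub (Fr M a) (fun F => LinearMap.ker ((eps M a).app F)) (ker_map M a)

/-- Inclusion of the kernel. -/
noncomputable def KeIncl (M : SqMod.{u} α) (a : ℕ) : Hom (Ke M a) (Fr M a) :=
  subIncl (Fr M a) (fun F => LinearMap.ker ((eps M a).app F)) (ker_map M a)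

theorem Ke_ses (M : SqMod.{u} α) (a : ℕ) (hM : ∀ F : Finset α, ∀ n, F.card = n + 1 → a ≤ n →
    Van M F n) : SES (KeIncl M a) (eps M a) where
  inj F := subIncl_inj _ _ _ F
  zero _ x := x.2
  exact _ x hx := ⟨⟨x, hx⟩, rfl⟩
  surj := eps_surj M a hM

theorem Fr_reg (M : SqMod.{u} α) (a : ℕ) : RegLE (Fr M a) a :=
  pi_reg fun G => (Tr_reg (const_reg _) G.1).mono (by have := G.2; omega)

theorem fn_Fr_reg (E : SetF.{u} α) {b : ℕ}
    (hE : ∀ (W : Type u) [AddCommGroup W] [Module ℚ W], RegLE (fn E (const α W)) b)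
    (M : SqMod.{u} α) (a : ℕ) : RegLE (fn E (Fr M a)) (a + b) :=
  fn_pi_reg E fun G => (fn_Tr_reg E (hE _) G.1).mono (by have := G.2; omega)

theorem Ke_supp (M : SqMod.{u} α) (a k : ℕ) (hM : ∀ F : Finset α, F.card < k → Subsingleton (M.obj F))
    (F : Finset α) (hF : F.card < k + 1) : Subsingleton ((Ke M a).obj F) := by
  classical
  suffices h : ∀ x : (Ke M a).obj F, x = 0 from ⟨fun x y => (h x).trans (h y).symm⟩
  rintro ⟨x, hx⟩
  refine Subtype.ext ?_
  change x = 0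
  have hx' : (eps M a).app F x = 0 := hx
  rw [eps_apply] at hx'
  have hne : ∀ G : {G : Finset α // G.card ≤ a}, G.1 ≠ F → crd M a F G x = 0 := by
    intro G hG
    by_cases h : G.1 ⊆ F
    · have hlt : G.1.card < F.card := Finset.card_lt_card (h.ssubset_of_ne hG)
      have := hM G.1 (by omega)
      exact Subsingleton.elim _ _
    · exact crd_zero M a F G x h
  refine crd_ext M a x fun G => ?_
  by_cases hG : G.1 = F
  · obtain ⟨G, hGa⟩ := G
    simp only at hG
    subst hG
    rw [Finset.sum_eq_single (⟨G, hGa⟩ : {G : Finset α // G.card ≤ a})] at hx'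
    · rw [dif_pos (subset_refl G), M.map_id] at hx'
      exact hx'
    · intro G' _ hG'
      have : G'.1 ≠ G := fun h => hG' (Subtype.ext h)
      by_cases h : G'.1 ⊆ G
      · rw [dif_pos h, hne G' this, map_zero]
      · rw [dif_neg h]
    · intro h; exact absurd (Finset.mem_univ _) h
  · exact hne G hG

theorem reg_of_subsingleton (M : SqMod.{u} α) (h : ∀ F, Subsingleton (M.obj F)) (d : ℕ) :
    RegLE M d := by
  intro F n _ f _
  exact ⟨fun _ => 0, fun σ _ => (h _).elim _ _⟩

theorem dim_bound_aux (j : ℕ) : ∀ k, Fintype.card α + 1 ≤ k + j → ∀ (M : SqMod.{u} α),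
    (∀ F : Finset α, F.card < k → Subsingleton (M.obj F)) → RegLE M (Fintype.card α) := by
  induction j with
  | zero =>
    intro k hk M hM
    exact reg_of_subsingleton M (fun F => hM F (by have := Finset.card_le_univ F; omega)) _
  | succ j ih =>
    intro k hk M hM
    refine (Ke_ses M (Fintype.card α) ?_).reg_right (Fr_reg M _)
      ((ih (k + 1) (by omega) _ (Ke_supp M _ k hM)).mono (by omega))
    intro F n h1 h2
    have := Finset.card_le_univ F
    omega

theorem dim_bound (M : SqMod.{u} α) : RegLE M (Fintype.card α) :=
  dim_bound_aux (Fintype.card α + 1) 0 (by omega) M (fun F h => absurd h (by omega))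

theorem fn_reg_aux (E : SetF.{u} α) {b : ℕ}
    (hE : ∀ (W : Type u) [AddCommGroup W] [Module ℚ W], RegLE (fn E (const α W)) b) (j : ℕ) :
    ∀ k, Fintype.card α + 1 ≤ k + j → ∀ (M : SqMod.{u} α) (a : ℕ),
    (∀ F : Finset α, F.card < k → Subsingleton (M.obj F)) → RegLE M a → RegLE (fn E M) (a + b) := by
  induction j with
  | zero =>
    intro k hk M a hM _
    refine reg_of_subsingleton _ (fun F => ?_) _
    have := hM F (by have := Finset.card_le_univ F; omega)
    exact inferInstanceAs (Subsingleton (E.obj F → M.obj F))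
  | succ j ih =>
    intro k hk M a hM ha
    have S := Ke_ses M a (fun F n _ h => ha F n h)
    have hK : RegLE (Ke M a) (a + 1) := S.reg_left ((Fr_reg M a).mono (by omega)) ha
    exact (fn_ses E S).reg_right (fn_Fr_reg E hE M a)
      ((ih (k + 1) (by omega) _ _ (Ke_supp M _ k hM) hK).mono (by omega))

theorem fn_reg (E : SetF.{u} α) {b : ℕ}
    (hE : ∀ (W : Type u) [AddCommGroup W] [Module ℚ W], RegLE (fn E (const α W)) b)
    (M : SqMod.{u} α) (a : ℕ) (ha : RegLE M a) : RegLE (fn E M) (a + b) :=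
  fn_reg_aux E hE (Fintype.card α + 1) 0 (by omega) M a (fun F h => absurd h (by omega)) ha

end SqMod

namespace SqMod

variable {α : Type} [DecidableEq α]

/-- Linearized restriction. -/
noncomputable def lres (E : SetF.{u} α) {F G : Finset α} (h : F ⊆ G) :
    (E.obj G →₀ ℚ) →ₗ[ℚ] (E.obj F →₀ ℚ) := Finsupp.lmapDomain ℚ ℚ (E.res h)

theorem lres_id (E : SetF.{u} α) {F : Finset α} (h : F ⊆ F) (x) : lres E h x = x := by
  have : E.res h = id := funext (E.res_id F h)
  simp [lres, this]

theorem lres_comp (E : SetF.{u} α) {F G H : Finset α} (h₁ : F ⊆ G) (h₂ : G ⊆ H) (x) :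
    lres E h₁ (lres E h₂ x) = lres E (h₁.trans h₂) x := by
  have : E.res h₁ ∘ E.res h₂ = E.res (h₁.trans h₂) := funext (E.res_comp h₁ h₂)
  simp [lres, ← this, Finsupp.mapDomain_comp]

/-- The sum of coefficients. -/
noncomputable def aug (T : Type u) : (T →₀ ℚ) →ₗ[ℚ] ℚ := Finsupp.linearCombination ℚ (fun _ => 1)

theorem aug_lres (E : SetF.{u} α) {F G : Finset α} (h : F ⊆ G) (x) :
    aug _ (lres E h x) = aug _ x := by
  simp [aug, lres, Finsupp.linearCombination_mapDomain, Function.comp_def]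

/-- Raw multilinear forms on a free module. -/
abbrev TenR (T : Type u) (k : ℕ) : Type u := MultilinearMap ℚ (fun _ : Fin k => T →₀ ℚ) ℚ

/-- Raw alternating forms on a free module. -/
abbrev AltR (T : Type u) (k : ℕ) : Type u := (T →₀ ℚ) [⋀^Fin k]→ₗ[ℚ] ℚ

/-- Pullback of multilinear forms. -/
noncomputable def tenPull {T T' : Type u} (k : ℕ) (l : (T' →₀ ℚ) →ₗ[ℚ] (T →₀ ℚ)) :
    TenR T k →ₗ[ℚ] TenR T' k where
  toFun := fun φ => φ.compLinearMap (fun _ => l)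
  map_add' := fun _ _ => rfl
  map_smul' := fun _ _ => rfl

theorem tenPull_apply {T T' : Type u} (k : ℕ) (l : (T' →₀ ℚ) →ₗ[ℚ] (T →₀ ℚ)) (φ : TenR T k)
    (x : Fin k → T' →₀ ℚ) : tenPull k l φ x = φ (fun i => l (x i)) := rfl

/-- Pullback of alternating forms. -/
noncomputable def altPull {T T' : Type u} (k : ℕ) (l : (T' →₀ ℚ) →ₗ[ℚ] (T →₀ ℚ)) :
    AltR T k →ₗ[ℚ] AltR T' k where
  toFun := fun φ => φ.compLinearMap l
  map_add' := fun _ _ => rfl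
  map_smul' := fun _ _ => rfl

theorem altPull_apply {T T' : Type u} (k : ℕ) (l : (T' →₀ ℚ) →ₗ[ℚ] (T →₀ ℚ)) (φ : AltR T k)
    (x : Fin k → T' →₀ ℚ) : altPull k l φ x = φ (fun i => l (x i)) := rfl

theorem tenPull_id {T : Type u} (k : ℕ) (l : (T →₀ ℚ) →ₗ[ℚ] (T →₀ ℚ)) (hl : ∀ x, l x = x)
    (φ : TenR T k) : tenPull k l φ = φ :=
  MultilinearMap.ext fun x => by simp only [tenPull_apply, hl]

theorem altPull_id {T : Type u} (k : ℕ) (l : (T →₀ ℚ) →ₗ[ℚ] (T →₀ ℚ)) (hl : ∀ x, l x = x)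
    (φ : AltR T k) : altPull k l φ = φ :=
  AlternatingMap.ext fun x => by simp only [altPull_apply, hl]

theorem tenPull_comp {T T' T'' : Type u} (k : ℕ) (l : (T' →₀ ℚ) →ₗ[ℚ] (T →₀ ℚ))
    (l' : (T'' →₀ ℚ) →ₗ[ℚ] (T' →₀ ℚ)) (l'' : (T'' →₀ ℚ) →ₗ[ℚ] (T →₀ ℚ))
    (hl : ∀ x, l (l' x) = l'' x)
    (φ : TenR T k) : tenPull k l' (tenPull k l φ) = tenPull k l'' φ :=
  MultilinearMap.ext fun x => by simp only [tenPull_apply, hl]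

theorem altPull_comp {T T' T'' : Type u} (k : ℕ) (l : (T' →₀ ℚ) →ₗ[ℚ] (T →₀ ℚ))
    (l' : (T'' →₀ ℚ) →ₗ[ℚ] (T' →₀ ℚ)) (l'' : (T'' →₀ ℚ) →ₗ[ℚ] (T →₀ ℚ))
    (hl : ∀ x, l (l' x) = l'' x)
    (φ : AltR T k) : altPull k l' (altPull k l φ) = altPull k l'' φ :=
  AlternatingMap.ext fun x => by simp only [altPull_apply, hl]

/-- Multilinear forms. -/
noncomputable def Ten (E : SetF.{u} α) (k : ℕ) : SqMod.{u} α where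
  obj F := TenR (E.obj F) k
  map h := tenPull k (lres E h)
  map_id F h φ := tenPull_id k _ (lres_id E h) φ
  map_comp h₁ h₂ φ := tenPull_comp k _ _ _ (lres_comp E h₁ h₂) φ

/-- Alternating forms. -/
noncomputable def Alt (E : SetF.{u} α) (k : ℕ) : SqMod.{u} α where
  obj F := AltR (E.obj F) k
  map h := altPull k (lres E h)
  map_id F h φ := altPull_id k _ (lres_id E h) φ
  map_comp h₁ h₂ φ := altPull_comp k _ _ _ (lres_comp E h₁ h₂) φ

/-- Evaluation of `0`-forms. -/
noncomputable def tenEv (T : Type u) : TenR T 0 →ₗ[ℚ] ℚ where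
  toFun := fun φ => φ 0
  map_add' := fun _ _ => rfl
  map_smul' := fun _ _ => rfl

theorem tenEv_bij (T : Type u) : Function.Bijective (tenEv T) := by
  constructor
  · intro φ ψ h
    refine MultilinearMap.ext fun x => ?_
    rw [Subsingleton.elim x 0]
    exact h
  · intro c
    exact ⟨MultilinearMap.constOfIsEmpty ℚ _ c, rfl⟩

theorem tenEv_pull {T T' : Type u} (l : (T' →₀ ℚ) →ₗ[ℚ] (T →₀ ℚ)) (φ : TenR T 0) :
    tenEv T' (tenPull 0 l φ) = tenEv T φ := by
  change φ _ = φ _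
  exact congrArg φ (Subsingleton.elim _ _)

theorem Ten_zero_reg (E : SetF.{u} α) : RegLE (Ten E 0) 0 := by
  intro F n hn
  let j : Hom (Ten E 0) (const α ℚ) :=
    { app := fun F => tenEv (E.obj F)
      nat := fun h φ => tenEv_pull (lres E h) φ }
  exact van_of_bij j (fun F => tenEv_bij (E.obj F)) (const_reg ℚ F n hn)

/-- Raw currying, on basis vectors. -/
noncomputable def curR (T : Type u) (k : ℕ) : TenR T (k + 1) →ₗ[ℚ] (T → TenR T k) where
  toFun := fun φ e => MultilinearMap.curryLeft φ (Finsupp.single e 1)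
  map_add' := fun _ _ => rfl
  map_smul' := fun _ _ => rfl

theorem curR_apply (T : Type u) (k : ℕ) (φ : TenR T (k + 1)) (e : T) (x : Fin k → T →₀ ℚ) :
    curR T k φ e x = φ (Fin.cons (Finsupp.single e 1) x) := rfl

theorem curR_pull {T T' : Type u} (k : ℕ) (l : (T' →₀ ℚ) →ₗ[ℚ] (T →₀ ℚ)) (φ : TenR T (k + 1))
    (e : T') (e' : T) (he : l (Finsupp.single e 1) = Finsupp.single e' 1) :
    curR T' k (tenPull (k + 1) l φ) e = tenPull k l (curR T k φ e') := by
  refine MultilinearMap.ext fun x => ?_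
  rw [curR_apply, tenPull_apply, tenPull_apply, curR_apply]
  refine congrArg φ (funext fun i => ?_)
  refine Fin.cases ?_ (fun i => ?_) i
  · simp [he]
  · simp

theorem curR_bij (T : Type u) (k : ℕ) : Function.Bijective (curR T k) := by
  constructor
  · intro φ ψ h
    apply (multilinearCurryLeftEquiv ℚ (fun _ : Fin (k + 1) => T →₀ ℚ) ℚ).injective
    refine Finsupp.lhom_ext' fun e => LinearMap.ext_ring ?_
    exact congrFun h e
  · intro y
    let L : (T →₀ ℚ) →ₗ[ℚ] TenR T k := Finsupp.linearCombination ℚ y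
    let L' : TenR T (k + 1) := LinearMap.uncurryLeft (M := fun _ : Fin (k + 1) => T →₀ ℚ) L
    refine ⟨L', funext fun e => MultilinearMap.ext fun x => ?_⟩
    rw [curR_apply]
    simp [L', L]

/-- Currying, on basis vectors. -/
noncomputable def tenCurry (E : SetF.{u} α) (k : ℕ) : Hom (Ten E (k + 1)) (fn E (Ten E k)) where
  app F := curR (E.obj F) k
  nat := by
    intro F G h φ
    funext e
    exact curR_pull k (lres E h) φ e (E.res h e) (by simp [lres])

theorem tenCurry_bij (E : SetF.{u} α) (k : ℕ) (F : Finset α) :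
    Function.Bijective ((tenCurry E k).app F) := curR_bij (E.obj F) k

theorem Ten_reg [Fintype α] (E : SetF.{u} α) {b : ℕ}
    (hE : ∀ (W : Type u) [AddCommGroup W] [Module ℚ W], RegLE (fn E (const α W)) b) (k : ℕ) :
    RegLE (Ten E k) (k * b) := by
  induction k with
  | zero => rw [zero_mul]; exact Ten_zero_reg E
  | succ k ih =>
    intro F n hn
    rw [add_mul, one_mul] at hn
    exact van_of_bij (tenCurry E k) (tenCurry_bij E k) (fn_reg E hE _ _ ih F n hn)

/-- Raw inclusion of alternating forms. -/
noncomputable def altI (T : Type u) (k : ℕ) : AltR T k →ₗ[ℚ] TenR T k where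
  toFun := fun φ => φ.toMultilinearMap
  map_add' := fun _ _ => rfl
  map_smul' := fun _ _ => rfl

theorem altern_apply (T : Type u) (k : ℕ) (φ : TenR T k) (v : Fin k → T →₀ ℚ) :
    MultilinearMap.alternatization φ v =
      ∑ σ : Equiv.Perm (Fin k), Equiv.Perm.sign σ • φ (fun i => v (σ i)) := by
  rw [MultilinearMap.alternatization_apply]
  rfl

/-- Raw antisymmetrization. -/
noncomputable def altP (T : Type u) (k : ℕ) : TenR T k →ₗ[ℚ] AltR T k where
  toFun := fun φ => ((k.factorial : ℚ)⁻¹) • MultilinearMap.alternatization φ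
  map_add' := fun x y => by rw [map_add, smul_add]
  map_smul' := fun c x => by
    refine AlternatingMap.ext fun v => ?_
    simp only [AlternatingMap.smul_apply, altern_apply, MultilinearMap.smul_apply, RingHom.id_apply]
    rw [smul_comm]
    congr 1
    rw [Finset.smul_sum]
    refine Finset.sum_congr rfl fun σ _ => ?_
    rw [smul_comm]

theorem altP_apply (T : Type u) (k : ℕ) (φ : TenR T k) (v : Fin k → T →₀ ℚ) :
    altP T k φ v = ((k.factorial : ℚ)⁻¹) •
      ∑ σ : Equiv.Perm (Fin k), Equiv.Perm.sign σ • φ (fun i => v (σ i)) := by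
  rw [← altern_apply]
  rfl

theorem altP_pull {T T' : Type u} (k : ℕ) (l : (T' →₀ ℚ) →ₗ[ℚ] (T →₀ ℚ)) (φ : TenR T k) :
    altP T' k (tenPull k l φ) = altPull k l (altP T k φ) := by
  refine AlternatingMap.ext fun v => ?_
  rw [altP_apply, altPull_apply, altP_apply]
  rfl

theorem altP_altI (T : Type u) (k : ℕ) (φ : AltR T k) : altP T k (altI T k φ) = φ := by
  change ((k.factorial : ℚ)⁻¹) • MultilinearMap.alternatization φ.toMultilinearMap = φ
  rw [AlternatingMap.coe_alternatization, Fintype.card_fin, ← Nat.cast_smul_eq_nsmul ℚ, smul_smul,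
    inv_mul_cancel₀ (by exact_mod_cast k.factorial_ne_zero), one_smul]

/-- Alternating forms inside multilinear forms. -/
noncomputable def altIncl (E : SetF.{u} α) (k : ℕ) : Hom (Alt E k) (Ten E k) where
  app F := altI (E.obj F) k
  nat _ _ := rfl

/-- Antisymmetrization. -/
noncomputable def altProj (E : SetF.{u} α) (k : ℕ) : Hom (Ten E k) (Alt E k) where
  app F := altP (E.obj F) k
  nat h φ := altP_pull k (lres E h) φ

theorem Alt_reg [Fintype α] (E : SetF.{u} α) {b : ℕ}
    (hE : ∀ (W : Type u) [AddCommGroup W] [Module ℚ W], RegLE (fn E (const α W)) b) (k : ℕ) :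
    RegLE (Alt E k) (k * b) := by
  intro F n hn
  exact van_retract (altIncl E k) (altProj E k) (fun F φ => altP_altI (E.obj F) k φ)
    (Ten_reg E hE k F n hn)

/-- The differential between alternating forms on a free module. -/
noncomputable def dAlt (T : Type u) (k : ℕ) :
    ((T →₀ ℚ) [⋀^Fin k]→ₗ[ℚ] ℚ) →ₗ[ℚ] ((T →₀ ℚ) [⋀^Fin (k + 1)]→ₗ[ℚ] ℚ) where
  toFun f := AlternatingMap.alternatizeUncurryFin ((aug T).smulRight f)
  map_add' f g := by
    ext v
    simp [AlternatingMap.alternatizeUncurryFin_apply, Finset.sum_add_distrib, mul_add]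
  map_smul' c f := by
    ext v
    simp [AlternatingMap.alternatizeUncurryFin_apply, Finset.mul_sum]
    refine Finset.sum_congr rfl fun i _ => by ring

theorem dAlt_apply (T : Type u) (k : ℕ) (f : (T →₀ ℚ) [⋀^Fin k]→ₗ[ℚ] ℚ) (v) :
    dAlt T k f v = ∑ i : Fin (k + 1), (-1 : ℚ) ^ (i : ℕ) * (aug T (v i) * f (i.removeNth v)) := by
  simp [dAlt, AlternatingMap.alternatizeUncurryFin_apply]

theorem dAlt_dAlt (T : Type u) (k : ℕ) (f : (T →₀ ℚ) [⋀^Fin k]→ₗ[ℚ] ℚ) :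
    dAlt T (k + 1) (dAlt T k f) = 0 := by
  have := AlternatingMap.alternatizeUncurryFin_alternatizeUncurryFinLM_comp_of_symmetric
    (f := (aug T).smulRight ((aug T).smulRight f)) (by
      intro x y
      simp [smul_smul, mul_comm])
  rw [← this]
  simp only [dAlt, LinearMap.coe_mk, AddHom.coe_mk]
  congr 1
  ext x v
  simp

theorem dAlt_exact (T : Type u) [Nonempty T] (k : ℕ) (f : (T →₀ ℚ) [⋀^Fin (k + 1)]→ₗ[ℚ] ℚ)
    (hf : dAlt T (k + 1) f = 0) : ∃ g, dAlt T k g = f := by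
  obtain ⟨t⟩ := (inferInstance : Nonempty T)
  let x : T →₀ ℚ := Finsupp.single t 1
  have hx : aug T x = 1 := by simp [x, aug]
  refine ⟨f.curryLeft x, AlternatingMap.ext fun v => ?_⟩
  have h := DFunLike.congr_fun hf (Fin.cons x v : Fin (k + 2) → T →₀ ℚ)
  rw [dAlt_apply, Fin.sum_univ_succ] at h
  have h0 : (Fin.removeNth 0 (Fin.cons x v : Fin (k + 2) → T →₀ ℚ)) = v := by
    funext i; simp [Fin.removeNth]
  have hs : ∀ i : Fin (k + 1), Fin.removeNth i.succ (Fin.cons x v : Fin (k + 2) → T →₀ ℚ)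
      = Fin.cons x (i.removeNth v) := by
    intro i
    funext j
    refine Fin.cases ?_ (fun j => ?_) j <;> simp [Fin.removeNth]
  simp only [h0, hs, Fin.cons_zero, Fin.cons_succ, hx, Fin.val_zero, pow_zero, one_mul,
    Fin.val_succ, AlternatingMap.zero_apply] at h
  rw [dAlt_apply, eq_neg_of_add_eq_zero_left h, ← Finset.sum_neg_distrib]
  refine Finset.sum_congr rfl fun i _ => ?_
  rw [pow_succ, AlternatingMap.curryLeft_apply_apply]
  simp only [Matrix.vecCons]
  ring

/-- The differential. -/
noncomputable def dHom (E : SetF.{u} α) (k : ℕ) : Hom (Alt E k) (Alt E (k + 1)) where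
  app F := dAlt (E.obj F) k
  nat := by
    intro F G h φ
    refine AlternatingMap.ext fun v => ?_
    refine (dAlt_apply _ _ _ _).trans (Eq.trans ?_ (dAlt_apply _ _ _ _).symm)
    refine Finset.sum_congr rfl fun i _ => ?_
    congr 2
    exact (aug_lres E h _).symm

theorem dker_map (E : SetF.{u} α) (k : ℕ) {F G : Finset α} (h : F ⊆ G) :
    ∀ x ∈ LinearMap.ker ((dHom E k).app F), (Alt E k).map h x ∈ LinearMap.ker ((dHom E k).app G) := by
  intro x hx
  rw [LinearMap.mem_ker] at hx ⊢
  rw [(dHom E k).nat, hx, map_zero]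

/-- Closed alternating forms. -/
noncomputable def Zk (E : SetF.{u} α) (k : ℕ) : SqMod.{u} α :=
  sub (Alt E k) (fun F => LinearMap.ker ((dHom E k).app F)) (dker_map E k)

/-- Inclusion of closed forms. -/
noncomputable def ZkIncl (E : SetF.{u} α) (k : ℕ) : Hom (Zk E k) (Alt E k) :=
  subIncl (Alt E k) (fun F => LinearMap.ker ((dHom E k).app F)) (dker_map E k)

/-- The differential onto closed forms. -/
noncomputable def ZkProj (E : SetF.{u} α) (k : ℕ) : Hom (Alt E k) (Zk E (k + 1)) where
  app F := ((dHom E k).app F).codRestrict _ (fun φ => dAlt_dAlt (E.obj F) k φ)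
  nat := by
    intro F G h φ
    exact Subtype.ext ((dHom E k).nat h φ)

theorem Zk_ses (E : SetF.{u} α) (k : ℕ) : SES (ZkIncl E k) (ZkProj E k) where
  inj F := subIncl_inj _ _ _ F
  zero _ x := Subtype.ext x.2
  exact F x hx := ⟨⟨x, congrArg Subtype.val hx⟩, rfl⟩
  surj F y := by
    by_cases hE : Nonempty (E.obj F)
    · obtain ⟨g, hg⟩ := dAlt_exact (E.obj F) k y.1 y.2
      exact ⟨g, Subtype.ext hg⟩
    · refine ⟨0, Subtype.ext ?_⟩
      rw [not_nonempty_iff] at hE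
      refine AlternatingMap.ext fun v => ?_
      have h0 : v 0 = 0 := Subsingleton.elim _ _
      exact (AlternatingMap.map_coord_zero _ 0 h0).trans
        (AlternatingMap.map_coord_zero _ 0 h0).symm

theorem alt_zero (T : Type u) [Finite T] (k : ℕ) (hk : Nat.card T < k)
    (f : (T →₀ ℚ) [⋀^Fin k]→ₗ[ℚ] ℚ) : f = 0 := by
  have := Fintype.ofFinite T
  refine AlternatingMap.ext fun v => ?_
  refine f.map_linearDependent v fun h => ?_
  have h1 := h.fintype_card_le_finrank
  rw [Fintype.card_fin, Module.finrank_finsupp_self] at h1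
  rw [Nat.card_eq_fintype_card] at hk
  omega

theorem Zk_reg [Fintype α] (E : SetF.{u} α) {b r : ℕ}
    (hE : ∀ (W : Type u) [AddCommGroup W] [Module ℚ W], RegLE (fn E (const α W)) b)
    (hfin : ∀ F, Finite (E.obj F)) (hr : ∀ F, Nat.card (E.obj F) ≤ r) (j : ℕ) :
    ∀ k, k + j = r → RegLE (Zk E k) (r * b + j) := by
  induction j with
  | zero =>
    intro k hk F n hn
    obtain rfl : k = r := by omega
    refine van_of_bij (ZkIncl E k) ?_ (Alt_reg E hE k F n (by omega))
    intro F
    refine ⟨subIncl_inj _ _ _ F, fun x => ⟨⟨x, ?_⟩, rfl⟩⟩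
    have := hfin F
    exact alt_zero (E.obj F) (k + 1) (Nat.lt_succ_of_le (hr F)) _
  | succ j ih =>
    intro k hk
    refine (Zk_ses E k).reg_left ((Alt_reg E hE k).mono ?_) (ih (k + 1) (by omega))
    have : k * b ≤ r * b := Nat.mul_le_mul_right _ (by omega)
    change k * b ≤ r * b + j + 1
    omega

end SqMod

section Bridge

universe u₁ u₂

variable {V : Type u₁} [DecidableEq V]

/-- Constructor for tuples. -/
def mkT {K : Set (Finset V)} {n : ℕ} (τ : Fin n → V) (hτ : Finset.image τ Finset.univ ∈ K) :
    Tup K n := ⟨τ, hτ⟩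

/-- Linear functional on chains given by a function on tuples. -/
noncomputable def evalL {W : Type u₂} [AddCommGroup W] [Module ℚ W] (K : Set (Finset V)) {n : ℕ}
    (Φ : (Fin n → V) → W) : Chains K n →ₗ[ℚ] W :=
  Finsupp.linearCombination ℚ (fun σ : Tup K n => Φ σ.1)

theorem evalL_gen {W : Type u₂} [AddCommGroup W] [Module ℚ W] (K : Set (Finset V)) {n : ℕ}
    (Φ : (Fin n → V) → W) (τ : Fin n → V) (hτ : Finset.image τ Finset.univ ∈ K) :
    evalL K Φ (gen K τ) = Φ τ := by
  unfold gen evalL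
  rw [dif_pos hτ]
  refine (Finsupp.linearCombination_single ℚ (1 : ℚ) (mkT τ hτ)).trans ?_
  rw [one_smul]
  rfl

theorem gen_eq (K : Set (Finset V)) {n : ℕ} (σ : Tup K n) :
    gen K σ.1 = Finsupp.single σ 1 := by
  unfold gen
  rw [dif_pos σ.2]
  rfl

theorem bdry_single (K : Set (Finset V)) {n : ℕ} (σ : Tup K (n + 1)) :
    bdry K n (Finsupp.single σ 1) =
      ∑ i : Fin (n + 1), ((-1 : ℚ) ^ (i : ℕ)) • gen K (σ.1 ∘ i.succAbove) := by
  unfold bdry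
  rw [Finsupp.lsum_single, LinearMap.toSpanSingleton_apply, one_smul]

theorem face_mem {K : Set (Finset V)} (hK : IsComplex K) {n k : ℕ} {σ : Fin n → V}
    (hσ : Finset.image σ Finset.univ ∈ K) (φ : Fin k → Fin n) :
    Finset.image (σ ∘ φ) Finset.univ ∈ K :=
  hK _ hσ _ (by
    intro x hx
    simp only [Finset.mem_image, Finset.mem_univ, true_and, Function.comp] at hx ⊢
    obtain ⟨i, hi⟩ := hx
    exact ⟨_, hi⟩)

theorem evalL_bdry {W : Type u₂} [AddCommGroup W] [Module ℚ W] {K : Set (Finset V)}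
    (hK : IsComplex K) {n : ℕ} (Φ : (Fin n → V) → W) (σ : Tup K (n + 1)) :
    evalL K Φ (bdry K n (Finsupp.single σ 1)) =
      ∑ i : Fin (n + 1), ((-1 : ℚ) ^ (i : ℕ)) • Φ (σ.1 ∘ i.succAbove) := by
  rw [bdry_single, map_sum]
  refine Finset.sum_congr rfl fun i _ => ?_
  rw [map_smul, evalL_gen K Φ _ (face_mem hK σ.2 _)]

theorem hv_iff (K : Set (Finset V)) (n : ℕ) :
    HomologyVanishes K n ↔ ∀ x, bdry K n x = 0 → x ∈ LinearMap.range (bdry K (n + 1)) := by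
  constructor
  · intro h x hx
    have := h (Submodule.Quotient.mk ⟨x, hx⟩)
    rw [Submodule.Quotient.mk_eq_zero] at this
    exact this
  · intro h x
    obtain ⟨⟨y, hy⟩, rfl⟩ := Submodule.Quotient.mk_surjective _ x
    rw [Submodule.Quotient.mk_eq_zero]
    exact h y hy

theorem factor_through {A B W : Type*} [AddCommGroup A] [Module ℚ A] [AddCommGroup B] [Module ℚ B]
    [AddCommGroup W] [Module ℚ W] (d : A →ₗ[ℚ] B) (f : A →ₗ[ℚ] W)
    (h : LinearMap.ker d ≤ LinearMap.ker f) : ∃ g : B →ₗ[ℚ] W, ∀ x, g (d x) = f x := by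
  let g0 : LinearMap.range d →ₗ[ℚ] W :=
    ((LinearMap.ker d).liftQ f h) ∘ₗ d.quotKerEquivRange.symm.toLinearMap
  obtain ⟨g, hg⟩ := LinearMap.exists_extend g0
  refine ⟨g, fun x => ?_⟩
  have h1 : g (d x) = g0 ⟨d x, x, rfl⟩ := by
    rw [← hg]
    rfl
  rw [h1]
  have h2 : d.quotKerEquivRange.symm ⟨d x, x, rfl⟩ = Submodule.Quotient.mk x := by
    rw [LinearEquiv.symm_apply_eq]
    rfl
  change ((LinearMap.ker d).liftQ f h) (d.quotKerEquivRange.symm ⟨d x, x, rfl⟩) = f x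
  rw [h2]
  rfl

theorem hv_to {W : Type u₂} [AddCommGroup W] [Module ℚ W] {K : Set (Finset V)}
    (hK : IsComplex K) {n : ℕ} (hv : HomologyVanishes K n) (Φ : (Fin (n + 1) → V) → W)
    (hΦ : ∀ τ : Fin (n + 2) → V, Finset.image τ Finset.univ ∈ K →
      ∑ i : Fin (n + 2), ((-1 : ℚ) ^ (i : ℕ)) • Φ (τ ∘ i.succAbove) = 0) :
    ∃ Γ : (Fin n → V) → W, ∀ σ : Fin (n + 1) → V, Finset.image σ Finset.univ ∈ K →
      ∑ i : Fin (n + 1), ((-1 : ℚ) ^ (i : ℕ)) • Γ (σ ∘ i.succAbove) = Φ σ := by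
  rw [hv_iff] at hv
  have h0 : evalL K Φ ∘ₗ bdry K (n + 1) = 0 := by
    refine Finsupp.lhom_ext' fun σ => LinearMap.ext_ring ?_
    exact (evalL_bdry hK Φ σ).trans (hΦ σ.1 σ.2)
  obtain ⟨g, hg⟩ := factor_through (bdry K n) (evalL K Φ) (by
    intro x hx
    obtain ⟨y, rfl⟩ := hv x hx
    exact LinearMap.congr_fun h0 y)
  refine ⟨fun τ => g (gen K τ), fun σ hσ => ?_⟩
  have h1 := hg (Finsupp.single (mkT σ hσ) 1)
  rw [bdry_single, map_sum] at h1
  simp only [map_smul] at h1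
  refine h1.trans ?_
  rw [← gen_eq]
  exact evalL_gen K Φ σ hσ

theorem hv_of {W : Type u₂} [AddCommGroup W] [Module ℚ W] (ι : ℚ →ₗ[ℚ] W)
    (hι : Function.Injective ι) {K : Set (Finset V)}
    (hK : IsComplex K) {n : ℕ}
    (H : ∀ Φ : (Fin (n + 1) → V) → W, (∀ τ : Fin (n + 2) → V, Finset.image τ Finset.univ ∈ K →
      ∑ i : Fin (n + 2), ((-1 : ℚ) ^ (i : ℕ)) • Φ (τ ∘ i.succAbove) = 0) →
      ∃ Γ : (Fin n → V) → W, ∀ σ : Fin (n + 1) → V, Finset.image σ Finset.univ ∈ K →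
      ∑ i : Fin (n + 1), ((-1 : ℚ) ^ (i : ℕ)) • Γ (σ ∘ i.succAbove) = Φ σ) :
    HomologyVanishes K n := by
  rw [hv_iff]
  intro x hx
  by_contra hne
  obtain ⟨f, hfx, hf⟩ := Submodule.exists_le_ker_of_notMem hne
  obtain ⟨Γ, hΓ⟩ := H (fun τ => ι (f (gen K τ))) (by
    intro τ hτ
    have := hf ⟨Finsupp.single (mkT τ hτ) 1, rfl⟩
    rw [LinearMap.mem_ker, bdry_single, map_sum] at this
    have h2 := congrArg ι this
    rw [map_sum, map_zero] at h2
    simp only [map_smul] at h2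
    exact h2)
  have h1 : evalL K Γ ∘ₗ bdry K n = ι ∘ₗ f := by
    refine Finsupp.lhom_ext' fun σ => LinearMap.ext_ring ?_
    refine (evalL_bdry hK Γ σ).trans ((hΓ σ.1 σ.2).trans ?_)
    rw [gen_eq]
    rfl
  have h2 := LinearMap.congr_fun h1 x
  rw [LinearMap.comp_apply, hx, map_zero] at h2
  exact hfx (hι (by rw [map_zero]; exact h2.symm))

end Bridge

section Sections

open SqMod

variable {V : Type u} [DecidableEq V] {m : ℕ}

/-- Simplices of `X` lying over a given set of the base. -/
def secF (p : V → Fin m) (X : Set (Finset V)) (hX : IsComplex X) : SetF.{u} (Fin m) where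
  obj F := {s : Finset V // s ∈ X ∧ s.image p = F}
  res {F G} h s := ⟨s.1.filter (fun v => p v ∈ F), hX _ s.2.1 _ (Finset.filter_subset _ _), by
    ext i
    simp only [Finset.mem_image, Finset.mem_filter]
    constructor
    · rintro ⟨v, ⟨_, hv⟩, rfl⟩
      exact hv
    · intro hi
      have hi' := h hi
      rw [← s.2.2, Finset.mem_image] at hi'
      obtain ⟨v, hv, rfl⟩ := hi'
      exact ⟨v, ⟨hv, hi⟩, rfl⟩⟩
  res_id F h s := Subtype.ext (by
    refine Finset.filter_true_of_mem fun v hv => ?_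
    rw [← s.2.2]
    exact Finset.mem_image_of_mem p hv)
  res_comp h₁ h₂ s := Subtype.ext (by
    ext v
    simp only [Finset.mem_filter]
    constructor
    · rintro ⟨⟨a, _⟩, b⟩
      exact ⟨a, b⟩
    · rintro ⟨a, b⟩
      exact ⟨⟨a, h₁ b⟩, b⟩)

theorem secF_res_val (p : V → Fin m) (X : Set (Finset V)) (hX : IsComplex X) {F G : Finset (Fin m)}
    (h : F ⊆ G) (s : (secF p X hX).obj G) :
    ((secF p X hX).res h s).1 = s.1.filter (fun v => p v ∈ F) := rfl

variable {p : V → Fin m} {X : Set (Finset V)} {hX : IsComplex X}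

theorem lift_ex {n : ℕ} {σ : Fin n → Fin m} (s : (secF p X hX).obj (im σ)) (i : Fin n) :
    ∃ v, v ∈ s.1 ∧ p v = σ i := by
  have : σ i ∈ s.1.image p := by
    rw [s.2.2]
    exact Finset.mem_image_of_mem σ (Finset.mem_univ i)
  simpa only [Finset.mem_image] using this

/-- The tuple of vertices of a simplex lying over a tuple in the base. -/
noncomputable def lift {n : ℕ} {σ : Fin n → Fin m} (s : (secF p X hX).obj (im σ)) : Fin n → V :=
  fun i => (lift_ex s i).choose

theorem lift_mem {n : ℕ} {σ : Fin n → Fin m} (s : (secF p X hX).obj (im σ)) (i : Fin n) :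
    lift s i ∈ s.1 := (lift_ex s i).choose_spec.1

theorem p_lift {n : ℕ} {σ : Fin n → Fin m} (s : (secF p X hX).obj (im σ)) (i : Fin n) :
    p (lift s i) = σ i := (lift_ex s i).choose_spec.2

theorem im_lift (hjoin : ∀ s ∈ X, ∀ v ∈ s, ∀ w ∈ s, p v = p w → v = w)
    {n : ℕ} {σ : Fin n → Fin m} (s : (secF p X hX).obj (im σ)) :
    Finset.image (lift s) Finset.univ = s.1 := by
  ext v
  simp only [Finset.mem_image, Finset.mem_univ, true_and]
  constructor
  · rintro ⟨i, rfl⟩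
    exact lift_mem s i
  · intro hv
    have h1 : p v ∈ im σ := by
      have := Finset.mem_image_of_mem p hv
      rwa [s.2.2] at this
    simp only [Finset.mem_image, Finset.mem_univ, true_and] at h1
    obtain ⟨i, hi⟩ := h1
    exact ⟨i, hjoin _ s.2.1 _ (lift_mem s i) _ hv ((p_lift s i).trans hi)⟩

theorem lift_res (hjoin : ∀ s ∈ X, ∀ v ∈ s, ∀ w ∈ s, p v = p w → v = w)
    {n k : ℕ} {σ : Fin n → Fin m} (s : (secF p X hX).obj (im σ)) (φ : Fin k → Fin n) :
    lift (σ := σ ∘ φ) ((secF p X hX).res (im_comp σ φ) s) = lift s ∘ φ := by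
  funext i
  refine hjoin _ s.2.1 _ ?_ _ (lift_mem s _) ?_
  · have := lift_mem (σ := σ ∘ φ) ((secF p X hX).res (im_comp σ φ) s) i
    exact Finset.mem_of_mem_filter _ this
  · exact (p_lift _ i).trans (p_lift s (φ i)).symm

/-- The simplex of a tuple. -/
def spx {n : ℕ} (τ : Fin n → V) (hτ : Finset.image τ Finset.univ ∈ X) :
    (secF p X hX).obj (im (p ∘ τ)) :=
  ⟨Finset.image τ Finset.univ, hτ, by rw [Finset.image_image]⟩

theorem res_spx (hjoin : ∀ s ∈ X, ∀ v ∈ s, ∀ w ∈ s, p v = p w → v = w)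
    {n k : ℕ} (τ : Fin n → V) (hτ : Finset.image τ Finset.univ ∈ X) (φ : Fin k → Fin n) :
    (secF p X hX).res (im_comp (p ∘ τ) φ) (spx τ hτ) = spx (τ ∘ φ) (face_mem hX hτ φ) := by
  refine Subtype.ext ?_
  change (Finset.image τ Finset.univ).filter (fun v => p v ∈ im ((p ∘ τ) ∘ φ)) =
    Finset.image (τ ∘ φ) Finset.univ
  ext v
  simp only [ Finset.mem_filter, Finset.mem_image, Finset.mem_univ, true_and,
    Function.comp]
  constructor
  · rintro ⟨hv, i, hi⟩
    refine ⟨i, hjoin _ hτ _ (Finset.mem_image_of_mem τ (Finset.mem_univ _)) _ ?_ hi⟩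
    simpa using hv
  · rintro ⟨i, rfl⟩
    exact ⟨⟨_, rfl⟩, i, rfl⟩

theorem lift_spx (hjoin : ∀ s ∈ X, ∀ v ∈ s, ∀ w ∈ s, p v = p w → v = w)
    {n : ℕ} (τ : Fin n → V) (hτ : Finset.image τ Finset.univ ∈ X) :
    lift (spx (p := p) (hX := hX) τ hτ) = τ := by
  funext i
  exact hjoin _ hτ _ (lift_mem (spx (p := p) (hX := hX) τ hτ) i) _
    (Finset.mem_image_of_mem τ (Finset.mem_univ _)) (p_lift _ i)

theorem coch_congr {W : Type u} {n : ℕ}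
    (f : (σ : Fin n → Fin m) → (secF p X hX).obj (im σ) → W) {σ σ' : Fin n → Fin m} (h : σ' = σ)
    (s : (secF p X hX).obj (im σ)) (s' : (secF p X hX).obj (im σ')) (hs : s'.1 = s.1) :
    f σ' s' = f σ s := by
  subst h
  rw [Subtype.ext hs]

theorem fn_const_cob {W : Type u} [AddCommGroup W] [Module ℚ W] {n : ℕ}
    (f : (σ : Fin n → Fin m) → (secF p X hX).obj (im σ) → W) (σ : Fin (n + 1) → Fin m)
    (s : (secF p X hX).obj (im σ)) :
    (fn (secF p X hX) (const (Fin m) W)).cob f σ s =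
      ∑ i : Fin (n + 1), (-1 : ℚ) ^ (i : ℕ) •
        f (σ ∘ i.succAbove) ((secF p X hX).res (im_comp σ i.succAbove) s) := by
  unfold cob
  exact Finset.sum_apply _ _ _

open Classical in
/-- Transfer of cochains to tuples upstairs. -/
noncomputable def up {W : Type u} [AddCommGroup W] (X : Set (Finset V)) (hX : IsComplex X) {n : ℕ}
    (f : (σ : Fin n → Fin m) → (secF p X hX).obj (im σ) → W) (τ : Fin n → V) : W :=
  if h : Finset.image τ Finset.univ ∈ X then f (p ∘ τ) (spx τ h) else 0

theorem up_pos {W : Type u} [AddCommGroup W] {n : ℕ}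
    (f : (σ : Fin n → Fin m) → (secF p X hX).obj (im σ) → W) (τ : Fin n → V)
    (h : Finset.image τ Finset.univ ∈ X) : up X hX f τ = f (p ∘ τ) (spx τ h) := dif_pos h

theorem up_cob (hjoin : ∀ s ∈ X, ∀ v ∈ s, ∀ w ∈ s, p v = p w → v = w)
    {W : Type u} [AddCommGroup W] [Module ℚ W] {n : ℕ}
    (f : (σ : Fin n → Fin m) → (secF p X hX).obj (im σ) → W) (τ : Fin (n + 1) → V)
    (hτ : Finset.image τ Finset.univ ∈ X) :
    ∑ i : Fin (n + 1), (-1 : ℚ) ^ (i : ℕ) • up X hX f (τ ∘ i.succAbove) =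
      (fn (secF p X hX) (const (Fin m) W)).cob f (p ∘ τ) (spx τ hτ) := by
  rw [fn_const_cob]
  refine Finset.sum_congr rfl fun i _ => ?_
  rw [res_spx hjoin, up_pos _ _ (face_mem hX hτ _)]
  rfl

theorem van_A [Fintype V] (hjoin : ∀ s ∈ X, ∀ v ∈ s, ∀ w ∈ s, p v = p w → v = w)
    {W : Type u} [AddCommGroup W] [Module ℚ W] (F : Finset (Fin m)) (n : ℕ)
    (hv : HomologyVanishes (induced X (Finset.univ.filter (fun v => p v ∈ F))) n) :
    Van (fn (secF p X hX) (const (Fin m) W)) F n := by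
  intro f hf
  have hK : IsComplex (induced X (Finset.univ.filter (fun v => p v ∈ F))) :=
    fun s hs t ht => ⟨hX s hs.1 t ht, ht.trans hs.2⟩
  obtain ⟨Γ, hΓ⟩ := hv_to hK hv (up X hX f) (by
    intro τ hτ
    rw [up_cob hjoin f τ hτ.1]
    have := hf (p ∘ τ) (by
      intro i hi
      simp only [Finset.mem_image, Finset.mem_univ, true_and, Function.comp] at hi
      obtain ⟨j, rfl⟩ := hi
      have := hτ.2 (Finset.mem_image_of_mem τ (Finset.mem_univ j))
      simpa using this)
    rw [this]
    rfl)
  refine ⟨fun σ s => Γ (lift s), fun σ hσ => funext fun s => ?_⟩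
  refine (fn_const_cob _ σ s).trans ?_
  simp only [lift_res hjoin]
  have hs : Finset.image (lift s) Finset.univ ∈ X := by rw [im_lift hjoin]; exact s.2.1
  refine (hΓ _ ?_).trans ((up_pos f _ hs).trans ?_)
  rotate_left
  · exact coch_congr f (funext (p_lift s)) _ _ (im_lift hjoin s)
  · refine ⟨hs, fun v hv => ?_⟩
    rw [im_lift hjoin] at hv
    have := Finset.mem_image_of_mem p hv
    rw [s.2.2] at this
    simpa using hσ this

theorem van_B (hX : IsComplex X) (hjoin : ∀ s ∈ X, ∀ v ∈ s, ∀ w ∈ s, p v = p w → v = w) (n : ℕ)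
    (hv : Van (fn (secF p X hX) (const (Fin m) (ULift.{u} ℚ))) Finset.univ n) :
    HomologyVanishes X n := by
  refine hv_of (ULift.moduleEquiv.{0, 0, u} (R := ℚ) (M := ℚ)).symm.toLinearMap
    (LinearEquiv.injective _) hX ?_
  intro Φ hΦ
  obtain ⟨g, hg⟩ := hv (fun σ s => Φ (lift s)) (by
    intro τ _
    refine funext fun s => (fn_const_cob _ τ s).trans ?_
    simp only [lift_res hjoin]
    exact hΦ _ (by rw [im_lift hjoin]; exact s.2.1))
  refine ⟨up X hX g, fun σ hσ => ?_⟩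
  rw [up_cob hjoin g σ hσ, hg (p ∘ σ) (Finset.subset_univ _)]
  exact congrArg Φ (lift_spx hjoin σ hσ)

theorem leray_nonempty [Fintype V] (hX : IsComplex X)
    (hjoin : ∀ s ∈ X, ∀ v ∈ s, ∀ w ∈ s, p v = p w → v = w) :
    {d | ∀ S : Finset V, ∀ i, d ≤ i → HomologyVanishes (induced X S) i}.Nonempty := by
  refine ⟨Fintype.card (Fin m), fun S i hi => ?_⟩
  have hK : IsComplex (induced X S) := fun s hs t ht => ⟨hX s hs.1 t ht, ht.trans hs.2⟩
  exact van_B (p := p) hK (fun s hs => hjoin s hs.1) i (dim_bound _ Finset.univ i hi)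

theorem leray_reg [Fintype V] (hX : IsComplex X)
    (hjoin : ∀ s ∈ X, ∀ v ∈ s, ∀ w ∈ s, p v = p w → v = w)
    (W : Type u) [AddCommGroup W] [Module ℚ W] :
    RegLE (fn (secF p X hX) (const (Fin m) W)) (lerayNumber X) := by
  intro F n hn
  exact van_A hjoin F n (Nat.sInf_mem (leray_nonempty hX hjoin) _ n hn)

end Sections

section ClosedForms

namespace SqMod

variable {α : Type} [DecidableEq α]

/-- Constants as closed `1`-forms. -/
noncomputable def cst (E : SetF.{u} α) : Hom (const α ℚ) (Alt E 0) where
  app F :=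
    { toFun := fun c => AlternatingMap.constOfIsEmpty ℚ (E.obj F →₀ ℚ) (Fin 0) c
      map_add' := fun _ _ => rfl
      map_smul' := fun _ _ => rfl }
  nat _ _ := rfl

/-- Constants as closed `1`-forms. -/
noncomputable def JHom (E : SetF.{u} α) : Hom (const α ℚ) (Zk E 1) where
  app F := (ZkProj E 0).app F ∘ₗ (cst E).app F
  nat h x := by
    rw [LinearMap.comp_apply, (cst E).nat, (ZkProj E 0).nat]
    rfl

/-- Raw evaluation at a basis vector. -/
noncomputable def ev1 {T : Type u} (e : T) : AltR T 1 →ₗ[ℚ] ℚ where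
  toFun z := z (fun _ => Finsupp.single e 1)
  map_add' _ _ := rfl
  map_smul' _ _ := rfl

theorem ev1_closed {T : Type u} (e e' : T) (z : AltR T 1) (hz : dAlt T 1 z = 0) :
    ev1 e z = ev1 e' z := by
  have h := DFunLike.congr_fun hz
    (Fin.cons (Finsupp.single e' 1) (fun _ => Finsupp.single e 1) : Fin 2 → T →₀ ℚ)
  rw [dAlt_apply, Fin.sum_univ_two] at h
  have h0 : Fin.removeNth 0
      (Fin.cons (Finsupp.single e' 1) (fun _ => Finsupp.single e 1) : Fin 2 → T →₀ ℚ) =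
      (fun _ => Finsupp.single e 1) := by
    funext i
    rw [Subsingleton.elim i 0]
    rfl
  have h1 : Fin.removeNth 1
      (Fin.cons (Finsupp.single e' 1) (fun _ => Finsupp.single e 1) : Fin 2 → T →₀ ℚ) =
      (fun _ => Finsupp.single e' 1) := by
    funext i
    rw [Subsingleton.elim i 0]
    rfl
  rw [h0, h1] at h
  have h2 : (Fin.cons (Finsupp.single e' 1) (fun _ => Finsupp.single e 1) : Fin 2 → T →₀ ℚ) 1
    = Finsupp.single e 1 := rfl
  rw [h2, Fin.cons_zero] at h
  simp [aug] at h
  change z _ = z _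
  linarith

/-- Evaluation on closed forms. -/
noncomputable def evZ (E : SetF.{u} α) {F : Finset α} (e : E.obj F) : (Zk E 1).obj F →ₗ[ℚ] ℚ :=
  ev1 e ∘ₗ (ZkIncl E 1).app F

theorem evZ_indep (E : SetF.{u} α) {F : Finset α} (e e' : E.obj F) (z : (Zk E 1).obj F) :
    evZ E e z = evZ E e' z := ev1_closed e e' z.1 z.2

theorem evZ_map (E : SetF.{u} α) {F G : Finset α} (h : F ⊆ G) (e : E.obj G)
    (z : (Zk E 1).obj F) : evZ E e ((Zk E 1).map h z) = evZ E (E.res h e) z := by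
  have hl : lres E h (Finsupp.single e 1) = Finsupp.single (E.res h e) 1 := by simp [lres]
  have key : ∀ y : AltR (E.obj F) 1, ev1 e (altPull 1 (lres E h) y) = ev1 (E.res h e) y := by
    intro y
    change y _ = y _
    exact congrArg y (funext fun _ => hl)
  exact key z.1

theorem evZ_J (E : SetF.{u} α) {F : Finset α} (e : E.obj F) (c : ℚ) :
    evZ E e ((JHom E).app F c) = c := by
  have : ev1 e (dAlt (E.obj F) 0 (AlternatingMap.constOfIsEmpty ℚ (E.obj F →₀ ℚ) (Fin 0) c)) = c := by
    change dAlt (E.obj F) 0 _ _ = c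
    rw [dAlt_apply]
    simp [aug]
  exact this

theorem Zk_zero_of_empty (E : SetF.{u} α) {F : Finset α} (hE : ¬ Nonempty (E.obj F))
    (z : (Zk E 1).obj F) : z = 0 := by
  rw [not_nonempty_iff] at hE
  refine Subtype.ext ?_
  refine AlternatingMap.ext fun v => ?_
  have h0 : v 0 = 0 := Subsingleton.elim _ _
  exact AlternatingMap.map_coord_zero _ 0 h0

theorem van_C (E : SetF.{u} α) (Y : Set (Finset α)) (hY : IsComplex Y)
    (hEY : ∀ F, Nonempty (E.obj F) ↔ F ∈ Y) (S : Finset α) (n : ℕ) (hv : Van (Zk E 1) S n) :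
    HomologyVanishes (induced Y S) n := by
  classical
  have hK : IsComplex (induced Y S) := fun s hs t ht => ⟨hY s hs.1 t ht, ht.trans hs.2⟩
  refine hv_of LinearMap.id Function.injective_id hK ?_
  intro Φ hΦ
  obtain ⟨g, hg⟩ := hv (fun σ => (JHom E).app _ (Φ σ)) (by
    intro τ hτ
    refine ((JHom E).cob (M := const α ℚ) Φ τ).trans ?_
    by_cases h : im τ ∈ Y
    · have h1 : (const α ℚ).cob Φ τ = 0 := hΦ τ ⟨h, hτ⟩
      rw [h1, map_zero]
    · exact Zk_zero_of_empty E (fun h' => h ((hEY _).1 h')) _)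
  refine ⟨fun σ => if h : Nonempty (E.obj (im σ)) then evZ E h.some (g σ) else 0, fun σ hσ => ?_⟩
  obtain ⟨e⟩ := (hEY _).2 hσ.1
  have h1 := congrArg (evZ E e) (hg σ hσ.2)
  rw [evZ_J] at h1
  rw [← h1, cob, map_sum]
  refine Finset.sum_congr rfl fun i _ => ?_
  have hne : Nonempty (E.obj (im (σ ∘ i.succAbove))) := ⟨E.res (im_comp σ _) e⟩
  rw [map_smul, evZ_map]
  congr 1
  exact (dif_pos hne).trans (evZ_indep E _ _ _)

end SqMod

end ClosedForms

section CardBound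

open SqMod

variable {V : Type u} [DecidableEq V] [Fintype V] {m : ℕ} {p : V → Fin m} {X : Set (Finset V)}

theorem geom_det (hjoin : ∀ s ∈ X, ∀ v ∈ s, ∀ w ∈ s, p v = p w → v = w) (y : geomPt X) (v : V)
    (hv : y.1 v ≠ 0) : y.1 v = projPt p y.1 (p v) := by
  obtain ⟨s, hs, hsv⟩ := y.2.2.2
  unfold projPt
  symm
  refine Finset.sum_eq_single v ?_ ?_
  · intro w hw hne
    by_contra h
    exact hne (hjoin s hs w ((hsv w).1 h) v ((hsv v).1 hv) (by simpa using hw))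
  · intro h
    simp at h

theorem fiber_finite (hjoin : ∀ s ∈ X, ∀ v ∈ s, ∀ w ∈ s, p v = p w → v = w) (x : geomPt X) :
    {y : geomPt X | projPt p y.1 = projPt p x.1}.Finite := by
  classical
  let φ : geomPt X → Finset V := fun y => Finset.univ.filter (fun v => y.1 v ≠ 0)
  refine Set.Finite.of_finite_image (f := φ) (Set.toFinite _) ?_
  intro y hy z hz hyz
  refine Subtype.ext (funext fun v => ?_)
  have h : y.1 v ≠ 0 ↔ z.1 v ≠ 0 := by
    have := Finset.ext_iff.1 hyz v
    simpa [φ] using this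
  by_cases h0 : y.1 v = 0
  · have : z.1 v = 0 := by
      by_contra h1
      exact h.2 h1 h0
    rw [h0, this]
  · rw [geom_det hjoin y v h0, geom_det hjoin z v (h.1 h0)]
    have hy' : projPt p y.1 = projPt p x.1 := hy
    have hz' : projPt p z.1 = projPt p x.1 := hz
    rw [hy', hz']

theorem sec_card (hjoin : ∀ s ∈ X, ∀ v ∈ s, ∀ w ∈ s, p v = p w → v = w) {F : Finset (Fin m)}
    {s : Finset V} (hs : s ∈ X) (hsF : s.image p = F) : s.card = F.card := by
  rw [← hsF, Finset.card_image_of_injOn]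
  intro v hv w hw h
  exact hjoin s hs v hv w hw h

/-- Barycenter weights. -/
noncomputable def bary (F : Finset (Fin m)) (s : Finset V) : V → ℝ :=
  fun v => if v ∈ s then (F.card : ℝ)⁻¹ else 0

theorem bary_ne (F : Finset (Fin m)) (hF : F.Nonempty) (s : Finset V) (v : V) :
    bary F s v ≠ 0 ↔ v ∈ s := by
  have : (F.card : ℝ) ≠ 0 := by exact_mod_cast hF.card_pos.ne'
  unfold bary
  split_ifs with h <;> simp [h, hF.ne_empty]

/-- The barycenter of a simplex over `F`. -/
noncomputable def baryPt (hjoin : ∀ s ∈ X, ∀ v ∈ s, ∀ w ∈ s, p v = p w → v = w)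
    (F : Finset (Fin m)) (hF : F.Nonempty) (s : Finset V) (hs : s ∈ X) (hsF : s.image p = F) :
    geomPt X :=
  ⟨bary F s, by
    intro v
    unfold bary
    split_ifs <;> positivity, by
    have : (F.card : ℝ) ≠ 0 := by exact_mod_cast hF.card_pos.ne'
    simp only [bary, Finset.sum_ite_mem, Finset.univ_inter, Finset.sum_const, nsmul_eq_mul]
    rw [sec_card hjoin hs hsF, mul_inv_cancel₀ this], s, hs, bary_ne F hF s⟩

theorem proj_bary (hjoin : ∀ s ∈ X, ∀ v ∈ s, ∀ w ∈ s, p v = p w → v = w)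
    (F : Finset (Fin m)) (s : Finset V) (hs : s ∈ X) (hsF : s.image p = F) :
    projPt p (bary F s) = fun i => if i ∈ F then (F.card : ℝ)⁻¹ else 0 := by
  funext i
  unfold projPt
  split_ifs with hi
  · rw [← hsF, Finset.mem_image] at hi
    obtain ⟨v, hv, rfl⟩ := hi
    rw [Finset.sum_eq_single v]
    · simp [bary, hv]
    · intro w hw hne
      have hw' : p w = p v := by simpa using hw
      have : w ∉ s := fun h => hne (hjoin s hs w h v hv hw')
      simp [bary, this]
    · intro h
      simp at h
  · refine Finset.sum_eq_zero fun w hw => ?_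
    have hw' : p w = i := by simpa using hw
    have : w ∉ s := fun h => hi (by
      rw [← hsF, ← hw']
      exact Finset.mem_image_of_mem p h)
    simp [bary, this]

theorem sec_finite (hX : IsComplex X) (F : Finset (Fin m)) : Finite ((secF p X hX).obj F) :=
  Finite.of_injective (fun s : (secF p X hX).obj F => s.1) Subtype.val_injective

theorem sec_bound (hX : IsComplex X)
    (hjoin : ∀ s ∈ X, ∀ v ∈ s, ∀ w ∈ s, p v = p w → v = w) (r : ℕ) (hr1 : 1 ≤ r)
    (hr : ∀ x : geomPt X, {y : geomPt X | projPt p y.1 = projPt p x.1}.ncard ≤ r)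
    (F : Finset (Fin m)) : Nat.card ((secF p X hX).obj F) ≤ r := by
  have hfin := sec_finite (p := p) hX F
  rcases F.eq_empty_or_nonempty with rfl | hF
  · refine le_trans ?_ hr1
    have : Subsingleton ((secF p X hX).obj ∅) := by
      constructor
      intro s t
      refine Subtype.ext ?_
      rw [Finset.image_eq_empty.1 s.2.2, Finset.image_eq_empty.1 t.2.2]
    exact Finite.card_le_one_iff_subsingleton.2 this
  · by_cases hne : Nonempty ((secF p X hX).obj F)
    · obtain ⟨s₀⟩ := hne
      refine le_trans ?_ (hr (baryPt hjoin F hF s₀.1 s₀.2.1 s₀.2.2))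
      have hff := fiber_finite hjoin (baryPt hjoin F hF s₀.1 s₀.2.1 s₀.2.2)
      rw [← Nat.card_coe_set_eq]
      have := hff.to_subtype
      refine Nat.card_le_card_of_injective
        (fun s : (secF p X hX).obj F => ⟨baryPt hjoin F hF s.1 s.2.1 s.2.2, ?_⟩) ?_
      · exact (proj_bary hjoin F s.1 s.2.1 s.2.2).trans
          (proj_bary hjoin F s₀.1 s₀.2.1 s₀.2.2).symm
      · intro s t hst
        have h1 : bary F s.1 = bary F t.1 := congrArg (fun z => z.1.1) hst
        refine Subtype.ext (Finset.ext fun v => ?_)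
        rw [← bary_ne F hF s.1, ← bary_ne F hF t.1, h1]
    · rw [not_nonempty_iff] at hne
      simp

end CardBound

/-- main theorem: if `X` is a subcomplex of the join `V_1 * ⋯ * V_m`
(`V_i = p⁻¹(i)`), and every fiber of the projection `π` on the geometric realization of `X`
has at most `r` points, then `L(π(X)) ≤ r·L(X) + r - 1`. -/
theorem stmt3 {V : Type*} [DecidableEq V] [Fintype V] {m : ℕ} (p : V → Fin m)
    (X : Set (Finset V)) (hX : IsComplex X)
    (hjoin : ∀ s ∈ X, ∀ v ∈ s, ∀ w ∈ s, p v = p w → v = w)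
    (r : ℕ) (hr1 : 1 ≤ r)
    (hr : ∀ x : geomPt X, {y : geomPt X | projPt p y.1 = projPt p x.1}.ncard ≤ r) :
    lerayNumber (imageComplex p X) ≤ r * lerayNumber X + r - 1 := by
  have hY : IsComplex (imageComplex p X) := by
    rintro _ ⟨s, hs, rfl⟩ t ht
    refine ⟨s.filter (fun v => p v ∈ t), hX s hs _ (Finset.filter_subset _ _), ?_⟩
    ext i
    simp only [Finset.mem_image, Finset.mem_filter]
    constructor
    · intro hi
      have := ht hi
      simp only [Finset.mem_image] at this
      obtain ⟨v, hv, rfl⟩ := this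
      exact ⟨v, ⟨hv, hi⟩, rfl⟩
    · rintro ⟨v, ⟨_, hv⟩, rfl⟩
      exact hv
  have hEY : ∀ F, Nonempty ((secF p X hX).obj F) ↔ F ∈ imageComplex p X := by
    intro F
    constructor
    · rintro ⟨s⟩
      exact ⟨s.1, s.2.1, s.2.2.symm⟩
    · rintro ⟨s, hs, hF⟩
      exact ⟨⟨s, hs, hF.symm⟩⟩
  have hreg : SqMod.RegLE (SqMod.Zk (secF p X hX) 1) (r * lerayNumber X + (r - 1)) :=
    SqMod.Zk_reg (secF p X hX) (fun W _ _ => leray_reg hX hjoin W) (sec_finite hX)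
      (sec_bound hX hjoin r hr1 hr) (r - 1) 1 (by omega)
  refine Nat.sInf_le fun S n hn => ?_
  exact SqMod.van_C (secF p X hX) _ hY hEY S n (hreg S n (by omega))
end

section
/- Let X_1, …, X_k be subcomplexes of the join V_1 * ⋯ * V_m of finite disjoint 0-dimensional complexes, and let M(X_1,…,X_k) be the simplicial complex whose p-simplices are sets {w_{i_0},…,w_{i_p}} with 1 ≤ i_0 < ⋯ < i_p ≤ m, where each w_{i_j} = (v_{i_j,1},…,v_{i_j,k}) ∈ V_{i_j}^k and {v_{i_0,s},…,v_{i_p,s}} ∈ X_s for every 1 ≤ s ≤ k. Then the reduced rational homology H̃_j(M(X_1,…,X_k);ℚ) vanishes for all j ≥ Σ_{i=1}^k L(X_i). -/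
/-- The generalized multiple point complex `M(X_1,…,X_k)`. Its vertices are pairs
`(i, w)` with `w ∈ V_i^k` (`V_i = p⁻¹(i)`); a finset of such vertices is a simplex iff the
levels `i` are pairwise distinct and, for each coordinate `s`, the set of `s`-th components
is a simplex of `X_s`. -/
def Mcplx {V : Type*} [DecidableEq V] {m k : ℕ} (p : V → Fin m)
    (Xs : Fin k → Set (Finset V)) :
    Set (Finset ((i : Fin m) × {w : Fin k → V // ∀ s, p (w s) = i})) :=
  {T | (∀ w ∈ T, ∀ w' ∈ T, w.1 = w'.1 → w = w') ∧
    ∀ s : Fin k, T.image (fun w => w.2.1 s) ∈ Xs s}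


namespace LC

abbrev Ch (U : Type*) := List U →₀ ℚ

noncomputable def pre {U : Type*} (v : U) : Ch U →ₗ[ℚ] Ch U :=
  Finsupp.lmapDomain ℚ ℚ (List.cons v)

noncomputable def bl {U : Type*} : List U → Ch U
  | [] => 0
  | v :: l => Finsupp.single l 1 - pre v (bl l)

noncomputable def bd {U : Type*} : Ch U →ₗ[ℚ] Ch U := Finsupp.linearCombination ℚ bl

lemma pre_single {U : Type*} (v : U) (l : List U) (a : ℚ) :
    pre v (Finsupp.single l a) = Finsupp.single (v :: l) a := by
  simp [pre, Finsupp.lmapDomain_apply, Finsupp.mapDomain_single]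

lemma bd_single {U : Type*} (l : List U) : bd (Finsupp.single l 1) = bl l := by
  simp [bd]

lemma lhom_ext {U : Type*} {M : Type*} [AddCommGroup M] [Module ℚ M] {f g : Ch U →ₗ[ℚ] M}
    (h : ∀ l, f (Finsupp.single l 1) = g (Finsupp.single l 1)) : f = g := by
  apply Finsupp.lhom_ext'
  intro l
  apply LinearMap.ext_ring
  exact h l

lemma bd_comp_pre {U : Type*} (v : U) :
    bd ∘ₗ pre v = LinearMap.id - pre v ∘ₗ bd := by
  apply lhom_ext
  intro l
  simp [pre_single, bd_single, bl]

lemma bd_pre {U : Type*} (v : U) (x : Ch U) : bd (pre v x) = x - pre v (bd x) :=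
  LinearMap.congr_fun (bd_comp_pre v) x

lemma bd_bl {U : Type*} (l : List U) : bd (bl l) = 0 := by
  induction l with
  | nil => simp [bl]
  | cons v l ih => simp [bl, bd_single, bd_pre, ih]

lemma bd_comp_bd {U : Type*} : bd ∘ₗ bd = (0 : Ch U →ₗ[ℚ] Ch U) := by
  apply lhom_ext
  intro l
  simp [bd_single, bd_bl]

lemma bd_bd {U : Type*} (x : Ch U) : bd (bd x) = 0 := LinearMap.congr_fun bd_comp_bd x

/-- chains spanned by lists with property -/
def S {U : Type*} (P : Set (List U)) : Submodule ℚ (Ch U) := Finsupp.supported ℚ ℚ P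

lemma S_mono {U : Type*} {P Q : Set (List U)} (h : P ⊆ Q) : S P ≤ S Q :=
  Finsupp.supported_mono h

lemma single_mem {U : Type*} {P : Set (List U)} {l : List U} {a : ℚ} (h : l ∈ P) :
    Finsupp.single l a ∈ S P := Finsupp.single_mem_supported ℚ a h

lemma map_mem {U : Type*} {M : Type*} [AddCommGroup M] [Module ℚ M] (f : Ch U →ₗ[ℚ] M)
    {P : Set (List U)} {N : Submodule ℚ M}
    (h : ∀ l ∈ P, f (Finsupp.single l 1) ∈ N) {x : Ch U} (hx : x ∈ S P) : f x ∈ N := by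
  have : S P ≤ N.comap f := by
    rw [S, Finsupp.supported_eq_span_single, Submodule.span_le]
    rintro _ ⟨l, hl, rfl⟩
    exact h l hl
  exact this hx

lemma map_eq_zero {U : Type*} {M : Type*} [AddCommGroup M] [Module ℚ M] (f : Ch U →ₗ[ℚ] M)
    {P : Set (List U)} (h : ∀ l ∈ P, f (Finsupp.single l 1) = 0) {x : Ch U} (hx : x ∈ S P) :
    f x = 0 := by
  have := map_mem f (N := ⊥) (by simpa using h) hx
  simpa using this

def C {U : Type*} [DecidableEq U] (K : Set (Finset U)) (n : ℕ) : Submodule ℚ (Ch U) :=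
  S {l | l.length = n ∧ l.toFinset ∈ K}

lemma C_mono {U : Type*} [DecidableEq U] {K L : Set (Finset U)} (h : K ⊆ L) (n : ℕ) :
    C K n ≤ C L n := S_mono fun _ hl => ⟨hl.1, h hl.2⟩

lemma bl_mem {U : Type*} [DecidableEq U] (l : List U) :
    bl l ∈ S {l' | l'.length + 1 = l.length ∧ l'.toFinset ⊆ l.toFinset} := by
  induction l with
  | nil => simp [bl]
  | cons v l ih =>
    refine Submodule.sub_mem _ (single_mem ⟨rfl, ?_⟩) (map_mem _ ?_ ih)
    · simp
    · rintro l' ⟨h1, h2⟩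
      rw [pre_single]
      refine single_mem ⟨by simp [h1], ?_⟩
      simp only [List.toFinset_cons]
      exact Finset.insert_subset_insert _ h2

lemma bd_mem {U : Type*} [DecidableEq U] {K : Set (Finset U)} (hK : IsComplex K) {n : ℕ}
    {x : Ch U} (hx : x ∈ C K (n + 1)) : bd x ∈ C K n := by
  refine map_mem _ ?_ hx
  rintro l ⟨h1, h2⟩
  rw [bd_single]
  refine S_mono ?_ (bl_mem l)
  rintro l' ⟨h3, h4⟩
  exact ⟨by omega, hK _ h2 _ h4⟩

def Van {U : Type*} [DecidableEq U] (K : Set (Finset U)) (n : ℕ) : Prop :=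
  ∀ z ∈ C K n, bd z = 0 → ∃ c ∈ C K (n + 1), bd c = z

def Ler {U : Type*} [DecidableEq U] (d : ℕ) (K : Set (Finset U)) : Prop :=
  ∀ S : Finset U, ∀ n, d < n → Van (induced K S) n

/-! Projection to lists containing `b`. -/

open Classical in
noncomputable def pj {U : Type*} (b : U) : Ch U →ₗ[ℚ] Ch U :=
  Finsupp.linearCombination ℚ (fun l => if b ∈ l then Finsupp.single l 1 else 0)

lemma pj_single_of_mem {U : Type*} {b : U} {l : List U} (h : b ∈ l) :
    pj b (Finsupp.single l 1) = Finsupp.single l 1 := by simp [pj, h]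

lemma pj_single_of_not_mem {U : Type*} {b : U} {l : List U} (h : b ∉ l) :
    pj b (Finsupp.single l 1) = 0 := by simp [pj, h]

lemma pj_eq_zero {U : Type*} {b : U} {P : Set (List U)} (h : ∀ l ∈ P, b ∉ l) {x : Ch U}
    (hx : x ∈ S P) : pj b x = 0 :=
  map_eq_zero _ (fun l hl => pj_single_of_not_mem (h l hl)) hx

lemma pj_eq_self {U : Type*} {b : U} {P : Set (List U)} (h : ∀ l ∈ P, b ∈ l) {x : Ch U}
    (hx : x ∈ S P) : pj b x = x := by
  have := map_eq_zero (pj b - LinearMap.id) (P := P)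
    (fun l hl => by simp [pj_single_of_mem (h l hl)]) hx
  simpa [sub_eq_zero] using this

lemma pj_mem {U : Type*} (b : U) {P : Set (List U)} {x : Ch U} (hx : x ∈ S P) :
    pj b x ∈ S {l | l ∈ P ∧ b ∈ l} := by
  refine map_mem _ ?_ hx
  intro l hl
  by_cases h : b ∈ l
  · rw [pj_single_of_mem h]; exact single_mem ⟨hl, h⟩
  · rw [pj_single_of_not_mem h]; exact Submodule.zero_mem _

lemma sub_pj_mem {U : Type*} (b : U) {P : Set (List U)} {x : Ch U} (hx : x ∈ S P) :
    x - pj b x ∈ S {l | l ∈ P ∧ b ∉ l} := by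
  refine map_mem (LinearMap.id - pj b) ?_ hx
  intro l hl
  by_cases h : b ∈ l
  · simp [pj_single_of_mem h]
  · simp only [LinearMap.sub_apply, LinearMap.id_apply, pj_single_of_not_mem h, sub_zero]
    exact single_mem ⟨hl, h⟩

lemma mem_univ {U : Type*} (x : Ch U) : x ∈ S (Set.univ : Set (List U)) := by
  simp [S]

lemma pj_bd_pj {U : Type*} (b : U) (x : Ch U) : pj b (bd (pj b x)) = pj b (bd x) := by
  classical
  have h : pj b (bd (x - pj b x)) = 0 := by
    have := map_eq_zero (pj b ∘ₗ bd) (P := {l : List U | l ∈ Set.univ ∧ b ∉ l}) ?_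
      (sub_pj_mem b (mem_univ x))
    · exact this
    · rintro l ⟨-, hl⟩
      simp only [LinearMap.comp_apply, bd_single]
      refine pj_eq_zero ?_ (bl_mem l)
      rintro l' ⟨-, h2⟩ h3
      exact hl (by simpa using h2 (by simpa using h3))
  rw [map_sub, map_sub, sub_eq_zero] at h
  exact h.symm

def lk {U : Type*} [DecidableEq U] (K : Set (Finset U)) (b : U) : Set (Finset U) :=
  {σ | b ∉ σ ∧ insert b σ ∈ K}

def dl {U : Type*} (K : Set (Finset U)) (B : Set U) : Set (Finset U) :=
  {σ | σ ∈ K ∧ ∀ b ∈ σ, b ∉ B}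

/-- every simplex has at most one vertex in B -/
def NA {U : Type*} (K : Set (Finset U)) (B : Set U) : Prop :=
  ∀ σ ∈ K, ∀ b ∈ σ, ∀ b' ∈ σ, b ∈ B → b' ∈ B → b = b'

/-- part outside b of the boundary of chain all of whose lists contain b -/
lemma bd_star_mem {U : Type*} [DecidableEq U] {K : Set (Finset U)} (hK : IsComplex K) {n : ℕ}
    {b : U} {x : Ch U} (hx : x ∈ C K (n + 1)) :
    bd (pj b x) - pj b (bd (pj b x)) ∈ C (lk K b) n := by
  refine map_mem ((LinearMap.id - pj b) ∘ₗ bd) ?_ (pj_mem b hx)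
  rintro l ⟨⟨h1, h2⟩, h3⟩
  simp only [LinearMap.comp_apply, bd_single]
  refine S_mono ?_ (sub_pj_mem b (bl_mem l))
  rintro l' ⟨⟨h4, h5⟩, h6⟩
  refine ⟨by omega, by simpa using h6, hK _ h2 _ ?_⟩
  exact Finset.insert_subset (by simpa using h3) h5

lemma lk_subset {U : Type*} [DecidableEq U] {K : Set (Finset U)} (hK : IsComplex K) (b : U) :
    lk K b ⊆ K := fun _ hσ => hK _ hσ.2 _ (Finset.subset_insert _ _)

lemma pre_mem {U : Type*} [DecidableEq U] {K L : Set (Finset U)} {b : U} {n : ℕ} {x : Ch U}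
    (h : ∀ σ ∈ K, insert b σ ∈ L) (hx : x ∈ C K n) : pre b x ∈ C L (n + 1) := by
  refine map_mem _ ?_ hx
  rintro l ⟨h1, h2⟩
  rw [pre_single]
  exact single_mem ⟨by simp [h1], by simpa using h _ h2⟩

lemma L1conv {U : Type*} [DecidableEq U] [Fintype U] {K : Set (Finset U)} (hK : IsComplex K)
    {B : Set U} (hB : NA K B) {n : ℕ} (hv : Van K (n + 1)) (z : U → Ch U)
    (hz : ∀ b, z b ∈ C (lk K b) n) (hz0 : ∀ b, b ∉ B → z b = 0) (hzc : ∀ b, bd (z b) = 0)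
    (c : Ch U) (hc : c ∈ C (dl K B) (n + 1)) (hcz : ∑ b, z b = bd c) (b : U) :
    ∃ c ∈ C (lk K b) (n + 1), bd c = z b := by
  by_cases hb : b ∈ B
  swap
  · exact ⟨0, Submodule.zero_mem _, by simp [hz0 b hb]⟩
  have hpz : ∀ b, pre b (z b) ∈ C K (n + 1) := fun b => pre_mem (fun σ hσ => hσ.2) (hz b)
  obtain ⟨e, he, hbe⟩ := hv (∑ b, pre b (z b) - c)
    (Submodule.sub_mem _ (Submodule.sum_mem _ fun b _ => hpz b)
      (C_mono (fun σ hσ => hσ.1) _ hc))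
    (by simp [bd_pre, hzc, hcz])
  have key : pj b (bd (pj b e)) = pre b (z b) := by
    rw [pj_bd_pj, hbe, map_sub, map_sum]
    rw [show pj b c = 0 from pj_eq_zero (by
      rintro l ⟨-, -, h⟩ h'
      exact h b (by simpa using h') hb) hc, sub_zero]
    rw [Finset.sum_eq_single b]
    · have : pre b (z b) ∈ S {l : List U | b ∈ l} := by
        refine map_mem _ ?_ (hz b)
        intro l _
        rw [pre_single]
        exact single_mem (by simp)
      exact pj_eq_self (fun l hl => hl) this
    · intro b' _ hne
      by_cases hb' : b' ∈ B
      swap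
      · simp [hz0 b' hb']
      have : pre b' (z b') ∈ S {l : List U | b ∉ l} := by
        refine map_mem _ ?_ (hz b')
        rintro l ⟨-, h1, h2⟩
        rw [pre_single]
        refine single_mem ?_
        simp only [Set.mem_ofPred_eq, List.mem_cons, not_or]
        refine ⟨fun h => hne h.symm, fun h => hne ?_⟩
        exact hB _ h2 _ (by simp) _ (by simp [h]) hb' hb
      exact pj_eq_zero (fun l hl => hl) this
    · simp
  have hm := bd_star_mem hK (b := b) he
  rw [key] at hm
  refine ⟨-(bd (pj b e) - pre b (z b)), Submodule.neg_mem _ hm, ?_⟩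
  simp [bd_bd, bd_pre, hzc]

lemma L1 {U : Type*} [DecidableEq U] [Fintype U] {K : Set (Finset U)} (hK : IsComplex K)
    {B : Set U} (hB : NA K B) {n : ℕ} (hv : Van (dl K B) (n + 1))
    (hinj : ∀ z : U → Ch U, (∀ b, z b ∈ C (lk K b) n) → (∀ b, b ∉ B → z b = 0) →
      (∀ b, bd (z b) = 0) → ∀ c ∈ C (dl K B) (n + 1), ∑ b, z b = bd c →
      ∀ b, b ∈ B → ∃ c ∈ C (lk K b) (n + 1), bd c = z b) :
    Van K (n + 1) := by
  classical
  intro z hz hcz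
  let zb : U → Ch U := fun b => if b ∈ B then pj b z else 0
  have hzb : ∀ b, zb b ∈ S {l : List U | (l.length = n + 1 ∧ l.toFinset ∈ K) ∧ b ∈ l} := by
    intro b
    by_cases h : b ∈ B
    · simp only [zb, h, if_true]; exact pj_mem b hz
    · simp only [zb, h, if_false]; exact Submodule.zero_mem _
  have hy : ∀ b, bd (zb b) ∈ C (lk K b) n := by
    intro b
    by_cases h : b ∈ B
    · simp only [zb, h, if_true]
      have := bd_star_mem hK (b := b) hz
      rw [pj_bd_pj, hcz] at this
      simpa using this
    · simp only [zb, h, if_false]; simp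
  have hz0 : z - ∑ b, zb b ∈ C (dl K B) (n + 1) := by
    have h := map_mem (LinearMap.id - ∑ b, if b ∈ B then pj b else 0)
      (P := {l : List U | l.length = n + 1 ∧ l.toFinset ∈ K}) (N := C (dl K B) (n + 1)) ?_ hz
    swap
    · rintro l ⟨h1, h2⟩
      simp only [LinearMap.sub_apply, LinearMap.id_apply, LinearMap.sum_apply]
      by_cases h : ∃ b ∈ l, b ∈ B
      · obtain ⟨b, hbl, hb⟩ := h
        rw [Finset.sum_eq_single b]
        · simp [hb, pj_single_of_mem hbl]
        · intro b' _ hne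
          by_cases hb' : b' ∈ B
          · simp only [hb', if_true]
            refine pj_single_of_not_mem fun h => hne ?_
            exact hB _ h2 _ (by simp [h]) _ (by simp [hbl]) hb' hb
          · simp [hb']
        · simp
      · push Not at h
        rw [Finset.sum_eq_zero]
        · rw [sub_zero]
          exact single_mem ⟨h1, h2, by simpa using h⟩
        · intro b _
          by_cases hb : b ∈ B
          · simp only [hb, if_true]
            exact pj_single_of_not_mem fun h' => h b h' hb
          · simp [hb]
    · convert h using 1
      simp only [LinearMap.sub_apply, LinearMap.id_apply, LinearMap.sum_apply, zb]
      congr 1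
      refine Finset.sum_congr rfl fun b _ => ?_
      split_ifs <;> simp
  have hex : ∀ b, ∃ c, (c ∈ C (lk K b) (n + 1) ∧ c ∈ C (dl K B) (n + 1)) ∧ bd c = bd (zb b) := by
    intro b
    by_cases hb : b ∈ B
    · obtain ⟨c, h1, h2⟩ := hinj (fun b => bd (zb b)) hy (fun b hb => by simp [zb, hb])
        (fun b => bd_bd _) (-(z - ∑ b, zb b)) (Submodule.neg_mem _ hz0) (by simp [hcz]) b hb
      refine ⟨c, ⟨h1, C_mono ?_ _ h1⟩, h2⟩
      rintro σ ⟨h3, h4⟩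
      refine ⟨hK _ h4 _ (Finset.subset_insert _ _), fun b' h5 h6 => h3 ?_⟩
      rwa [hB _ h4 b (by simp) b' (by simp [h5]) hb h6]
    · exact ⟨0, ⟨Submodule.zero_mem _, Submodule.zero_mem _⟩, by simp [zb, hb]⟩
  choose cb hcb hcb2 using hex
  obtain ⟨e0, he0, hbe0⟩ := hv (z - ∑ b, zb b + ∑ b, cb b)
    (Submodule.add_mem _ hz0 (Submodule.sum_mem _ fun b _ => (hcb b).2))
    (by simp [hcz, hcb2])
  refine ⟨e0 + ∑ b, pre b (zb b - cb b), Submodule.add_mem _ (C_mono (fun σ hσ => hσ.1) _ he0)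
    (Submodule.sum_mem _ fun b _ => ?_), ?_⟩
  · rw [map_sub]
    refine Submodule.sub_mem _ ?_ (pre_mem (fun σ hσ => hσ.2) (hcb b).1)
    refine map_mem _ ?_ (hzb b)
    rintro l ⟨⟨h1, h2⟩, h3⟩
    rw [pre_single]
    refine single_mem ⟨by simp [h1], ?_⟩
    rwa [List.toFinset_cons, Finset.insert_eq_of_mem (by simpa using h3)]
  · simp [hbe0, bd_pre, hcb2]


lemma induced_complex {U : Type*} {K : Set (Finset U)} (hK : IsComplex K) (S : Finset U) :
    IsComplex (induced K S) := fun s hs t ht => ⟨hK s hs.1 t ht, ht.trans hs.2⟩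

lemma lk_complex {U : Type*} [DecidableEq U] {K : Set (Finset U)} (hK : IsComplex K) (b : U) :
    IsComplex (lk K b) := fun _ hs _ ht =>
  ⟨fun h => hs.1 (ht h), hK _ hs.2 _ (Finset.insert_subset_insert _ ht)⟩

lemma dl_complex {U : Type*} {K : Set (Finset U)} (hK : IsComplex K) (B : Set U) :
    IsComplex (dl K B) := fun _ hs _ ht => ⟨hK _ hs.1 _ ht, fun b hb => hs.2 b (ht hb)⟩

lemma NA_mono {U : Type*} {K L : Set (Finset U)} {B : Set U} (h : NA L B) (hKL : K ⊆ L) :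
    NA K B := fun σ hσ => h σ (hKL hσ)

lemma induced_subset {U : Type*} (K : Set (Finset U)) (S : Finset U) : induced K S ⊆ K :=
  fun _ h => h.1

lemma induced_induced {U : Type*} [DecidableEq U] (K : Set (Finset U)) (S T : Finset U) :
    induced (induced K S) T = induced K (S ∩ T) := by
  ext σ
  simp only [induced, Set.mem_ofPred_eq, Finset.subset_inter_iff]
  tauto

lemma dl_induced {U : Type*} [Fintype U] [DecidableEq U] (K : Set (Finset U)) (S : Finset U)
    (B : Set U) [DecidablePred (· ∈ B)] :
    dl (induced K S) B = induced K (S.filter (· ∉ B)) := by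
  ext σ
  simp only [induced, dl, Set.mem_ofPred_eq, Finset.subset_iff, Finset.mem_filter]
  constructor
  · rintro ⟨⟨h1, h2⟩, h3⟩; exact ⟨h1, fun x hx => ⟨h2 hx, h3 x hx⟩⟩
  · rintro ⟨h1, h2⟩; exact ⟨⟨h1, fun x hx => (h2 hx).1⟩, fun x hx => (h2 hx).2⟩

lemma Ler.induced {U : Type*} [DecidableEq U] {K : Set (Finset U)} {d : ℕ} (h : Ler d K)
    (S : Finset U) : Ler d (induced K S) := by
  intro T n hn
  rw [induced_induced]
  exact h _ _ hn

lemma Ler.van {U : Type*} [Fintype U] [DecidableEq U] {K : Set (Finset U)} {d : ℕ} (h : Ler d K)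
    {n : ℕ} (hn : d < n) : Van K n := by
  have := h Finset.univ n hn
  rwa [show _root_.induced K Finset.univ = K by ext; simp [_root_.induced]] at this

lemma Ler.dl {U : Type*} [Fintype U] [DecidableEq U] {K : Set (Finset U)} {d : ℕ} (h : Ler d K)
    (B : Set U) : Ler d (dl K B) := by
  classical
  have : LC.dl K B = _root_.induced K (Finset.univ.filter (· ∉ B)) := by
    rw [← dl_induced]
    congr 1
    ext; simp [_root_.induced]
  rw [this]
  exact h.induced _

lemma lk_induced {U : Type*} [DecidableEq U] (K : Set (Finset U)) (b : U)
    (S : Finset U) : induced (lk K b) S = lk (induced K (insert b S)) b := by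
  ext σ
  simp only [induced, lk, Set.mem_ofPred_eq]
  constructor
  · rintro ⟨⟨h1, h2⟩, h3⟩; exact ⟨h1, h2, Finset.insert_subset_insert _ h3⟩
  · rintro ⟨h1, h2, h3⟩
    refine ⟨⟨h1, h2⟩, fun x hx => ?_⟩
    have := h3 (Finset.mem_insert_of_mem hx)
    rcases Finset.mem_insert.1 this with rfl | h
    · exact absurd hx h1
    · exact h

lemma NA_singleton {U : Type*} (K : Set (Finset U)) (b : U) : NA K {b} := by
  rintro σ - x - y - rfl rfl; rfl

lemma lk_subset_dl {U : Type*} [DecidableEq U] {K : Set (Finset U)} (hK : IsComplex K) (b : U) :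
    lk K b ⊆ dl K {b} := fun σ hσ =>
  ⟨lk_subset hK b hσ, fun x hx h => hσ.1 (by rw [← Set.mem_singleton_iff.1 h]; exact hx)⟩

lemma Ler.lk {U : Type*} [Fintype U] [DecidableEq U] {K : Set (Finset U)} (hK : IsComplex K)
    {d : ℕ} (h : Ler d K) (b : U) : Ler d (lk K b) := by
  intro S n hn
  rw [lk_induced]
  have hL := h.induced (insert b S)
  have hLc := induced_complex hK (insert b S)
  generalize _root_.induced K (insert b S) = L at hL hLc
  intro z hz hz0
  obtain ⟨c, hc, hcz⟩ := (hL.dl {b}).van hn z (C_mono (lk_subset_dl hLc b) _ hz) hz0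
  have := L1conv hLc (NA_singleton L b) (hL.van (Nat.lt_succ_of_lt hn))
    (fun x => if x = b then z else 0)
    (fun x => by split_ifs with h; · rw [h]; exact hz
                 · exact Submodule.zero_mem _)
    (fun x hx => by simp at hx; simp [hx])
    (fun x => by split_ifs; · exact hz0
                 · simp) c hc (by simp [hcz]) b
  simpa using this

lemma Ler_card_aux {U : Type*} [Fintype U] [DecidableEq U] (S : Finset U) :
    ∀ (K : Set (Finset U)), IsComplex K → ∀ n, S.card < n → Van (induced K S) n := by
  induction S using Finset.induction_on with
  | empty =>
    intro K hK n hn z hz _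
    have : z = 0 := map_eq_zero LinearMap.id (by
      rintro l ⟨h1, -, h2⟩
      have : l = [] := by simpa using h2
      subst this
      simp at h1 hn
      omega) hz
    exact ⟨0, Submodule.zero_mem _, by simp [this]⟩
  | insert v S hv ih =>
    intro K hK n hn
    rw [Finset.card_insert_of_notMem hv] at hn
    obtain ⟨n, rfl⟩ : ∃ k, n = k + 1 := ⟨n - 1, by omega⟩
    refine L1 (induced_complex hK _) (NA_singleton _ v) ?_ ?_
    · classical
      rw [dl_induced]
      have : (insert v S).filter (· ∉ ({v} : Set U)) = S := by
        ext x
        simp only [Finset.mem_filter, Finset.mem_insert, Set.mem_singleton_iff]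
        constructor
        · rintro ⟨h | h, h2⟩
          · exact absurd h h2
          · exact h
        · intro h
          exact ⟨Or.inr h, fun h' => hv (h' ▸ h)⟩
      have e : Finset.filter (fun x => x ∉ ({v} : Set U)) (insert v S) = S := this
      rw [e]
      exact ih K hK _ (by omega)
    · intro z hz _ hz0 c _ _ b hb
      rw [Set.mem_singleton_iff.1 hb]
      have := ih (lk K v) (lk_complex hK v) n (by omega)
      rw [lk_induced] at this
      exact this _ (hz v) (hz0 v)

lemma Ler_card {U : Type*} [Fintype U] [DecidableEq U] {K : Set (Finset U)} (hK : IsComplex K) :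
    Ler (Fintype.card U) K :=
  fun S n hn => Ler_card_aux S K hK n (lt_of_le_of_lt (Finset.card_le_univ S) hn)

/-- link of a set -/
def lks {U : Type*} [DecidableEq U] (K : Set (Finset U)) (τ : Finset U) : Set (Finset U) :=
  {σ | Disjoint σ τ ∧ σ ∪ τ ∈ K}

lemma Inj {U : Type*} [Fintype U] [DecidableEq U] {d n : ℕ} (hn : d < n + 1) : ∀ (k : ℕ)
    (K : Set (Finset U)), IsComplex K → Ler d K → ∀ B : Fin k → Set U, (∀ s, NA K (B s)) →
    (∀ s t, s ≠ t → Disjoint (B s) (B t)) →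
    ∀ z : (Fin k → U) → Ch U, (∀ w, z w ∈ C (lks K (Finset.univ.image w)) n) →
    (∀ w, (∃ s, w s ∉ B s) → z w = 0) → (∀ w, bd (z w) = 0) →
    ∀ c ∈ C (dl K (⋃ s, B s)) (n + 1), ∑ w, z w = bd c →
    ∀ w, ∃ c ∈ C (lks K (Finset.univ.image w)) (n + 1), bd c = z w := by
  classical
  intro k
  induction k with
  | zero =>
    intro K hK hL B _ _ z hz _ _ c hc hcz w
    refine ⟨c, C_mono ?_ _ hc, ?_⟩
    · rintro σ ⟨h1, -⟩
      refine ⟨by simp, by simpa using h1⟩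
    · rw [← hcz, Fintype.sum_unique]
      congr 1
      exact Subsingleton.elim _ _
  | succ k ih =>
    intro K hK hL B hB hdis z hz hz0 hzc c hc hcz w
    by_cases hw : ∃ s, w s ∉ B s
    · exact ⟨0, Submodule.zero_mem _, by simp [hz0 w hw]⟩
    push Not at hw
    set K0 := dl K (⋃ s : Fin k, B s.succ) with hK0
    have hK0c : IsComplex K0 := dl_complex hK _
    have hmem : ∀ b w', z (Fin.cons b w') ∈ C (lk K0 b) n := by
      intro b w'
      by_cases hw' : ∃ s, (Fin.cons b w' : Fin (k+1) → U) s ∉ B s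
      · rw [hz0 _ hw']; exact Submodule.zero_mem _
      push Not at hw'
      refine C_mono ?_ _ (hz (Fin.cons b w'))
      rintro σ ⟨h1, h2⟩
      rw [Finset.disjoint_left] at h1
      have hbσ : b ∉ σ := fun h => h1 h (Finset.mem_image.2 ⟨0, by simp, by simp⟩)
      refine ⟨hbσ, hK _ h2 _ ?_, ?_⟩
      · refine Finset.insert_subset ?_ Finset.subset_union_left
        exact Finset.mem_union_right _ (Finset.mem_image.2 ⟨0, by simp, by simp⟩)
      · intro x hx hxB
        obtain ⟨s, hs⟩ := Set.mem_iUnion.1 hxB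
        rcases Finset.mem_insert.1 hx with rfl | hx
        · have := hw' 0
          rw [Fin.cons_zero] at this
          exact Set.disjoint_left.1 (hdis 0 s.succ (Fin.succ_ne_zero s).symm) this hs
        · have h3 := hw' s.succ
          have h4 : (Fin.cons x w' : Fin (k+1) → U) s.succ = w' s := by simp
          rw [Fin.cons_succ] at h3
          have h5 : w' s ∈ Finset.univ.image (Fin.cons b w' : Fin (k+1) → U) :=
            Finset.mem_image.2 ⟨s.succ, by simp, by simp⟩
          have := hB s.succ _ h2 x (Finset.mem_union_left _ hx) (w' s)
            (Finset.mem_union_right _ h5) hs h3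
          exact h1 hx (this ▸ h5)
    obtain ⟨c0, hc0, hcz0⟩ := L1conv hK0c (NA_mono (hB 0) (fun σ h => h.1) : NA K0 (B 0))
      ((hL.dl _).van hn) (fun b => ∑ w' : Fin k → U, z (Fin.cons b w'))
      (fun b => Submodule.sum_mem _ fun w' _ => hmem b w')
      (fun b hb => Finset.sum_eq_zero fun w' _ => hz0 _ ⟨0, by simpa using hb⟩)
      (fun b => by simp [hzc]) c
      (C_mono (by intro σ hσ; exact ⟨⟨hσ.1, fun b hb h => hσ.2 b hb (by
          obtain ⟨s, hs⟩ := Set.mem_iUnion.1 h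
          exact Set.mem_iUnion.2 ⟨_, hs⟩)⟩,
        fun b hb h => hσ.2 b hb (Set.mem_iUnion.2 ⟨0, h⟩)⟩) _ hc)
      (by
        rw [← hcz, ← (Fin.consEquiv (fun _ : Fin (k+1) => U)).sum_comp, Fintype.sum_prod_type]
        rfl) (w 0)
    have hcons : ∀ w' : Fin k → U, Finset.univ.image (Fin.cons (w 0) w' : Fin (k+1) → U)
        = insert (w 0) (Finset.univ.image w') := by
      intro w'
      ext x
      simp [Fin.exists_fin_succ, eq_comm]
    have hlks : ∀ w' : Fin k → U, (∀ s, w' s ∈ B s.succ) →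
        lks K (Finset.univ.image (Fin.cons (w 0) w' : Fin (k+1) → U))
        = lks (lk K (w 0)) (Finset.univ.image w') := by
      intro w' hw'
      have h0 : w 0 ∉ Finset.univ.image w' := by
        intro h
        obtain ⟨s, -, hs⟩ := Finset.mem_image.1 h
        have := hw' s
        rw [hs] at this
        exact Set.disjoint_left.1 (hdis 0 s.succ (Fin.succ_ne_zero s).symm) (hw 0) this
      rw [hcons]
      ext σ
      simp only [lks, lk, Set.mem_ofPred_eq, Finset.disjoint_insert_right, Finset.union_insert,
        Finset.mem_union, not_or]
      tauto
    obtain ⟨c1, h1, h2⟩ := ih (lk K (w 0)) (lk_complex hK _) (hL.lk hK _) (fun s => B s.succ)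
      (fun s => NA_mono (hB s.succ) (lk_subset hK _))
      (fun s t hst => hdis _ _ (by simpa using hst))
      (fun w' => z (Fin.cons (w 0) w'))
      (fun w' => by
        by_cases hw' : ∀ s, w' s ∈ B s.succ
        · rw [← hlks w' hw']; exact hz _
        · push Not at hw'
          obtain ⟨s, hs⟩ := hw'
          rw [hz0 _ ⟨s.succ, by simpa using hs⟩]; exact Submodule.zero_mem _)
      (fun w' ⟨s, hs⟩ => hz0 _ ⟨s.succ, by simpa using hs⟩)
      (fun w' => hzc _) c0
      (C_mono (by intro σ hσ; exact ⟨⟨hσ.1, hσ.2.1⟩, fun b hb => hσ.2.2 b (Finset.mem_insert_of_mem hb)⟩)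
        _ hc0) hcz0.symm (Fin.tail w)
    rw [← hlks (Fin.tail w) (fun s => hw s.succ), Fin.cons_self_tail] at h1
    rw [Fin.cons_self_tail] at h2
    exact ⟨c1, h1, h2⟩

lemma Merge {U : Type*} [Fintype U] [DecidableEq U] {d k : ℕ} {K K' : Set (Finset U)}
    (hK : IsComplex K) (hK' : IsComplex K') (hL : Ler d K) (B : Fin k → Set U)
    (hB : ∀ s, NA K (B s)) (hdis : ∀ s t, s ≠ t → Disjoint (B s) (B t))
    (B' : Set U) (hB' : NA K' B') (g : U → Fin k → U) (hg : ∀ b ∈ B', ∀ s, g b s ∈ B s)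
    (hgi : Set.InjOn g B') (h1 : dl K' B' = dl K (⋃ s, B s))
    (h2 : ∀ b ∈ B', lk K' b = lks K (Finset.univ.image (g b))) : Ler d K' := by
  classical
  intro S n hn
  obtain ⟨n, rfl⟩ : ∃ k, n = k + 1 := ⟨n - 1, by omega⟩
  have hd : dl (induced K' S) B' = dl (induced K S) (⋃ s, B s) := by
    ext σ
    have := Set.ext_iff.1 h1 σ
    simp only [dl, induced, Set.mem_ofPred_eq] at this ⊢
    tauto
  refine L1 (induced_complex hK' _) (NA_mono hB' (induced_subset _ _)) ?_ ?_
  · rw [hd]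
    exact ((hL.induced S).dl _).van hn
  intro z hz hz0 hzc c hc hcz b hb
  by_cases hbS : b ∈ S
  swap
  · refine ⟨0, Submodule.zero_mem _, ?_⟩
    have : z b = 0 := map_eq_zero LinearMap.id (by
      rintro l ⟨-, -, -, h⟩
      exact absurd (h (Finset.mem_insert_self _ _)) hbS) (hz b)
    simp [this]
  -- avoidance
  have hav : ∀ b ∈ B', ∀ σ ∈ lks K (Finset.univ.image (g b)), ∀ x ∈ σ, x ∉ ⋃ s, B s := by
    intro b hb σ hσ x hx hxB
    obtain ⟨s, hs⟩ := Set.mem_iUnion.1 hxB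
    have h3 : g b s ∈ Finset.univ.image (g b) := Finset.mem_image_of_mem _ (Finset.mem_univ _)
    have := hB s _ hσ.2 x (Finset.mem_union_left _ hx) (g b s) (Finset.mem_union_right _ h3) hs
      (hg b hb s)
    exact Finset.disjoint_left.1 hσ.1 hx (this ▸ h3)
  set S' : Finset U := S ∪ Finset.univ.filter (· ∈ ⋃ s, B s) with hS'
  set L := induced K S' with hLdef
  have hlk : ∀ b ∈ B', b ∈ S → lk (induced K' S) b = lks L (Finset.univ.image (g b)) := by
    intro b hb hbS
    ext σ
    have h3 := Set.ext_iff.1 (h2 b hb) σ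
    constructor
    · rintro ⟨h4, h5, h6⟩
      have h7 := h3.1 ⟨h4, h5⟩
      refine ⟨h7.1, h7.2, Finset.union_subset ?_ ?_⟩
      · exact ((Finset.subset_insert _ _).trans h6).trans Finset.subset_union_left
      · intro x hx
        obtain ⟨s, -, rfl⟩ := Finset.mem_image.1 hx
        exact Finset.mem_union_right _ (by simpa using ⟨s, hg b hb s⟩)
    · rintro ⟨h4, h5, h6⟩
      have h7 := h3.2 ⟨h4, h5⟩
      refine ⟨h7.1, h7.2, Finset.insert_subset hbS fun x hx => ?_⟩
      rcases Finset.mem_union.1 (h6 (Finset.mem_union_left _ hx)) with h | h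
      · exact h
      · exact absurd (Finset.mem_filter.1 h).2 (hav b hb σ ⟨h4, h5⟩ x hx)
  have hzmem : ∀ b' ∈ B', z b' ∈ C (lks L (Finset.univ.image (g b'))) n := by
    intro b' hb'
    by_cases hbS' : b' ∈ S
    · rw [← hlk b' hb' hbS']; exact hz b'
    · have : z b' = 0 := map_eq_zero LinearMap.id (by
        rintro l ⟨-, -, -, h⟩
        exact absurd (h (Finset.mem_insert_self _ _)) hbS') (hz b')
      rw [this]; exact Submodule.zero_mem _
  obtain ⟨c', hc', hcz'⟩ := Inj hn k L (induced_complex hK _) (hL.induced _) B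
    (fun s => NA_mono (hB s) (induced_subset _ _)) hdis
    (fun w => ∑ b : U, if g b = w then z b else 0)
    (fun w => Submodule.sum_mem _ fun b' _ => by
      by_cases hb' : b' ∈ B'
      · split_ifs with h
        · rw [← h]; exact hzmem b' hb'
        · exact Submodule.zero_mem _
      · rw [hz0 b' hb']; simp)
    (fun w ⟨s, hs⟩ => Finset.sum_eq_zero fun b' _ => by
      by_cases hb' : b' ∈ B'
      · rw [if_neg]
        rintro rfl
        exact hs (hg b' hb' s)
      · rw [hz0 b' hb']; simp)
    (fun w => by
      rw [map_sum]
      refine Finset.sum_eq_zero fun b' _ => ?_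
      split_ifs
      · exact hzc b'
      · simp) c
    (by
      rw [hd] at hc
      refine C_mono (by intro σ hσ; exact ⟨⟨hσ.1.1, hσ.1.2.trans Finset.subset_union_left⟩, hσ.2⟩) _ hc)
    (by
      rw [← hcz, Finset.sum_comm]
      simp) (g b)
  rw [← hlk b hb hbS] at hc'
  refine ⟨c', hc', hcz'.trans ?_⟩
  rw [Finset.sum_eq_single b]
  · simp
  · intro b' _ hne
    by_cases hb' : b' ∈ B'
    · rw [if_neg]
      exact fun h => hne (hgi hb' hb h)
    · rw [hz0 b' hb']; simp
  · simp


/-! Künneth-type vanishing for joins -/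

noncomputable def eps {U : Type*} : Ch U →ₗ[ℚ] Ch U :=
  Finsupp.linearCombination ℚ (fun l => ((-1 : ℚ) ^ l.length) • Finsupp.single l 1)

lemma eps_single {U : Type*} (l : List U) :
    eps (Finsupp.single l 1) = ((-1 : ℚ) ^ l.length) • Finsupp.single l 1 := by
  simp [eps]

lemma eps_pre {U : Type*} (v : U) : eps ∘ₗ pre v = - (pre v ∘ₗ eps) := by
  apply lhom_ext
  intro l
  simp only [LinearMap.comp_apply, LinearMap.neg_apply, pre_single, eps_single, map_smul,
    List.length_cons, pow_succ]
  simp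

lemma eps_eps {U : Type*} : eps ∘ₗ eps = (LinearMap.id : Ch U →ₗ[ℚ] Ch U) := by
  apply lhom_ext
  intro l
  simp only [LinearMap.comp_apply, eps_single, map_smul, smul_smul, LinearMap.id_apply]
  rw [← pow_add, Even.neg_one_pow ⟨_, rfl⟩, one_smul]

lemma eps_of_mem {U : Type*} {P : Set (List U)} {n : ℕ} (hP : ∀ l ∈ P, l.length = n) {x : Ch U}
    (hx : x ∈ S P) : eps x = ((-1 : ℚ) ^ n) • x := by
  have := map_eq_zero (eps - ((-1 : ℚ) ^ n) • LinearMap.id) (P := P)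
    (fun l hl => by simp only [LinearMap.sub_apply, eps_single, hP l hl]; simp) hx
  simpa [sub_eq_zero] using this

lemma eps_bd {U : Type*} : eps ∘ₗ bd = - (bd ∘ₗ eps : Ch U →ₗ[ℚ] Ch U) := by
  classical
  apply lhom_ext
  intro l
  simp only [LinearMap.comp_apply, LinearMap.neg_apply, bd_single, eps_single, map_smul]
  cases l with
  | nil => simp [bl]
  | cons v l =>
    rw [eps_of_mem (n := l.length) _ (bl_mem (v :: l))]
    · simp [pow_succ]
    · rintro l' ⟨h, -⟩
      simpa using h

open TensorProduct

abbrev TT (U : Type*) := Ch U ⊗[ℚ] Ch U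

noncomputable def bT {U : Type*} : TT U →ₗ[ℚ] TT U :=
  TensorProduct.map bd LinearMap.id + TensorProduct.map eps bd

open Classical in
noncomputable def R {U : Type*} (A : Set U) (v : U) : TT U →ₗ[ℚ] TT U :=
  if v ∈ A then TensorProduct.map (pre v) LinearMap.id else TensorProduct.map eps (pre v)

lemma T_ext {U : Type*} {M : Type*} [AddCommGroup M] [Module ℚ M] {f g : TT U →ₗ[ℚ] M}
    (h : ∀ x y, f (x ⊗ₜ y) = g (x ⊗ₜ y)) : f = g := TensorProduct.ext' h

lemma bT_R {U : Type*} (A : Set U) (v : U) : bT ∘ₗ R A v = LinearMap.id - R A v ∘ₗ bT := by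
  apply T_ext
  intro x y
  have h1 : eps (pre v x) = - pre v (eps x) := LinearMap.congr_fun (eps_pre v) x
  have h2 : eps (eps x) = x := LinearMap.congr_fun eps_eps x
  have h3 : eps (bd x) = - bd (eps x) := LinearMap.congr_fun eps_bd x
  by_cases hv : v ∈ A
  · simp only [bT, R, hv, if_true, LinearMap.comp_apply, LinearMap.add_apply, LinearMap.sub_apply,
      TensorProduct.map_tmul, LinearMap.id_apply, map_add, bd_pre, h1, TensorProduct.sub_tmul,
      TensorProduct.neg_tmul]
    abel
  · simp only [bT, R, hv, if_false, LinearMap.comp_apply, LinearMap.add_apply, LinearMap.sub_apply,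
      TensorProduct.map_tmul, LinearMap.id_apply, map_add, bd_pre, h2, h3, TensorProduct.tmul_sub,
      TensorProduct.neg_tmul]
    abel

lemma bT_R_apply {U : Type*} (A : Set U) (v : U) (x : TT U) :
    bT (R A v x) = x - R A v (bT x) := LinearMap.congr_fun (bT_R A v) x

noncomputable def phl {U : Type*} (A : Set U) : List U → TT U
  | [] => Finsupp.single [] 1 ⊗ₜ Finsupp.single [] 1
  | v :: l => R A v (phl A l)

noncomputable def ph {U : Type*} (A : Set U) : Ch U →ₗ[ℚ] TT U :=
  Finsupp.linearCombination ℚ (phl A)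

lemma ph_single {U : Type*} (A : Set U) (l : List U) : ph A (Finsupp.single l 1) = phl A l := by
  simp [ph]

lemma ph_pre {U : Type*} (A : Set U) (v : U) (x : Ch U) : ph A (pre v x) = R A v (ph A x) := by
  have : ph A ∘ₗ pre v = R A v ∘ₗ ph A := by
    apply lhom_ext
    intro l
    simp [pre_single, ph_single, phl]
  exact LinearMap.congr_fun this x

lemma ph_bl {U : Type*} (A : Set U) (l : List U) : bT (phl A l) = ph A (bl l) := by
  induction l with
  | nil => simp [phl, bl, bT, bd_single]
  | cons v l ih => simp [phl, bl, bT_R_apply, ih, ph_pre, ph_single]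

lemma ph_bd {U : Type*} (A : Set U) (x : Ch U) : bT (ph A x) = ph A (bd x) := by
  have : bT ∘ₗ ph A = ph A ∘ₗ bd := by
    apply lhom_ext
    intro l
    simp [ph_single, ph_bl, bd_single]
  exact LinearMap.congr_fun this x

/-- right concatenation -/
noncomputable def app {U : Type*} (l : List U) : Ch U →ₗ[ℚ] Ch U :=
  Finsupp.lmapDomain ℚ ℚ (fun m => l ++ m)

noncomputable def catb {U : Type*} : Ch U →ₗ[ℚ] Ch U →ₗ[ℚ] Ch U :=
  Finsupp.linearCombination ℚ app

lemma catb_single {U : Type*} (l m : List U) :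
    catb (Finsupp.single l 1) (Finsupp.single m 1) = Finsupp.single (l ++ m) 1 := by
  simp [catb, app, Finsupp.mapDomain_single]

lemma catb_pre {U : Type*} (v : U) (x y : Ch U) : catb (pre v x) y = pre v (catb x y) := by
  have : catb ∘ₗ pre v = (LinearMap.llcomp ℚ (Ch U) (Ch U) (Ch U) (pre v)) ∘ₗ catb := by
    apply lhom_ext
    intro l
    apply lhom_ext
    intro m
    simp [pre_single, catb_single]
  exact LinearMap.congr_fun (LinearMap.congr_fun this x) y

lemma catb_nil {U : Type*} (y : Ch U) : catb (Finsupp.single [] 1) y = y := by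
  have : catb (Finsupp.single [] 1) = (LinearMap.id : Ch U →ₗ[ℚ] Ch U) := by
    apply lhom_ext
    intro m
    simp [catb_single]
  exact LinearMap.congr_fun this y

noncomputable def ps {U : Type*} : TT U →ₗ[ℚ] Ch U := TensorProduct.lift catb

lemma bd_catb {U : Type*} (l : List U) (y : Ch U) :
    bd (catb (Finsupp.single l 1) y) =
      catb (bl l) y + ((-1 : ℚ) ^ l.length) • catb (Finsupp.single l 1) (bd y) := by
  induction l with
  | nil => simp [catb_nil, bl]
  | cons v l ih =>
    rw [← pre_single, catb_pre, bd_pre, ih]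
    simp only [bl, catb_pre, map_sub, LinearMap.sub_apply, List.length_cons, pow_succ, map_add,
      map_smul]
    simp only [mul_neg, mul_one, neg_smul]
    abel

lemma ps_bT {U : Type*} (t : TT U) : ps (bT t) = bd (ps t) := by
  have : ps ∘ₗ bT = (bd ∘ₗ ps : TT U →ₗ[ℚ] Ch U) := by
    apply TensorProduct.ext
    apply lhom_ext
    intro l
    apply LinearMap.ext
    intro y
    simp only [ps, bT, bd_catb, bd_single, eps_single, LinearMap.compr₂ₛₗ_apply,
      TensorProduct.mk_apply, LinearMap.comp_apply, LinearMap.add_apply, TensorProduct.map_tmul,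
      map_add, TensorProduct.lift.tmul, LinearMap.id_apply, map_smul, LinearMap.smul_apply]
  exact LinearMap.congr_fun this t

/-- homotopy between `ps ∘ ph` and the identity -/
noncomputable def Dl {U : Type*} (A : Set U) : List U → Ch U
  | [] => 0
  | v :: l => pre v (ps (R A v (phl A l))) - pre v (Dl A l)

noncomputable def D {U : Type*} (A : Set U) : Ch U →ₗ[ℚ] Ch U :=
  Finsupp.linearCombination ℚ (Dl A)

lemma D_single {U : Type*} (A : Set U) (l : List U) : D A (Finsupp.single l 1) = Dl A l := by
  simp [D]

lemma D_pre {U : Type*} (A : Set U) (v : U) (x : Ch U) :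
    D A (pre v x) = pre v (ps (R A v (ph A x))) - pre v (D A x) := by
  have : D A ∘ₗ pre v = pre v ∘ₗ ps ∘ₗ R A v ∘ₗ ph A - pre v ∘ₗ D A := by
    apply lhom_ext
    intro l
    simp [pre_single, ph_single, D_single, Dl]
  exact LinearMap.congr_fun this x

lemma D_htpy_list {U : Type*} (A : Set U) (l : List U) :
    bd (Dl A l) + D A (bl l) = ps (phl A l) - Finsupp.single l 1 := by
  induction l with
  | nil => simp [Dl, bl, phl, ps, catb_single]
  | cons v l ih =>
    have ih' : D A (bl l) = ps (phl A l) - Finsupp.single l 1 - bd (Dl A l) := by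
      rw [← ih]; abel
    simp only [Dl, bl, map_sub, bd_pre, D_pre, ← ps_bT, bT_R_apply, ph_bl, D_single, ih', phl,
      ← pre_single v l]
    abel

lemma D_htpy {U : Type*} (A : Set U) (x : Ch U) :
    bd (D A x) + D A (bd x) = ps (ph A x) - x := by
  have : bd ∘ₗ D A + D A ∘ₗ bd = ps ∘ₗ ph A - LinearMap.id := by
    apply lhom_ext
    intro l
    simp [ph_single, D_single, bd_single, D_htpy_list]
  exact LinearMap.congr_fun this x

open Classical in
lemma phl_eq {U : Type*} (A : Set U) (l : List U) : ∃ a : ℚ, phl A l =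
    a • (Finsupp.single (l.filter (· ∈ A)) 1 ⊗ₜ Finsupp.single (l.filter (· ∉ A)) 1) := by
  induction l with
  | nil => exact ⟨1, by simp [phl]⟩
  | cons v l ih =>
    obtain ⟨a, ha⟩ := ih
    by_cases hv : v ∈ A
    · refine ⟨a, ?_⟩
      simp [phl, ha, R, hv, pre_single]
    · refine ⟨a * (-1) ^ (l.filter (· ∈ A)).length, ?_⟩
      simp only [phl, ha, R, hv, if_false, map_smul, TensorProduct.map_tmul, eps_single,
        pre_single, mul_smul]
      simp [hv, TensorProduct.smul_tmul']

lemma ps_single {U : Type*} (l m : List U) :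
    ps (Finsupp.single l 1 ⊗ₜ Finsupp.single m 1) = Finsupp.single (l ++ m) 1 := by
  simp [ps, catb_single]

lemma Dl_mem {U : Type*} [DecidableEq U] (A : Set U) (l : List U) :
    Dl A l ∈ S {l' | l'.length = l.length + 1 ∧ l'.toFinset ⊆ l.toFinset} := by
  classical
  induction l with
  | nil => simp [Dl]
  | cons v l ih =>
    have e : R A v (phl A l) = phl A (v :: l) := rfl
    rw [Dl, e]
    refine Submodule.sub_mem _ ?_ (map_mem _ ?_ ih)
    · obtain ⟨a, ha⟩ := phl_eq A (v :: l)
      rw [ha, map_smul, map_smul, ps_single, pre_single]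
      refine Submodule.smul_mem _ _ (single_mem ⟨?_, ?_⟩)
      · have := List.length_eq_length_filter_add (l := v :: l) (fun x => decide (x ∈ A))
        simp only [List.length_cons, List.length_append] at this ⊢
        rw [this]
        congr 3
        apply List.filter_congr
        simp
      · intro x
        simp only [List.mem_toFinset, List.mem_cons, List.mem_append, List.mem_filter]
        tauto
    · rintro l' ⟨h1, h2⟩
      rw [pre_single]
      refine single_mem ⟨by simp [h1], ?_⟩
      simp only [List.toFinset_cons]
      exact Finset.insert_subset_insert _ h2

lemma D_mem {U : Type*} [DecidableEq U] (A : Set U) {K : Set (Finset U)} (hK : IsComplex K)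
    {n : ℕ} {x : Ch U} (hx : x ∈ C K n) : D A x ∈ C K (n + 1) := by
  refine map_mem _ ?_ hx
  rintro l ⟨h1, h2⟩
  rw [D_single]
  refine S_mono ?_ (Dl_mem A l)
  rintro l' ⟨h3, h4⟩
  exact ⟨by omega, hK _ h2 _ h4⟩

/-! sections -/

lemma exists_g {U : Type*} [DecidableEq U] (K : Set (Finset U)) (n : ℕ) :
    ∃ g : Ch U →ₗ[ℚ] Ch U, (∀ x, g x ∈ C K (n + 1)) ∧
      ∀ z ∈ C K (n + 1), bd (g (bd z)) = bd z := by
  let f : C K (n + 1) →ₗ[ℚ] Ch U := bd ∘ₗ (C K (n + 1)).subtype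
  obtain ⟨s, hs⟩ := f.rangeRestrict.exists_rightInverse_of_surjective f.range_rangeRestrict
  obtain ⟨g, hg⟩ := LinearMap.exists_extend s
  refine ⟨(C K (n + 1)).subtype ∘ₗ g, fun x => (g x).2, fun z hz => ?_⟩
  have h1 := LinearMap.congr_fun hg ⟨bd z, ⟨⟨z, hz⟩, rfl⟩⟩
  have h2 := LinearMap.congr_fun hs ⟨bd z, ⟨⟨z, hz⟩, rfl⟩⟩
  have h3 := congrArg Subtype.val h2
  simp only [LinearMap.comp_apply, Submodule.subtype_apply] at h1 ⊢
  rw [h1]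
  exact h3

lemma exists_h {U : Type*} [DecidableEq U] {K : Set (Finset U)} (hK : IsComplex K) {a : ℕ}
    (hv : ∀ n, a < n → Van K n) :
    ∃ h : Ch U →ₗ[ℚ] Ch U, (∀ l, h (Finsupp.single l 1) ∈ C K (l.length + 1)) ∧
      ∀ n, a < n → ∀ z ∈ C K n, bd (h z) + h (bd z) = z := by
  choose g hg1 hg2 using exists_g K
  let kk : ℕ → Ch U →ₗ[ℚ] Ch U := fun n => g n ∘ₗ (LinearMap.id - g (n - 1) ∘ₗ bd)
  let h : Ch U →ₗ[ℚ] Ch U :=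
    Finsupp.linearCombination ℚ (fun l => kk l.length (Finsupp.single l 1))
  have hh : ∀ n, ∀ z ∈ C K n, h z = g n (z - g (n - 1) (bd z)) := by
    intro n z hz
    have : (h - kk n) z = 0 := by
      refine map_eq_zero _ ?_ hz
      rintro l ⟨h1, h2⟩
      simp [h, h1]
    rw [LinearMap.sub_apply, sub_eq_zero] at this
    rw [this]
    simp [kk]
  refine ⟨h, fun l => ?_, fun n hn z hz => ?_⟩
  · simp only [h, Finsupp.linearCombination_single, one_smul]
    exact hg1 _ _
  · obtain ⟨n, rfl⟩ : ∃ k, n = k + 1 := ⟨n - 1, by omega⟩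
    rw [hh _ z hz, hh n _ (bd_mem hK hz), bd_bd, map_zero, sub_zero, Nat.add_sub_cancel]
    obtain ⟨c, hc, hcz⟩ := hv _ hn (z - g n (bd z)) (Submodule.sub_mem _ hz (hg1 _ _))
      (by rw [map_sub, hg2 n z hz, sub_self])
    rw [← hcz, hg2 _ c hc, hcz]
    abel

lemma eps_h {U : Type*} [DecidableEq U] {K : Set (Finset U)} {h : Ch U →ₗ[ℚ] Ch U}
    (hh : ∀ l, h (Finsupp.single l 1) ∈ C K (l.length + 1)) (x : Ch U) :
    eps (h x) = - h (eps x) := by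
  have : eps ∘ₗ h = - (h ∘ₗ eps) := by
    apply lhom_ext
    intro l
    simp only [LinearMap.comp_apply, LinearMap.neg_apply, eps_single, map_smul]
    rw [eps_of_mem (n := l.length + 1) (fun l hl => hl.1) (hh l)]
    simp [pow_succ]
  exact LinearMap.congr_fun this x

/-- bigraded piece of the tensor product -/
noncomputable def TM {U : Type*} [DecidableEq U] (X Y : Set (Finset U)) (Q : Set (ℕ × ℕ)) :
    Submodule ℚ (TT U) :=
  Submodule.span ℚ {t | ∃ p q, (p, q) ∈ Q ∧ ∃ x ∈ C X p, ∃ y ∈ C Y q, x ⊗ₜ y = t}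

lemma tmul_mem {U : Type*} [DecidableEq U] {X Y : Set (Finset U)} {Q : Set (ℕ × ℕ)} {p q : ℕ}
    (hpq : (p, q) ∈ Q) {x y : Ch U} (hx : x ∈ C X p) (hy : y ∈ C Y q) : x ⊗ₜ y ∈ TM X Y Q :=
  Submodule.subset_span ⟨p, q, hpq, x, hx, y, hy, rfl⟩

lemma TM_map {U : Type*} [DecidableEq U] {M : Type*} [AddCommGroup M] [Module ℚ M]
    {X Y : Set (Finset U)} {Q : Set (ℕ × ℕ)}
    (f : TT U →ₗ[ℚ] M) (N : Submodule ℚ M)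
    (h : ∀ p q, (p, q) ∈ Q → ∀ x ∈ C X p, ∀ y ∈ C Y q, f (x ⊗ₜ y) ∈ N) {t : TT U}
    (ht : t ∈ TM X Y Q) : f t ∈ N := by
  have : TM X Y Q ≤ N.comap f := by
    rw [TM, Submodule.span_le]
    rintro _ ⟨p, q, hpq, x, hx, y, hy, rfl⟩
    exact h p q hpq x hx y hy
  exact this ht

lemma TM_van {U : Type*} [DecidableEq U] {X Y : Set (Finset U)} (hX : IsComplex X)
    (hY : IsComplex Y) {a b : ℕ} (hva : ∀ n, a < n → Van X n) (hvb : ∀ n, b < n → Van Y n)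
    {n : ℕ} (hn : a + b < n) (t : TT U) (ht : t ∈ TM X Y {pq | pq.1 + pq.2 = n})
    (ht0 : bT t = 0) : ∃ c ∈ TM X Y {pq | pq.1 + pq.2 = n + 1}, bT c = t := by
  obtain ⟨h, hh1, hh2⟩ := exists_h hX hva
  obtain ⟨k, hk1, hk2⟩ := exists_h hY hvb
  have hhm : ∀ p, ∀ x ∈ C X p, h x ∈ C X (p + 1) := fun p x hx =>
    map_mem h (fun l hl => by have := hh1 l; rwa [hl.1] at this) hx
  have hkm : ∀ p, ∀ x ∈ C Y p, k x ∈ C Y (p + 1) := fun p x hx =>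
    map_mem k (fun l hl => by have := hk1 l; rwa [hl.1] at this) hx
  have hem : ∀ p, ∀ x ∈ C X p, eps x ∈ C X p := fun p x hx => by
    rw [eps_of_mem (n := p) (fun l hl => hl.1) hx]; exact Submodule.smul_mem _ _ hx
  have bd0 : ∀ (K : Set (Finset U)), ∀ x ∈ C K 0, bd x = 0 := fun K x hx =>
    map_eq_zero bd (fun l hl => by
      have : l = [] := List.length_eq_zero_iff.1 hl.1
      simp [this, bd_single, bl]) hx
  let E : Ch U →ₗ[ℚ] Ch U := LinearMap.id - bd ∘ₗ h - h ∘ₗ bd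
  let F : Ch U →ₗ[ℚ] Ch U := LinearMap.id - bd ∘ₗ k - k ∘ₗ bd
  have hEm : ∀ p, ∀ x ∈ C X p, E x ∈ C X p := by
    intro p x hx
    refine Submodule.sub_mem _ (Submodule.sub_mem _ hx (bd_mem hX (hhm p x hx))) ?_
    cases p with
    | zero => simp [bd0 X x hx]
    | succ p => exact hhm _ _ (bd_mem hX hx)
  have hE0 : ∀ p, a < p → ∀ x ∈ C X p, E x = 0 := by
    intro p hp x hx
    have := hh2 p hp x hx
    simp only [E, LinearMap.sub_apply, LinearMap.comp_apply, LinearMap.id_apply]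
    nth_rewrite 1 [← this]
    abel
  have hF0 : ∀ p, b < p → ∀ x ∈ C Y p, F x = 0 := by
    intro p hp x hx
    have := hk2 p hp x hx
    simp only [F, LinearMap.sub_apply, LinearMap.comp_apply, LinearMap.id_apply]
    nth_rewrite 1 [← this]
    abel
  let H1 : TT U →ₗ[ℚ] TT U := TensorProduct.map h LinearMap.id
  let H2 : TT U →ₗ[ℚ] TT U := TensorProduct.map eps k
  have id1 : bT ∘ₗ H1 + H1 ∘ₗ bT = LinearMap.id - TensorProduct.map E LinearMap.id := by
    apply T_ext
    intro x y
    simp only [bT, H1, E, LinearMap.comp_apply, LinearMap.add_apply, LinearMap.sub_apply,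
      TensorProduct.map_tmul, LinearMap.id_apply, map_add, eps_h hh1, TensorProduct.sub_tmul,
      TensorProduct.neg_tmul]
    abel
  have id2 : bT ∘ₗ H2 + H2 ∘ₗ bT = LinearMap.id - TensorProduct.map LinearMap.id F := by
    apply T_ext
    intro x y
    have h2 : eps (eps x) = x := LinearMap.congr_fun eps_eps x
    have h3 : eps (bd x) = - bd (eps x) := LinearMap.congr_fun eps_bd x
    simp only [bT, H2, F, LinearMap.comp_apply, LinearMap.add_apply, LinearMap.sub_apply,
      TensorProduct.map_tmul, LinearMap.id_apply, map_add, h2, h3, TensorProduct.tmul_sub,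
      TensorProduct.neg_tmul]
    abel
  set t' := TensorProduct.map E LinearMap.id t with ht'
  have e1 : bT (H1 t) = t - t' := by
    have := LinearMap.congr_fun id1 t
    simpa [ht0] using this
  have ht'0 : bT t' = 0 := by
    have : bT (bT (H1 t)) = 0 := by
      have hbb : (bT ∘ₗ bT : TT U →ₗ[ℚ] TT U) = 0 := by
        apply T_ext
        intro x y
        have h2 : eps (eps x) = x := LinearMap.congr_fun eps_eps x
        have h3 : eps (bd x) = - bd (eps x) := LinearMap.congr_fun eps_bd x
        simp [bT, bd_bd, h3, TensorProduct.neg_tmul]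
      exact LinearMap.congr_fun hbb _
    rw [e1, map_sub, ht0, zero_sub, neg_eq_zero] at this
    exact this
  have ht'm : t' ∈ TM X Y {pq | pq.1 + pq.2 = n ∧ pq.1 ≤ a} := by
    refine TM_map _ _ ?_ ht
    intro p q hpq x hx y hy
    simp only [TensorProduct.map_tmul, LinearMap.id_apply]
    by_cases hp : a < p
    · rw [hE0 p hp x hx, TensorProduct.zero_tmul]; exact Submodule.zero_mem _
    · exact tmul_mem (p := p) (q := q) (show p + q = n ∧ p ≤ a from ⟨hpq, not_lt.1 hp⟩)
        (hEm p x hx) hy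
  have hFt : TensorProduct.map LinearMap.id F t' = 0 := by
    have := TM_map (TensorProduct.map LinearMap.id F) (⊥ : Submodule ℚ (TT U)) (by
      rintro p q ⟨h1, h2⟩ x hx y hy
      simp only [TensorProduct.map_tmul]
      dsimp only at h1 h2
      rw [hF0 q (by omega) y hy, TensorProduct.tmul_zero]; exact Submodule.zero_mem _) ht'm
    simpa using this
  have e2 : bT (H2 t') = t' := by
    have := LinearMap.congr_fun id2 t'
    simpa [ht'0, hFt] using this
  refine ⟨H1 t + H2 t', Submodule.add_mem _ ?_ ?_, by rw [map_add, e1, e2]; abel⟩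
  · refine TM_map _ _ ?_ ht
    intro p q hpq x hx y hy
    have hpq' : p + q = n := hpq
    exact tmul_mem (p := p + 1) (q := q) (show p + 1 + q = n + 1 by omega) (hhm p x hx) hy
  · refine TM_map _ _ ?_ ht'm
    intro p q hpq x hx y hy
    have hpq' : p + q = n := hpq.1
    exact tmul_mem (p := p) (q := q + 1) (show p + (q + 1) = n + 1 by omega) (hem p x hx)
      (hkm q y hy)

open Classical in
lemma join_van {U : Type*} [DecidableEq U] {X Y J : Set (Finset U)} (hX : IsComplex X)
    (hY : IsComplex Y) (hJ : IsComplex J) (A : Set U)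
    (hJX : ∀ σ ∈ J, σ.filter (· ∈ A) ∈ X) (hJY : ∀ σ ∈ J, σ.filter (· ∉ A) ∈ Y)
    (hXY : ∀ σ ∈ X, ∀ τ ∈ Y, σ ∪ τ ∈ J)
    {a b : ℕ} (hva : ∀ n, a < n → Van X n) (hvb : ∀ n, b < n → Van Y n)
    {n : ℕ} (hn : a + b < n) : Van J n := by
  intro z hz hz0
  obtain ⟨c, hc, hcz⟩ := TM_van hX hY hva hvb hn (ph A z) (by
      refine map_mem _ ?_ hz
      rintro l ⟨h1, h2⟩
      rw [ph_single]
      obtain ⟨r, hr⟩ := phl_eq A l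
      rw [hr]
      refine Submodule.smul_mem _ _ (tmul_mem (p := _) (q := _) ?_ (single_mem ⟨rfl, ?_⟩)
        (single_mem ⟨rfl, ?_⟩))
      · have := List.length_eq_length_filter_add (l := l) (fun x => decide (x ∈ A))
        rw [h1] at this
        show (l.filter (· ∈ A)).length + (l.filter (· ∉ A)).length = n
        rw [this]
        congr 2
        apply List.filter_congr
        simp
      · convert hJX _ h2
        ext x; simp
      · convert hJY _ h2
        ext x; simp) (by rw [ph_bd, hz0, map_zero])
  refine ⟨ps c - D A z, Submodule.sub_mem _ ?_ (D_mem A hJ hz), ?_⟩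
  · refine TM_map _ _ ?_ hc
    intro p q hpq x hx y hy
    have hpq' : p + q = n + 1 := hpq
    simp only [ps, TensorProduct.lift.tmul]
    refine map_mem (catb.flip y) ?_ hx
    rintro l ⟨h1, h2⟩
    rw [LinearMap.flip_apply]
    refine map_mem _ ?_ hy
    rintro m ⟨h3, h4⟩
    rw [catb_single]
    refine single_mem ⟨by simp; omega, ?_⟩
    rw [List.toFinset_append]
    exact hXY _ h2 _ h4
  · have := D_htpy A z
    rw [hz0, map_zero, add_zero] at this
    rw [map_sub, ← ps_bT, hcz, this]
    abel


/-! Transfer along injective vertex maps -/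

noncomputable def fm {V U : Type*} (f : V → U) : Ch V →ₗ[ℚ] Ch U :=
  Finsupp.lmapDomain ℚ ℚ (List.map f)

lemma fm_single {V U : Type*} (f : V → U) (l : List V) (a : ℚ) :
    fm f (Finsupp.single l a) = Finsupp.single (l.map f) a := by
  simp [fm, Finsupp.mapDomain_single]

lemma fm_pre {V U : Type*} (f : V → U) (v : V) (x : Ch V) :
    fm f (pre v x) = pre (f v) (fm f x) := by
  have : fm f ∘ₗ pre v = pre (f v) ∘ₗ fm f := by
    apply lhom_ext
    intro l
    simp [pre_single, fm_single]
  exact LinearMap.congr_fun this x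

lemma fm_bd {V U : Type*} (f : V → U) (x : Ch V) : fm f (bd x) = bd (fm f x) := by
  have h : ∀ l : List V, fm f (bl l) = bl (l.map f) := by
    intro l
    induction l with
    | nil => simp [bl]
    | cons v l ih => simp [bl, fm_single, fm_pre, ih]
  have : fm f ∘ₗ bd = bd ∘ₗ fm f := by
    apply lhom_ext
    intro l
    simp [bd_single, fm_single, h]
  exact LinearMap.congr_fun this x

lemma transfer {V U : Type*} [DecidableEq V] [DecidableEq U] (f : V → U)
    (hf : Function.Injective f) {K : Set (Finset V)} {K' : Set (Finset U)}
    (h1 : ∀ σ : Finset V, σ.image f ∈ K' ↔ σ ∈ K)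
    (h2 : ∀ σ ∈ K', ∀ u ∈ σ, ∃ v, f v = u) (n : ℕ) : Van K n ↔ Van K' n := by
  have hinj : Function.Injective (fm f) :=
    Finsupp.mapDomain_injective (List.map_injective_iff.2 hf)
  have htf : ∀ l : List V, (l.map f).toFinset = l.toFinset.image f := by
    intro l; ext x; simp
  have hm : ∀ n, ∀ x ∈ C K n, fm f x ∈ C K' n := by
    intro n x hx
    refine map_mem _ ?_ hx
    rintro l ⟨h3, h4⟩
    rw [fm_single]
    exact single_mem ⟨by simp [h3], by rw [htf]; exact (h1 _).2 h4⟩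
  have hs : ∀ n, ∀ y ∈ C K' n, ∃ x ∈ C K n, fm f x = y := by
    intro n y hy
    have : (LinearMap.id : Ch U →ₗ[ℚ] Ch U) y ∈ (C K n).map (fm f) := by
      refine map_mem _ ?_ hy
      rintro l ⟨h3, h4⟩
      have : ∃ l0 : List V, l0.map f = l := by
        have := h2 _ h4
        simp only [List.mem_toFinset] at this
        clear h3 h4
        induction l with
        | nil => exact ⟨[], rfl⟩
        | cons u l ih =>
          obtain ⟨v, rfl⟩ := this u (by simp)
          obtain ⟨l0, rfl⟩ := ih fun u hu => this u (by simp [hu])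
          exact ⟨v :: l0, rfl⟩
      obtain ⟨l0, rfl⟩ := this
      rw [htf, h1] at h4
      refine ⟨Finsupp.single l0 1, single_mem ⟨by simpa using h3, h4⟩, ?_⟩
      rw [fm_single]; rfl
    exact this
  constructor
  · intro hv z hz hz0
    obtain ⟨x, hx, rfl⟩ := hs n z hz
    obtain ⟨c, hc, rfl⟩ := hv x hx (hinj (by rw [fm_bd, hz0, map_zero]))
    exact ⟨fm f c, hm _ c hc, (fm_bd f c).symm⟩
  · intro hv z hz hz0
    obtain ⟨c, hc, hcz⟩ := hv _ (hm n z hz) (by rw [← fm_bd, hz0, map_zero])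
    obtain ⟨x, hx, rfl⟩ := hs _ c hc
    exact ⟨x, hx, hinj (by rw [fm_bd, hcz])⟩

/-! Comparison with the frozen definitions -/

lemma bl_ofFn {V : Type*} : ∀ (n : ℕ) (σ : Fin (n + 1) → V),
    bl (List.ofFn σ) = ∑ i : Fin (n + 1),
      ((-1 : ℚ) ^ (i : ℕ)) • Finsupp.single (List.ofFn (σ ∘ i.succAbove)) (1 : ℚ) := by
  intro n
  induction n with
  | zero =>
    intro σ
    simp [List.ofFn_succ, bl]
  | succ n ih =>
    intro σ
    rw [List.ofFn_succ, bl, ih, map_sum, sub_eq_add_neg, ← Finset.sum_neg_distrib]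
    conv_rhs => rw [Fin.sum_univ_succ]
    congr 1
    · simp [Function.comp_def]
    · refine Finset.sum_congr rfl fun i _ => ?_
      rw [map_smul, pre_single, Fin.val_succ, pow_succ]
      rw [List.ofFn_succ (f := σ ∘ i.succ.succAbove)]
      simp [Function.comp_def]

noncomputable def jj {V : Type*} [DecidableEq V] (X : Set (Finset V)) (n : ℕ) :
    Chains X n →ₗ[ℚ] Ch V := Finsupp.lmapDomain ℚ ℚ (fun τ : Tup X n => List.ofFn τ.1)

lemma jj_inj {V : Type*} [DecidableEq V] (X : Set (Finset V)) (n : ℕ) :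
    Function.Injective (jj X n) :=
  Finsupp.mapDomain_injective fun a b h => Subtype.ext (List.ofFn_injective h)

lemma jj_single {V : Type*} [DecidableEq V] (X : Set (Finset V)) (n : ℕ) (τ : Tup X n) (a : ℚ) :
    jj X n (Finsupp.single τ a) = Finsupp.single (List.ofFn τ.1) a := by
  simp [jj, Finsupp.mapDomain_single]

lemma toFinset_ofFn' {V : Type*} [DecidableEq V] {n : ℕ} (σ : Fin n → V) :
    (List.ofFn σ).toFinset = Finset.image σ Finset.univ := by
  ext x; simp [List.mem_ofFn]

lemma jj_mem {V : Type*} [DecidableEq V] (X : Set (Finset V)) (n : ℕ) (x : Chains X n) :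
    jj X n x ∈ C X n := by
  induction x using Finsupp.induction_linear with
  | zero => simp
  | add f g hf hg => rw [map_add]; exact Submodule.add_mem _ hf hg
  | single τ a =>
    rw [jj_single]
    exact single_mem ⟨by simp, by rw [toFinset_ofFn']; exact τ.2⟩

lemma jj_surj {V : Type*} [DecidableEq V] (X : Set (Finset V)) (n : ℕ) (y : Ch V)
    (hy : y ∈ C X n) : ∃ x, jj X n x = y := by
  have : (LinearMap.id : Ch V →ₗ[ℚ] Ch V) y ∈ LinearMap.range (jj X n) := by
    refine map_mem _ ?_ hy
    rintro l ⟨rfl, h2⟩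
    refine ⟨Finsupp.single ⟨l.get, ?_⟩ 1, ?_⟩
    · rw [← toFinset_ofFn', List.ofFn_get]; exact h2
    · refine (jj_single X l.length _ 1).trans ?_
      simp [List.ofFn_get]
  exact this

lemma jj_bdry {V : Type*} [DecidableEq V] {X : Set (Finset V)} (hX : IsComplex X) (n : ℕ)
    (x : Chains X (n + 1)) : jj X n (bdry X n x) = bd (jj X (n + 1) x) := by
  have : jj X n ∘ₗ bdry X n = bd ∘ₗ jj X (n + 1) := by
    apply Finsupp.lhom_ext'
    intro σ
    apply LinearMap.ext_ring
    simp only [LinearMap.comp_apply, Finsupp.lsingle_apply, jj_single, bd_single, bl_ofFn]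
    simp only [bdry, Finsupp.lsum_single, LinearMap.toSpanSingleton_apply, one_smul, map_sum,
      map_smul]
    refine Finset.sum_congr rfl fun i _ => ?_
    have h : Finset.image (σ.1 ∘ i.succAbove) Finset.univ ∈ X := by
      refine hX _ σ.2 _ ?_
      intro x hx
      obtain ⟨y, -, rfl⟩ := Finset.mem_image.1 hx
      exact Finset.mem_image_of_mem _ (Finset.mem_univ _)
    rw [gen, dif_pos h]
    exact congrArg _ (jj_single X n (⟨_, h⟩ : Tup X n) 1)
  exact LinearMap.congr_fun this x

lemma hv_iff {V : Type*} [DecidableEq V] {X : Set (Finset V)} (hX : IsComplex X) (i : ℕ) :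
    HomologyVanishes X i ↔ Van X (i + 1) := by
  have h0 : HomologyVanishes X i ↔
      ∀ z : Chains X (i + 1), bdry X i z = 0 → ∃ c, bdry X (i + 1) c = z := by
    constructor
    · intro h z hz
      have := h (Submodule.Quotient.mk ⟨z, hz⟩)
      rw [Submodule.Quotient.mk_eq_zero] at this
      exact this
    · intro h x
      obtain ⟨⟨z, hz⟩, rfl⟩ := Submodule.Quotient.mk_surjective _ x
      rw [Submodule.Quotient.mk_eq_zero]
      exact h z hz
  rw [h0]
  constructor
  · intro h z hz hz0
    obtain ⟨x, rfl⟩ := jj_surj X _ z hz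
    obtain ⟨c, rfl⟩ := h x (jj_inj X i (by rw [jj_bdry hX, hz0, map_zero]))
    exact ⟨jj X _ c, jj_mem _ _ _, (jj_bdry hX _ c).symm⟩
  · intro h z hz
    obtain ⟨c, hc, hcz⟩ := h (jj X _ z) (jj_mem _ _ _) (by rw [← jj_bdry hX, hz, map_zero])
    obtain ⟨x, rfl⟩ := jj_surj X _ c hc
    exact ⟨x, jj_inj X _ (by rw [jj_bdry hX, hcz])⟩

lemma Ler_iff {V : Type*} [DecidableEq V] {X : Set (Finset V)} (hX : IsComplex X) (d : ℕ) :
    Ler d X ↔ ∀ S : Finset V, ∀ i, d ≤ i → HomologyVanishes (induced X S) i := by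
  constructor
  · intro h S i hi
    rw [hv_iff (induced_complex hX S)]
    exact h S _ (by omega)
  · intro h S n hn
    obtain ⟨n, rfl⟩ : ∃ k, n = k + 1 := ⟨n - 1, by omega⟩
    rw [← hv_iff (induced_complex hX S)]
    exact h S _ (by omega)

lemma Ler_leray {V : Type*} [DecidableEq V] [Fintype V] {X : Set (Finset V)} (hX : IsComplex X) :
    Ler (lerayNumber X) X := by
  rw [Ler_iff hX]
  exact Nat.sInf_mem (s := {d | ∀ S : Finset V, ∀ i, d ≤ i → HomologyVanishes (induced X S) i})
    ⟨_, (Ler_iff hX _).1 (Ler_card hX)⟩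

/-! The join -/

/-- the copy of `X` in coordinate `s` -/
def cp {W V : Type*} [DecidableEq W] [DecidableEq V] [Fintype V] {k : ℕ} (s : Fin k)
    (X : Set (Finset V)) : Set (Finset (W ⊕ V × Fin k)) :=
  {σ | (∀ u ∈ σ, ∃ v, u = Sum.inr (v, s)) ∧
    Finset.univ.filter (fun v => Sum.inr (v, s) ∈ σ) ∈ X}

lemma cp_complex {W V : Type*} [DecidableEq W] [DecidableEq V] [Fintype V] {k : ℕ} (s : Fin k)
    {X : Set (Finset V)} (hX : IsComplex X) : IsComplex (cp (W := W) s X) := by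
  rintro σ ⟨h1, h2⟩ τ hτ
  refine ⟨fun u hu => h1 u (hτ hu), hX _ h2 _ ?_⟩
  intro v hv
  simp only [Finset.mem_filter, Finset.mem_univ, true_and] at hv ⊢
  exact hτ hv

lemma cp_Ler {W V : Type*} [DecidableEq W] [DecidableEq V] [Fintype V] {k : ℕ} (s : Fin k)
    {X : Set (Finset V)} {d : ℕ} (h : Ler d X) : Ler d (cp (W := W) s X) := by
  intro S n hn
  refine (transfer (fun v : V => (Sum.inr (v, s) : W ⊕ V × Fin k)) (fun a b h => by simpa using h)
    ?_ ?_ n).1 (h (Finset.univ.filter (fun v => Sum.inr (v, s) ∈ S)) n hn)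
  · intro σ
    have e : Finset.univ.filter (fun v => (Sum.inr (v, s) : W ⊕ V × Fin k) ∈
        σ.image (fun v : V => (Sum.inr (v, s) : W ⊕ V × Fin k))) = σ := by
      ext v; simp
    simp only [induced, cp, Set.mem_ofPred_eq, e]
    constructor
    · rintro ⟨⟨-, h2⟩, h3⟩
      refine ⟨h2, fun v hv => ?_⟩
      simpa using h3 (Finset.mem_image_of_mem _ hv)
    · rintro ⟨h2, h3⟩
      refine ⟨⟨?_, h2⟩, ?_⟩
      · intro u hu
        obtain ⟨v, -, rfl⟩ := Finset.mem_image.1 hu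
        exact ⟨v, rfl⟩
      · intro u hu
        obtain ⟨v, hv, rfl⟩ := Finset.mem_image.1 hu
        simpa using h3 hv
  · rintro σ ⟨⟨h1, -⟩, -⟩ u hu
    obtain ⟨v, rfl⟩ := h1 u hu
    exact ⟨v, rfl⟩

/-- join of the coordinates in `I` -/
def Jn {W V : Type*} [DecidableEq W] [DecidableEq V] [Fintype V] {k : ℕ} (I : Finset (Fin k))
    (Xs : Fin k → Set (Finset V)) : Set (Finset (W ⊕ V × Fin k)) :=
  {σ | (∀ u ∈ σ, ∃ v, ∃ s ∈ I, u = Sum.inr (v, s)) ∧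
    ∀ s ∈ I, Finset.univ.filter (fun v => Sum.inr (v, s) ∈ σ) ∈ Xs s}

lemma Jn_complex {W V : Type*} [DecidableEq W] [DecidableEq V] [Fintype V] {k : ℕ}
    (I : Finset (Fin k)) {Xs : Fin k → Set (Finset V)} (hX : ∀ s, IsComplex (Xs s)) :
    IsComplex (Jn (W := W) I Xs) := by
  rintro σ ⟨h1, h2⟩ τ hτ
  refine ⟨fun u hu => h1 u (hτ hu), fun s hs => hX s _ (h2 s hs) _ ?_⟩
  intro v hv
  simp only [Finset.mem_filter, Finset.mem_univ, true_and] at hv ⊢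
  exact hτ hv

lemma Jn_Ler {W V : Type*} [DecidableEq W] [DecidableEq V] [Fintype V] {k : ℕ}
    (I : Finset (Fin k)) {Xs : Fin k → Set (Finset V)} (hX : ∀ s, IsComplex (Xs s))
    (a : Fin k → ℕ) (ha : ∀ s, Ler (a s) (Xs s)) :
    Ler (∑ s ∈ I, a s) (Jn (W := W) I Xs) := by
  classical
  induction I using Finset.induction_on with
  | empty =>
    intro S n hn z hz _
    have : z = 0 := map_eq_zero LinearMap.id (by
      rintro l ⟨h1, ⟨h2, -⟩, -⟩
      have : l = [] := by
        rw [List.eq_nil_iff_forall_not_mem]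
        intro x hx
        obtain ⟨v, s, hs, -⟩ := h2 x (by simpa using hx)
        simp at hs
      subst this
      simp at h1 hn
      omega) hz
    exact ⟨0, Submodule.zero_mem _, by simp [this]⟩
  | insert s I hs ih =>
    intro S n hn
    rw [Finset.sum_insert hs, add_comm] at hn
    obtain ⟨A, hA⟩ : ∃ A : Set (W ⊕ V × Fin k), ∀ u, u ∈ A ↔ ∃ v, ∃ t ∈ I, u = Sum.inr (v, t) :=
      ⟨{u | ∃ v, ∃ t ∈ I, u = Sum.inr (v, t)}, fun _ => Iff.rfl⟩
    refine join_van (X := induced (Jn I Xs) S) (Y := induced (cp s (Xs s)) S)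
      (induced_complex (Jn_complex I hX) S) (induced_complex (cp_complex s (hX s)) S)
      (induced_complex (Jn_complex _ hX) S) A ?_ ?_ ?_
      (fun n hn => ih S n hn) (fun n hn => cp_Ler s (ha s) S n hn) hn
    · rintro σ ⟨⟨h1, h2⟩, h3⟩
      refine ⟨⟨fun u hu => (hA u).1 (Finset.mem_filter.1 hu).2, fun t ht => ?_⟩,
        (Finset.filter_subset _ _).trans h3⟩
      refine hX t _ (h2 t (Finset.mem_insert_of_mem ht)) _ ?_
      intro v hv
      simp only [Finset.mem_filter, Finset.mem_univ, true_and] at hv ⊢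
      exact hv.1
    · rintro σ ⟨⟨h1, h2⟩, h3⟩
      refine ⟨⟨fun u hu => ?_, ?_⟩, (Finset.filter_subset _ _).trans h3⟩
      · obtain ⟨h4, h5⟩ := Finset.mem_filter.1 hu
        obtain ⟨v, t, ht, rfl⟩ := h1 u h4
        rcases Finset.mem_insert.1 ht with rfl | ht
        · exact ⟨v, rfl⟩
        · exact absurd ((hA _).2 ⟨v, t, ht, rfl⟩) h5
      · refine hX s _ (h2 s (Finset.mem_insert_self _ _)) _ ?_
        intro v hv
        simp only [Finset.mem_filter, Finset.mem_univ, true_and] at hv ⊢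
        exact hv.1
    · rintro σ ⟨⟨h1, h2⟩, h3⟩ τ ⟨⟨h4, h5⟩, h6⟩
      refine ⟨⟨fun u hu => ?_, fun t ht => ?_⟩, Finset.union_subset h3 h6⟩
      · rcases Finset.mem_union.1 hu with hu | hu
        · obtain ⟨v, t, ht, rfl⟩ := h1 u hu
          exact ⟨v, t, Finset.mem_insert_of_mem ht, rfl⟩
        · obtain ⟨v, rfl⟩ := h4 u hu
          exact ⟨v, s, Finset.mem_insert_self _ _, rfl⟩
      · rcases Finset.mem_insert.1 ht with rfl | ht
        · refine hX _ _ h5 _ ?_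
          intro v hv
          simp only [Finset.mem_filter, Finset.mem_univ, true_and] at hv ⊢
          rcases Finset.mem_union.1 hv with hv | hv
          · obtain ⟨v', t', ht', e⟩ := h1 _ hv
            simp only [Sum.inr.injEq, Prod.mk.injEq] at e
            exact absurd (e.2 ▸ ht') hs
          · exact hv
        · refine hX _ _ (h2 t ht) _ ?_
          intro v hv
          simp only [Finset.mem_filter, Finset.mem_univ, true_and] at hv ⊢
          rcases Finset.mem_union.1 hv with hv | hv
          · exact hv
          · obtain ⟨v', e⟩ := h4 _ hv
            simp only [Sum.inr.injEq, Prod.mk.injEq] at e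
            exact absurd (e.2 ▸ ht) hs

/-! The stages -/

abbrev WW {V : Type*} {m : ℕ} (k : ℕ) (p : V → Fin m) :=
  (i : Fin m) × {w : Fin k → V // ∀ s, p (w s) = i}

abbrev UU {V : Type*} {m : ℕ} (k : ℕ) (p : V → Fin m) := WW k p ⊕ V × Fin k

open Classical in
noncomputable def tr {V : Type*} [DecidableEq V] [Fintype V] {m k : ℕ} (p : V → Fin m)
    (T : Finset (UU k p)) (s : Fin k) : Finset V :=
  Finset.univ.filter (fun v => Sum.inr (v, s) ∈ T ∨ ∃ w : WW k p, Sum.inl w ∈ T ∧ w.2.1 s = v)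

lemma mem_tr {V : Type*} [DecidableEq V] [Fintype V] {m k : ℕ} {p : V → Fin m}
    {T : Finset (UU k p)} {s : Fin k} {v : V} :
    v ∈ tr p T s ↔ Sum.inr (v, s) ∈ T ∨ ∃ w : WW k p, Sum.inl w ∈ T ∧ w.2.1 s = v := by
  simp [tr]

lemma tr_mono {V : Type*} [DecidableEq V] [Fintype V] {m k : ℕ} {p : V → Fin m}
    {T T' : Finset (UU k p)} (h : T ⊆ T') (s : Fin k) : tr p T s ⊆ tr p T' s := by
  intro v hv
  rw [mem_tr] at hv ⊢
  rcases hv with hv | ⟨w, hw, e⟩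
  · exact Or.inl (h hv)
  · exact Or.inr ⟨w, h hw, e⟩

def ZZ {V : Type*} [DecidableEq V] [Fintype V] {m k : ℕ} (p : V → Fin m)
    (Xs : Fin k → Set (Finset V)) (r : ℕ) : Set (Finset (UU k p)) :=
  {T | (∀ w : WW k p, Sum.inl w ∈ T → w.1.val < r) ∧
    (∀ v s, (Sum.inr (v, s) : UU k p) ∈ T → r ≤ (p v).val) ∧
    (∀ w w' : WW k p, Sum.inl w ∈ T → Sum.inl w' ∈ T → w.1 = w'.1 → w = w') ∧
    ∀ s, tr p T s ∈ Xs s}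

lemma ZZ_complex {V : Type*} [DecidableEq V] [Fintype V] {m k : ℕ} (p : V → Fin m)
    {Xs : Fin k → Set (Finset V)} (hX : ∀ s, IsComplex (Xs s)) (r : ℕ) :
    IsComplex (ZZ p Xs r) := by
  rintro T ⟨h1, h2, h3, h4⟩ T' hT
  exact ⟨fun w hw => h1 w (hT hw), fun v s hv => h2 v s (hT hv),
    fun w w' hw hw' => h3 w w' (hT hw) (hT hw'), fun s => hX s _ (h4 s) _ (tr_mono hT s)⟩

lemma ZZ_zero {V : Type*} [DecidableEq V] [Fintype V] {m k : ℕ} (p : V → Fin m)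
    (Xs : Fin k → Set (Finset V)) : ZZ p Xs 0 = Jn Finset.univ Xs := by
  ext T
  have e : (∀ w : WW k p, Sum.inl w ∉ T) → ∀ s, tr p T s =
      Finset.univ.filter (fun v => (Sum.inr (v, s) : UU k p) ∈ T) := by
    intro h s
    ext v
    rw [mem_tr]
    simp only [Finset.mem_filter, Finset.mem_univ, true_and]
    constructor
    · rintro (hv | ⟨w, hw, -⟩)
      · exact hv
      · exact absurd hw (h w)
    · exact Or.inl
  constructor
  · rintro ⟨h1, h2, h3, h4⟩
    have h5 : ∀ w : WW k p, Sum.inl w ∉ T := fun w hw => by have := h1 w hw; omega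
    refine ⟨fun u hu => ?_, fun s _ => ?_⟩
    · rcases u with w | ⟨v, s⟩
      · exact absurd hu (h5 w)
      · exact ⟨v, s, Finset.mem_univ _, rfl⟩
    · have := h4 s
      rwa [e h5] at this
  · rintro ⟨h1, h2⟩
    have h5 : ∀ w : WW k p, Sum.inl w ∉ T := fun w hw => by
      obtain ⟨v, s, -, h⟩ := h1 _ hw
      simp at h
    refine ⟨fun w hw => absurd hw (h5 w), fun _ _ _ => Nat.zero_le _,
      fun w w' hw => absurd hw (h5 w), fun s => ?_⟩
    rw [e h5]
    exact h2 s (Finset.mem_univ _)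

def gg {V : Type*} {m k : ℕ} (p : V → Fin m) : UU k p → Fin k → UU k p
  | Sum.inl w, s => Sum.inr (w.2.1 s, s)
  | Sum.inr x, _ => Sum.inr x

lemma ZZ_step {V : Type*} [DecidableEq V] [Fintype V] {m k : ℕ} (p : V → Fin m)
    {Xs : Fin k → Set (Finset V)} (hX : ∀ s, IsComplex (Xs s))
    (hjoin : ∀ s, ∀ t ∈ Xs s, ∀ v ∈ t, ∀ w ∈ t, p v = p w → v = w) {d : ℕ} (r : ℕ)
    (h : Ler d (ZZ p Xs r)) : Ler d (ZZ p Xs (r + 1)) := by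
  classical
  refine Merge (ZZ_complex p hX r) (ZZ_complex p hX (r + 1)) h
    (fun s => {u | ∃ v, u = Sum.inr (v, s) ∧ (p v).val = r}) ?_ ?_
    {u | ∃ w, u = Sum.inl w ∧ w.1.val = r} ?_ (gg p) ?_ ?_ ?_ ?_
  · rintro s T ⟨-, -, -, h4⟩ _ hb _ hb' ⟨v, rfl, hv⟩ ⟨v', rfl, hv'⟩
    rw [hjoin s _ (h4 s) v (mem_tr.2 (Or.inl hb)) v' (mem_tr.2 (Or.inl hb'))
      (Fin.ext (hv.trans hv'.symm))]
  · intro s t hst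
    rw [Set.disjoint_left]
    rintro _ ⟨v, rfl, -⟩ ⟨v', e, -⟩
    simp only [Sum.inr.injEq, Prod.mk.injEq] at e
    exact hst e.2
  · rintro T ⟨-, -, h3, -⟩ _ hb _ hb' ⟨w, rfl, hw⟩ ⟨w', rfl, hw'⟩
    rw [h3 w w' hb hb' (Fin.ext (hw.trans hw'.symm))]
  · rintro _ ⟨w, rfl, hw⟩ s
    exact ⟨w.2.1 s, rfl, by rw [w.2.2 s]; exact hw⟩
  · rintro _ ⟨⟨i, w, hw⟩, rfl, hi⟩ _ ⟨⟨i', w', hw'⟩, rfl, hi'⟩ e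
    have hii : i = i' := Fin.ext (hi.trans hi'.symm)
    subst hii
    have : w = w' := by
      funext s
      have := congrFun e s
      simp only [gg, Sum.inr.injEq, Prod.mk.injEq] at this
      exact this.1
    subst this
    rfl
  · ext T
    constructor
    · rintro ⟨⟨h1, h2, h3, h4⟩, h5⟩
      refine ⟨⟨fun w hw => ?_, fun v s hv => ?_, h3, h4⟩, fun b hb hb' => ?_⟩
      · have h6 := h1 w hw
        have h7 : w.1.val ≠ r := fun h => h5 _ hw ⟨w, rfl, h⟩
        omega
      · have := h2 v s hv
        omega
      · obtain ⟨s, v, rfl, hv⟩ := Set.mem_iUnion.1 hb'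
        have := h2 v s hb
        omega
    · rintro ⟨⟨h1, h2, h3, h4⟩, h5⟩
      refine ⟨⟨fun w hw => ?_, fun v s hv => ?_, h3, h4⟩, fun b hb hb' => ?_⟩
      · have h6 := h1 w hw
        omega
      · have h6 := h2 v s hv
        have h7 : (p v).val ≠ r := fun h => h5 _ hv (Set.mem_iUnion.2 ⟨s, v, rfl, h⟩)
        omega
      · obtain ⟨w, rfl, hw⟩ := hb'
        have := h1 w hb
        omega
  · rintro _ ⟨w, rfl, hw⟩
    have him : ∀ u, u ∈ Finset.univ.image (gg p (Sum.inl w)) ↔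
        ∃ s, u = Sum.inr (w.2.1 s, s) := by
      intro u
      simp [gg, eq_comm]
    have hpw : ∀ s, (p (w.2.1 s)).val = r := fun s => by rw [w.2.2 s]; exact hw
    ext T
    constructor
    · rintro ⟨h0, h1, h2, h3, h4⟩
      refine ⟨?_, fun w' hw' => ?_, fun v s hv => ?_, fun w1 w2 hw1 hw2 => ?_, fun s => ?_⟩
      · rw [Finset.disjoint_left]
        intro u hu hu'
        obtain ⟨s, rfl⟩ := (him u).1 hu'
        have := h2 _ _ (Finset.mem_insert_of_mem hu)
        have := hpw s
        omega
      · rcases Finset.mem_union.1 hw' with hw' | hw'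
        · have h6 := h1 w' (Finset.mem_insert_of_mem hw')
          have h7 : w'.1.val ≠ r := fun h => h0 (by
            rw [h3 w w' (Finset.mem_insert_self _ _) (Finset.mem_insert_of_mem hw')
              (Fin.ext (hw.trans h.symm))]
            exact hw')
          omega
        · obtain ⟨s, hs⟩ := (him _).1 hw'
          simp at hs
      · rcases Finset.mem_union.1 hv with hv | hv
        · have := h2 v s (Finset.mem_insert_of_mem hv)
          omega
        · obtain ⟨s', hs⟩ := (him _).1 hv
          simp only [Sum.inr.injEq, Prod.mk.injEq] at hs
          rw [hs.1, hpw]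
      · have aux : ∀ w' : WW k p, Sum.inl w' ∈ T ∪ Finset.univ.image (gg p (Sum.inl w)) →
            Sum.inl w' ∈ T := by
          intro w' hw'
          rcases Finset.mem_union.1 hw' with hw' | hw'
          · exact hw'
          · obtain ⟨s, hs⟩ := (him _).1 hw'
            simp at hs
        exact h3 w1 w2 (Finset.mem_insert_of_mem (aux _ hw1)) (Finset.mem_insert_of_mem (aux _ hw2))
      · refine hX s _ (h4 s) _ ?_
        intro v hv
        rw [mem_tr] at hv ⊢
        rcases hv with hv | ⟨w', hw', e⟩
        · rcases Finset.mem_union.1 hv with hv | hv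
          · exact Or.inl (Finset.mem_insert_of_mem hv)
          · obtain ⟨s', hs⟩ := (him _).1 hv
            simp only [Sum.inr.injEq, Prod.mk.injEq] at hs
            obtain ⟨rfl, rfl⟩ := hs
            exact Or.inr ⟨w, Finset.mem_insert_self _ _, rfl⟩
        · rcases Finset.mem_union.1 hw' with hw' | hw'
          · exact Or.inr ⟨w', Finset.mem_insert_of_mem hw', e⟩
          · obtain ⟨s, hs⟩ := (him _).1 hw'
            simp at hs
    · rintro ⟨h0, h1, h2, h3, h4⟩
      rw [Finset.disjoint_left] at h0
      have hwT : Sum.inl w ∉ T := fun h => by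
        have := h1 w (Finset.mem_union_left _ h)
        omega
      refine ⟨hwT, fun w' hw' => ?_, fun v s hv => ?_, fun w1 w2 hw1 hw2 e => ?_, fun s => ?_⟩
      · rcases Finset.mem_insert.1 hw' with hw' | hw'
        · rw [Sum.inl.inj hw']; omega
        · have := h1 w' (Finset.mem_union_left _ hw')
          omega
      · rcases Finset.mem_insert.1 hv with hv | hv
        · simp at hv
        · have h6 := h2 v s (Finset.mem_union_left _ hv)
          have h7 : (p v).val ≠ r := fun h => by
            have hmem : (Sum.inr (w.2.1 s, s) : UU k p) ∈
              Finset.univ.image (gg p (Sum.inl w)) := (him _).2 ⟨s, rfl⟩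
            have := hjoin s _ (h4 s) v (mem_tr.2 (Or.inl (Finset.mem_union_left _ hv)))
              (w.2.1 s) (mem_tr.2 (Or.inl (Finset.mem_union_right _ hmem)))
              (Fin.ext (h.trans (hpw s).symm))
            exact h0 hv (by rw [this]; exact hmem)
          omega
      · rcases Finset.mem_insert.1 hw1 with hw1 | hw1
        · rcases Finset.mem_insert.1 hw2 with hw2 | hw2
          · rw [Sum.inl.inj hw1, Sum.inl.inj hw2]
          · have h5 := h1 w2 (Finset.mem_union_left _ hw2)
            have h6 := Sum.inl.inj hw1
            rw [← e, h6] at h5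
            omega
        · rcases Finset.mem_insert.1 hw2 with hw2 | hw2
          · have h5 := h1 w1 (Finset.mem_union_left _ hw1)
            have h6 := Sum.inl.inj hw2
            rw [e, h6] at h5
            omega
          · exact h3 w1 w2 (Finset.mem_union_left _ hw1) (Finset.mem_union_left _ hw2) e
      · refine hX s _ (h4 s) _ ?_
        intro v hv
        rw [mem_tr] at hv ⊢
        rcases hv with hv | ⟨w', hw', e⟩
        · rcases Finset.mem_insert.1 hv with hv | hv
          · simp at hv
          · exact Or.inl (Finset.mem_union_left _ hv)
        · rcases Finset.mem_insert.1 hw' with hw' | hw'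
          · have h6 := Sum.inl.inj hw'
            subst h6
            subst e
            exact Or.inl (Finset.mem_union_right _ ((him _).2 ⟨s, rfl⟩))
          · exact Or.inr ⟨w', Finset.mem_union_left _ hw', e⟩

lemma main_van {V : Type*} [DecidableEq V] [Fintype V] {m k : ℕ} (p : V → Fin m)
    {Xs : Fin k → Set (Finset V)} (hX : ∀ s, IsComplex (Xs s))
    (hjoin : ∀ s, ∀ t ∈ Xs s, ∀ v ∈ t, ∀ w ∈ t, p v = p w → v = w) (n : ℕ)
    (hn : ∑ s, lerayNumber (Xs s) < n) : Van (Mcplx p Xs) n := by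
  classical
  have hL : ∀ r, Ler (∑ s, lerayNumber (Xs s)) (ZZ p Xs r) := by
    intro r
    induction r with
    | zero =>
      rw [ZZ_zero]
      exact Jn_Ler Finset.univ hX _ fun s => Ler_leray (hX s)
    | succ r ih => exact ZZ_step p hX hjoin r ih
  refine (transfer (fun w : WW k p => (Sum.inl w : UU k p)) Sum.inl_injective ?_ ?_ n).2
    ((hL m).van hn)
  · intro T
    have e : ∀ s, tr p (T.image (fun w : WW k p => (Sum.inl w : UU k p))) s =
        T.image (fun w => w.2.1 s) := by
      intro s
      ext v
      rw [mem_tr]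
      simp
    simp only [ZZ, Mcplx, Set.mem_ofPred_eq, e]
    constructor
    · rintro ⟨-, -, h3, h4⟩
      exact ⟨fun w hw w' hw' => h3 w w' (Finset.mem_image_of_mem _ hw)
        (Finset.mem_image_of_mem _ hw'), h4⟩
    · rintro ⟨h3, h4⟩
      have aux : ∀ w : WW k p, Sum.inl w ∈ T.image (fun w : WW k p => (Sum.inl w : UU k p)) →
          w ∈ T := by
        intro w hw
        obtain ⟨w', hw', e⟩ := Finset.mem_image.1 hw
        rw [← Sum.inl.inj e]; exact hw'
      refine ⟨fun w _ => w.1.isLt, fun v s hv => ?_, fun w w' hw hw' =>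
        h3 w (aux w hw) w' (aux w' hw'), h4⟩
      obtain ⟨w', hw', e⟩ := Finset.mem_image.1 hv
      simp at e
  · rintro T ⟨-, h2, -, -⟩ u hu
    rcases u with w | ⟨v, s⟩
    · exact ⟨w, rfl⟩
    · have := h2 v s hu
      have := (p v).isLt
      omega

lemma Mcplx_complex {V : Type*} [DecidableEq V] {m k : ℕ} (p : V → Fin m)
    {Xs : Fin k → Set (Finset V)} (hX : ∀ s, IsComplex (Xs s)) : IsComplex (Mcplx p Xs) := by
  rintro T ⟨h1, h2⟩ T' hT
  exact ⟨fun w hw w' hw' => h1 w (hT hw) w' (hT hw'),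
    fun s => hX s _ (h2 s) _ (Finset.image_subset_image hT)⟩

end LC

/-- `H̃_j(M(X_1,…,X_k);ℚ) = 0` for all `j ≥ Σ L(X_i)`. -/
theorem stmt4 {V : Type*} [DecidableEq V] [Fintype V] {m k : ℕ} (p : V → Fin m)
    (Xs : Fin k → Set (Finset V)) (hXs : ∀ s, IsComplex (Xs s))
    (hjoin : ∀ s, ∀ t ∈ Xs s, ∀ v ∈ t, ∀ w ∈ t, p v = p w → v = w) :
    ∀ j : ℕ, (∑ s, lerayNumber (Xs s)) ≤ j → HomologyVanishes (Mcplx p Xs) j := by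
  intro j hj
  rw [LC.hv_iff (LC.Mcplx_complex p hXs)]
  exact LC.main_van p hXs hjoin _ (by omega)
end
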